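/- Let V be a two-dimensional algebraic surface of degree D > 1 in ℝ³ with no linear components, P a set of m points on V, and L a set of n lines fully contained in V. Then there is a subset L₀ ⊆ L of size O(D²) such that I(P, L \ L₀) = O(m^{1/2} n^{1/2} D^{1/2} + m + n). -/

import Mathlib

open MvPolynomial
open scoped Classical

/-- The line through `p` with direction `v` in ℝ³. -/
def lineThrough (p v : Fin 3 → ℝ) : Set (Fin 3 → ℝ) := {q | ∃ t : ℝ, q = p + t • v}

/-- `ℓ` is a line in ℝ³. -/
def IsLine (ℓ : Set (Fin 3 → ℝ)) : Prop := ∃ p v : Fin 3 → ℝ, v ≠ 0 ∧ ℓ = lineThrough p v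

/-- `ℓ` is a line fully contained in `V`. -/
def IsLineIn (V ℓ : Set (Fin 3 → ℝ)) : Prop := IsLine ℓ ∧ ℓ ⊆ V

/-- An exceptional line of `V`: a line fully contained in `V` containing
infinitely many points each incident to another line fully contained in `V`. -/
def IsExceptionalLine (V ℓ : Set (Fin 3 → ℝ)) : Prop :=
  IsLineIn V ℓ ∧ {p ∈ ℓ | ∃ ℓ', IsLineIn V ℓ' ∧ ℓ' ≠ ℓ ∧ p ∈ ℓ'}.Infinite

/-- An exceptional point (apex) of `V`: a point incident to infinitely many
lines fully contained in `V`. -/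
def IsExceptionalPoint (V : Set (Fin 3 → ℝ)) (p : Fin 3 → ℝ) : Prop :=
  {ℓ : Set (Fin 3 → ℝ) | IsLineIn V ℓ ∧ p ∈ ℓ}.Infinite

/-- `Λ_V(p)`: the number of generator lines (non-exceptional lines fully
contained in `V`) through `p`, set to `0` at an exceptional point (apex). -/
noncomputable def ΛV (V : Set (Fin 3 → ℝ)) (p : Fin 3 → ℝ) : ℕ :=
  if IsExceptionalPoint V p then 0
  else {ℓ : Set (Fin 3 → ℝ) | IsLineIn V ℓ ∧ ¬ IsExceptionalLine V ℓ ∧ p ∈ ℓ}.ncard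

/-- `Λ*_V(p) = max {0, Λ_V(p) − 1}` (truncated subtraction). -/
noncomputable def ΛVstar (V : Set (Fin 3 → ℝ)) (p : Fin 3 → ℝ) : ℕ := ΛV V p - 1

/-- `V` is ruled by lines: every point lies on a line fully contained in `V`. -/
def IsRuled (V : Set (Fin 3 → ℝ)) : Prop := ∀ p ∈ V, ∃ ℓ, IsLineIn V ℓ ∧ p ∈ ℓ

/-- `V` is a plane (2-flat) in ℝ³. -/
def IsPlane (V : Set (Fin 3 → ℝ)) : Prop :=
  ∃ p u v : Fin 3 → ℝ, LinearIndependent ℝ ![u, v] ∧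
    V = {q | ∃ a b : ℝ, q = p + a • u + b • v}

/-- Two lines are skew: disjoint and non-parallel. -/
def SkewLines (ℓ₁ ℓ₂ : Set (Fin 3 → ℝ)) : Prop :=
  IsLine ℓ₁ ∧ IsLine ℓ₂ ∧ ℓ₁ ∩ ℓ₂ = ∅ ∧
    ∀ p₁ v₁ p₂ v₂ : Fin 3 → ℝ, v₁ ≠ 0 → v₂ ≠ 0 →
      ℓ₁ = lineThrough p₁ v₁ → ℓ₂ = lineThrough p₂ v₂ → ¬ ∃ c : ℝ, v₂ = c • v₁

/-- `V` is a regulus: the union of all lines meeting three pairwise skew lines. -/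
def IsRegulus (V : Set (Fin 3 → ℝ)) : Prop :=
  ∃ ℓ₁ ℓ₂ ℓ₃ : Set (Fin 3 → ℝ), SkewLines ℓ₁ ℓ₂ ∧ SkewLines ℓ₁ ℓ₃ ∧ SkewLines ℓ₂ ℓ₃ ∧
    V = ⋃₀ {ℓ | IsLine ℓ ∧ (ℓ ∩ ℓ₁).Nonempty ∧ (ℓ ∩ ℓ₂).Nonempty ∧ (ℓ ∩ ℓ₃).Nonempty}

open MvPolynomial
open scoped Classical

lemma finrank_restr (n k : ℕ) :
    Module.finrank ℝ (restrictTotalDegree (Fin n) ℝ k) = (k + n).choose n := by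
  have b := basisRestrictSupport ℝ { s : Fin n →₀ ℕ | (s.sum fun _ e => e) ≤ k }
  have h1 : Module.finrank ℝ (restrictTotalDegree (Fin n) ℝ k)
      = Nat.card { s : Fin n →₀ ℕ | (s.sum fun _ e => e) ≤ k } :=
    Module.finrank_eq_nat_card_basis b
  rw [h1]
  have h2 : { s : Fin n →₀ ℕ | (s.sum fun _ e => e) ≤ k }
      = (((Finset.range (k+1)).biUnion fun j => (Finset.univ : Finset (Fin n)).finsuppAntidiag j :
        Finset (Fin n →₀ ℕ)) : Set (Fin n →₀ ℕ)) := by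
    ext s
    simp [Finset.mem_finsuppAntidiag, Finsupp.sum_fintype]
  rw [h2]
  simp only [Nat.card_eq_fintype_card, Finset.coe_sort_coe, Fintype.card_coe]
  rw [Finset.card_biUnion]
  · simp only [Finset.card_finsuppAntidiag_nat_eq_multichoose, Finset.card_univ, Fintype.card_fin]
    rw [Nat.sum_range_multichoose]
  · intro i _ j _ hij
    rw [Function.onFun, Finset.disjoint_left]
    intro s hs hs'
    simp [Finset.mem_finsuppAntidiag] at hs hs'
    omega

lemma choose_two_diff (d b k : ℕ) (hd : 1 ≤ d) (hb : 1 ≤ b) (hk : k = 2 * d * b) :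
    (k + 3).choose 3 + (k - d - b + 3).choose 3 <
      (k - d + 3).choose 3 + (k - b + 3).choose 3 + (k + 2).choose 2 := by
  have hkd : d + b ≤ k := by subst hk; nlinarith
  have c3 : ∀ x : ℕ, ((x + 3).choose 3 : ℝ) = (x + 3) * (x + 2) * (x + 1) / 6 := by
    intro x
    have := Nat.add_choose_mul_factorial_mul_factorial x 3
    have h4 : (x+3).factorial = (x+3)*((x+2)*((x+1)*x.factorial)) := by
      simp [Nat.factorial_succ]
    have h5 : (x.factorial : ℝ) ≠ 0 := by exact_mod_cast Nat.factorial_ne_zero x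
    rw [h4] at this
    have h6 : ((x + 3).choose 3 : ℝ) * x.factorial * 6 = (x+3)*((x+2)*((x+1)*x.factorial)) := by
      have : (x + 3).choose 3 * x.factorial * 6 = (x+3)*((x+2)*((x+1)*x.factorial)) := by
        rw [← this]; rw [Nat.choose_symm_of_eq_add (show x + 3 = 3 + x by omega)]; rfl
      exact_mod_cast this
    field_simp
    apply mul_right_cancel₀ h5
    linarith
  have c2 : ((k + 2).choose 2 : ℝ) = (k + 2) * (k + 1) / 2 := by
    rw [Nat.cast_choose_two]; push_cast; ring
  have key : ((k + 3).choose 3 : ℝ) + ((k - d - b + 3).choose 3 : ℝ) <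
      ((k - d + 3).choose 3 : ℝ) + ((k - b + 3).choose 3 : ℝ) + ((k + 2).choose 2 : ℝ) := by
    rw [c3, c3, c3, c3, c2]
    have e1 : ((k - d - b : ℕ) : ℝ) = k - d - b := by
      rw [Nat.cast_sub (by omega), Nat.cast_sub (by omega)]
    have e2 : ((k - d : ℕ) : ℝ) = k - d := by rw [Nat.cast_sub (by omega)]
    have e3 : ((k - b : ℕ) : ℝ) = k - b := by rw [Nat.cast_sub (by omega)]
    rw [e1, e2, e3]
    have hd' : (1:ℝ) ≤ d := by exact_mod_cast hd
    have hb' : (1:ℝ) ≤ b := by exact_mod_cast hb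
    have hk' : (k:ℝ) = 2 * d * b := by exact_mod_cast hk
    have : (0:ℝ) ≤ d * b * ((d - 1) + (b - 1)) := by
      apply mul_nonneg (by positivity) (by linarith)
    have h0 : (0:ℝ) ≤ k := by positivity
    have hdb : (d:ℝ) * b = k / 2 := by rw [hk']; ring
    have id : (k + 3 : ℝ) * (k + 2) * (k + 1) / 6 + (k - d - b + 3) * (k - d - b + 2) * (k - d - b + 1) / 6
      - ((k - d + 3) * (k - d + 2) * (k - d + 1) / 6 + (k - b + 3) * (k - b + 2) * (k - b + 1) / 6)
      = d * b * (k + 2 - (d + b) / 2) := by ring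
    have id2 : (d:ℝ) * b * (k + 2 - (d + b) / 2) ≤ d * b * (k + 1) := by nlinarith
    rw [hdb] at id2
    have : (k:ℝ)/2 * (k+1) < (k+2)*(k+1)/2 := by nlinarith
    rw [hdb] at id
    linarith
  exact_mod_cast key

lemma totalDegree_aeval_lin {σ τ : Type*} [Fintype σ] (y : σ → MvPolynomial τ ℝ)
    (hy : ∀ i, (y i).totalDegree ≤ 1) (h : MvPolynomial σ ℝ) :
    (aeval y h).totalDegree ≤ h.totalDegree := by
  rw [aeval_def, eval₂_eq']
  refine (totalDegree_finsetSum _ _).trans (Finset.sup_le fun s hs => ?_)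
  refine (totalDegree_mul _ _).trans ?_
  have h1 : (algebraMap ℝ (MvPolynomial τ ℝ) (coeff s h)).totalDegree = 0 :=
    totalDegree_C _
  rw [h1, zero_add]
  refine (totalDegree_finsetProd _ _).trans ?_
  have h2 : ∀ i ∈ (Finset.univ : Finset σ), ((y i) ^ s i).totalDegree ≤ s i := fun i _ =>
    (totalDegree_pow _ _).trans (by nlinarith [hy i])
  refine (Finset.sum_le_sum h2).trans ?_
  have h3 := le_totalDegree hs
  rw [Finsupp.sum_fintype _ _ (by simp)] at h3
  exact h3

/-- elimination: a nonzero bivariate polynomial in the ideal `(f, g)` -/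
lemma elim_poly (f g : MvPolynomial (Fin 3) ℝ) (d b : ℕ) (hf : Irreducible f) (hfd : f.totalDegree = d)
    (hgb : g.totalDegree = b) (hd : 1 ≤ d) (hb : 1 ≤ b) (hfg : ¬ f ∣ g)
    (y : Fin 2 → MvPolynomial (Fin 3) ℝ) (hy : ∀ i, (y i).totalDegree ≤ 1) :
    ∃ h : MvPolynomial (Fin 2) ℝ, h ≠ 0 ∧ h.totalDegree ≤ 2 * d * b ∧
      ∃ A B, aeval y h = f * A + g * B := by
  set k := 2 * d * b with hk
  have hkd : d + b ≤ k := by rw [hk]; nlinarith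
  have hp : Prime f := hf.prime
  have hg0 : g ≠ 0 := by rintro rfl; simp at hfg
  by_contra hcon
  push Not at hcon
  let R := fun j => restrictTotalDegree (Fin 3) ℝ j
  have hmem : ∀ (x : R (k-d) × R (k-b) × restrictTotalDegree (Fin 2) ℝ k),
      f * x.1.1 + g * x.2.1.1 - aeval y x.2.2.1 ∈ R k := by
    rintro ⟨⟨A, hA⟩, ⟨B, hB⟩, ⟨h, hh⟩⟩
    simp only [R, mem_restrictTotalDegree] at hA hB hh ⊢
    refine (totalDegree_sub _ _).trans (max_le ((totalDegree_add _ _).trans (max_le ?_ ?_)) ?_)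
    · exact (totalDegree_mul _ _).trans (by omega)
    · exact (totalDegree_mul _ _).trans (by omega)
    · exact (totalDegree_aeval_lin y hy h).trans hh
  let φ : (R (k-d) × R (k-b) × restrictTotalDegree (Fin 2) ℝ k) →ₗ[ℝ] R k :=
    { toFun := fun x => ⟨_, hmem x⟩
      map_add' := by
        intro x x'; ext1; simp; ring
      map_smul' := by
        intro c x; ext1; simp [smul_eq_C_mul]; ring }
  have hker : ∀ x ∈ LinearMap.ker φ, ∃ E ∈ R (k-d-b), (x.1.1 : MvPolynomial (Fin 3) ℝ) = g * E ∧
      (x.2.1.1 : MvPolynomial (Fin 3) ℝ) = - (f * E) ∧ x.2.2 = 0 := by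
    rintro ⟨⟨A, hA⟩, ⟨B, hB⟩, ⟨h, hh⟩⟩ hx
    have hx' : f * A + g * B - aeval y h = 0 := congrArg Subtype.val (LinearMap.mem_ker.mp hx)
    have h0 : h = 0 := by
      by_contra h0
      exact hcon h h0 ((mem_restrictTotalDegree _ _ _).mp hh) A B (by linear_combination -hx')
    subst h0
    simp only [map_zero, sub_zero] at hx'
    have hfB : f ∣ B := by
      have : f ∣ g * B := ⟨-A, by linear_combination hx'⟩
      exact (hp.dvd_or_dvd this).resolve_left hfg
    obtain ⟨E, rfl⟩ := hfB
    have hAE : A = g * (-E) := by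
      apply mul_left_cancel₀ hf.ne_zero; linear_combination hx'
    refine ⟨-E, ?_, hAE, by simp, rfl⟩
    simp only [R, mem_restrictTotalDegree] at hA hB ⊢
    by_cases hE : E = 0
    · simp [hE]
    · by_cases hA0 : A = 0
      · exact absurd (by simpa [hA0, hg0] using hAE) hE
      · have h1 : (g * (-E)).totalDegree = g.totalDegree + (-E).totalDegree :=
          totalDegree_mul_of_isDomain hg0 (neg_ne_zero.mpr hE)
        rw [← hAE] at h1
        omega
  let ψ : R (k-d-b) →ₗ[ℝ] MvPolynomial (Fin 3) ℝ × MvPolynomial (Fin 3) ℝ ×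
      restrictTotalDegree (Fin 2) ℝ k :=
    { toFun := fun E => (g * E.1, -(f * E.1), 0)
      map_add' := by intro x x'; ext <;> simp [mul_add]; ring
      map_smul' := by intro c x; ext <;> simp }
  let ι : (R (k-d) × R (k-b) × restrictTotalDegree (Fin 2) ℝ k) →ₗ[ℝ]
      MvPolynomial (Fin 3) ℝ × MvPolynomial (Fin 3) ℝ × restrictTotalDegree (Fin 2) ℝ k :=
    LinearMap.prodMap (Submodule.subtype _) (LinearMap.prodMap (Submodule.subtype _) LinearMap.id)
  have hι : Function.Injective ι := by
    rintro ⟨⟨A, hA⟩, ⟨B, hB⟩, h⟩ ⟨⟨A', hA'⟩, ⟨B', hB'⟩, h'⟩ hh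
    simpa [ι] using hh
  have hle : (LinearMap.ker φ).map ι ≤ LinearMap.range ψ := by
    rintro _ ⟨x, hx, rfl⟩
    obtain ⟨E, hE, h1, h2, h3⟩ := hker x hx
    refine ⟨⟨E, hE⟩, ?_⟩
    simp only [ψ, ι, LinearMap.coe_mk, AddHom.coe_mk, LinearMap.prodMap_apply, Submodule.subtype_apply,
      LinearMap.id_coe, id]
    rw [h1, h2, h3]
  have d1 : Module.finrank ℝ (LinearMap.ker φ) ≤ Module.finrank ℝ (R (k-d-b)) := by
    rw [(Submodule.equivMapOfInjective ι hι (LinearMap.ker φ)).finrank_eq]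
    exact (Submodule.finrank_mono hle).trans (LinearMap.finrank_range_le ψ)
  have d2 := LinearMap.finrank_range_add_finrank_ker φ
  have d3 : Module.finrank ℝ (LinearMap.range φ) ≤ Module.finrank ℝ (R k) := Submodule.finrank_le _
  rw [Module.finrank_prod, Module.finrank_prod] at d2
  simp only [R, finrank_restr] at d1 d2 d3
  have := choose_two_diff d b k hd hb hk
  omega

open MvPolynomial
open scoped Classical

/-- dot product -/
def dt {R : Type*} [CommRing R] (u v : Fin 3 → R) : R := u 0 * v 0 + u 1 * v 1 + u 2 * v 2

/-- cross product -/
def cr {R : Type*} [CommRing R] (u v : Fin 3 → R) : Fin 3 → R :=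
  ![u 1 * v 2 - u 2 * v 1, u 2 * v 0 - u 0 * v 2, u 0 * v 1 - u 1 * v 0]

/-- triple product -/
def det3 {R : Type*} [CommRing R] (u v w : Fin 3 → R) : R := dt u (cr v w)

lemma cr_0 {R : Type*} [CommRing R] (u v : Fin 3 → R) : cr u v 0 = u 1 * v 2 - u 2 * v 1 := rfl
lemma cr_1 {R : Type*} [CommRing R] (u v : Fin 3 → R) : cr u v 1 = u 2 * v 0 - u 0 * v 2 := rfl
lemma cr_2 {R : Type*} [CommRing R] (u v : Fin 3 → R) : cr u v 2 = u 0 * v 1 - u 1 * v 0 := rfl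

/-- restriction of a polynomial to a parametrized line -/
noncomputable def lineP {σ : Type*} (p v : σ → ℝ) (f : MvPolynomial σ ℝ) : Polynomial ℝ :=
  aeval (fun i => Polynomial.C (p i) + Polynomial.X * Polynomial.C (v i)) f

lemma lineP_eval {σ : Type*} (p v : σ → ℝ) (f : MvPolynomial σ ℝ) (t : ℝ) :
    (lineP p v f).eval t = eval (p + t • v) f := by
  induction f using MvPolynomial.induction_on with
  | C a => simp [lineP]
  | add f g hf hg => simp only [lineP, map_add, Polynomial.eval_add] at *; rw [hf, hg]
  | mul_X f i hf =>
    simp only [lineP, map_mul, Polynomial.eval_mul, aeval_X] at *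
    rw [hf]; simp [mul_comm t]

lemma lineP_natDegree {σ : Type*} (p v : σ → ℝ) (f : MvPolynomial σ ℝ) :
    (lineP p v f).natDegree ≤ f.totalDegree := by
  unfold lineP
  have h := aeval_natDegree_le f le_rfl
    (fun i => Polynomial.C (p i) + Polynomial.X * Polynomial.C (v i)) (n := 1) ?_
  · simpa using h
  · intro i
    refine (Polynomial.natDegree_add_le _ _).trans ?_
    simp only [Polynomial.natDegree_C, zero_le, sup_of_le_right]
    refine Polynomial.natDegree_mul_le.trans ?_
    simp [Polynomial.natDegree_X]

lemma exists_eval_ne_zero {σ : Type*} [Finite σ] (H : MvPolynomial σ ℝ) (h : H ≠ 0) :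
    ∃ x, eval x H ≠ 0 := by
  by_contra hc
  push Not at hc
  exact h (MvPolynomial.funext fun x => by simp [hc x])

/-- a nonzero polynomial has a nonzero value in every nonempty open set -/
lemma exists_eval_ne_zero_open {σ : Type*} [Finite σ] (H : MvPolynomial σ ℝ) (h : H ≠ 0)
    (U : Set (σ → ℝ)) (hU : IsOpen U) (hne : U.Nonempty) : ∃ x ∈ U, eval x H ≠ 0 := by
  obtain ⟨x0, hx0⟩ := hne
  obtain ⟨y, hy⟩ := exists_eval_ne_zero H h
  have h1 : lineP x0 (y - x0) H ≠ 0 := by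
    intro h0
    have := lineP_eval x0 (y - x0) H 1
    rw [h0] at this
    simp at this
    exact hy this.symm
  have hc : Continuous fun t : ℝ => x0 + t • (y - x0) := by fun_prop
  have hopen : IsOpen ((fun t : ℝ => x0 + t • (y - x0)) ⁻¹' U) := hU.preimage hc
  have hmem : (0:ℝ) ∈ ((fun t : ℝ => x0 + t • (y - x0)) ⁻¹' U) := by simpa using hx0
  have hinf : ((fun t : ℝ => x0 + t • (y - x0)) ⁻¹' U).Infinite :=
    infinite_of_mem_nhds 0 (hopen.mem_nhds hmem)
  have hfin : {t | (lineP x0 (y - x0) H).IsRoot t}.Finite :=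
    Polynomial.finite_setOfPred_isRoot h1
  obtain ⟨t, ht, ht'⟩ := hinf.exists_notMem_finite hfin
  refine ⟨_, ht, ?_⟩
  simpa [Polynomial.IsRoot, lineP_eval] using ht'

lemma exists_finset_eval_ne_zero_open {σ ι : Type*} [Finite σ] (s : Finset ι) (H : ι → MvPolynomial σ ℝ)
    (h : ∀ i ∈ s, H i ≠ 0)
    (U : Set (σ → ℝ)) (hU : IsOpen U) (hne : U.Nonempty) : ∃ x ∈ U, ∀ i ∈ s, eval x (H i) ≠ 0 := by
  obtain ⟨x, hx, hx'⟩ := exists_eval_ne_zero_open (∏ i ∈ s, H i) (Finset.prod_ne_zero_iff.mpr h) U hU hne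
  refine ⟨x, hx, ?_⟩
  rw [map_prod] at hx'
  exact Finset.prod_ne_zero_iff.mp hx'

lemma irr_deg_pos {f : MvPolynomial (Fin 3) ℝ} (hf : Irreducible f) : 1 ≤ f.totalDegree := by
  by_contra h
  have h0 : f.totalDegree = 0 := by omega
  rw [totalDegree_eq_zero_iff_eq_C] at h0
  have hc : coeff 0 f ≠ 0 := by
    intro hc; rw [hc] at h0; exact hf.ne_zero (by simpa using h0)
  apply hf.not_isUnit
  rw [h0]
  exact (isUnit_iff_ne_zero.mpr hc).map C

lemma eval_aeval_mv {σ τ : Type*} (p : τ → ℝ) (y : σ → MvPolynomial τ ℝ) (h : MvPolynomial σ ℝ) :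
    eval p (aeval y h) = eval (fun i => eval p (y i)) h := by
  induction h using MvPolynomial.induction_on with
  | C a => simp
  | add f g hf hg => simp only [map_add]; rw [hf, hg]
  | mul_X f i hf => simp only [map_mul, aeval_X, eval_X]; rw [hf]

lemma elim_dir (f g : MvPolynomial (Fin 3) ℝ) (b : ℕ) (hf : Irreducible f)
    (hgb : g.totalDegree ≤ b) (hfg : ¬ f ∣ g) (w : Fin 3 → ℝ) (hw : w ≠ 0) :
    ∃ H : MvPolynomial (Fin 3) ℝ, H ≠ 0 ∧ H.totalDegree ≤ 2 * f.totalDegree * b ∧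
      (∀ p (s : ℝ), eval (p + s • w) H = eval p H) ∧
      (∀ p, eval p f = 0 → eval p g = 0 → eval p H = 0) := by
  have hg0 : g ≠ 0 := by rintro rfl; simp at hfg
  rcases Nat.eq_zero_or_pos g.totalDegree with h0 | hpos
  · refine ⟨1, one_ne_zero, by simp, by simp, ?_⟩
    intro p _ hg
    rw [totalDegree_eq_zero_iff_eq_C] at h0
    rw [h0] at hg hg0
    simp only [eval_C] at hg
    rw [hg] at hg0; simp at hg0
  obtain ⟨k, hk⟩ : ∃ k, w k ≠ 0 := by
    by_contra hc; push Not at hc; exact hw (funext hc)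
  let y : Fin 2 → MvPolynomial (Fin 3) ℝ := fun i =>
    C (w k) * X (k.succAbove i) - C (w (k.succAbove i)) * X k
  have hy : ∀ i, (y i).totalDegree ≤ 1 := by
    intro i
    refine (totalDegree_sub _ _).trans (max_le ?_ ?_)
    · exact (totalDegree_mul _ _).trans (by simp)
    · exact (totalDegree_mul _ _).trans (by simp)
  obtain ⟨h, hne, hdeg, A, B, hAB⟩ := elim_poly f g _ _ hf rfl rfl (irr_deg_pos hf) hpos hfg y hy
  have hev : ∀ p, eval p (aeval y h) = eval (fun i => eval p (y i)) h := by
    intro p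
    exact eval_aeval_mv p y h
  refine ⟨aeval y h, ?_, ?_, ?_, ?_⟩
  · obtain ⟨z, hz⟩ := exists_eval_ne_zero h hne
    intro h0
    have h1 := hev (k.insertNth 0 (fun i => z i / w k))
    rw [h0] at h1
    apply hz
    rw [map_zero] at h1
    rw [h1]
    congr 2
    funext i
    simp [y]
    field_simp
  · refine (totalDegree_aeval_lin y hy h).trans (hdeg.trans ?_)
    exact Nat.mul_le_mul_left _ hgb
  · intro p s
    rw [hev, hev]
    congr 2
    funext i
    simp [y]; ring
  · intro p hp hq
    rw [hAB]; simp [hp, hq]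

open MvPolynomial
open scoped Classical

/-- real zero set -/
def Zs (f : MvPolynomial (Fin 3) ℝ) : Set (Fin 3 → ℝ) := {p | eval p f = 0}

lemma dt_self_ne {u : Fin 3 → ℝ} (h : u ≠ 0) : 0 < dt u u := by
  obtain ⟨k, hk⟩ : ∃ k, u k ≠ 0 := by
    by_contra hc; push Not at hc; exact h (funext hc)
  unfold dt
  fin_cases k <;> simp at hk <;>
    nlinarith [sq_nonneg (u 0), sq_nonneg (u 1), sq_nonneg (u 2), sq_pos_of_ne_zero hk]

lemma vec3_ext {R : Type*} {u v : Fin 3 → R} (h0 : u 0 = v 0) (h1 : u 1 = v 1) (h2 : u 2 = v 2) : u = v := by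
  funext i; fin_cases i <;> assumption

lemma exists_cr_ne {v : Fin 3 → ℝ} (h : v ≠ 0) : ∃ z, cr v z ≠ 0 := by
  by_contra hc
  push Not at hc
  have a := hc ![1,0,0]
  have b := hc ![0,1,0]
  have a1 := congrFun a 1
  have a2 := congrFun a 2
  have b2 := congrFun b 2
  simp [cr] at a1 a2 b2
  exact h (vec3_ext b2 a2 a1)

lemma exists_dt_ne_open (T : Finset (Fin 3 → ℝ)) (hT : ∀ u ∈ T, u ≠ 0) (U : Set (Fin 3 → ℝ))
    (hU : IsOpen U) (hne : U.Nonempty) : ∃ w ∈ U, ∀ u ∈ T, dt w u ≠ 0 := by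
  have hev : ∀ w u : Fin 3 → ℝ, eval w (C (u 0) * X 0 + C (u 1) * X 1 + C (u 2) * X 2) = dt w u := by
    intro w u; simp [dt]; ring
  obtain ⟨w, hw, h⟩ := exists_finset_eval_ne_zero_open T
    (fun u => (C (u 0) * X 0 + C (u 1) * X 1 + C (u 2) * X 2 : MvPolynomial (Fin 3) ℝ)) (by
      intro u hu h0
      have := hev u u
      rw [h0, map_zero] at this
      exact (dt_self_ne (hT u hu)).ne this) U hU hne
  exact ⟨w, hw, fun u hu => by rw [← hev]; exact h u hu⟩

lemma span_of_det3 {x w v : Fin 3 → ℝ} (h : det3 x w v = 0) (hN : cr w v ≠ 0) :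
    ∃ a b : ℝ, x = a • w + b • v := by
  have hpos := dt_self_ne hN
  refine ⟨dt (cr x v) (cr w v) / dt (cr w v) (cr w v), dt (cr w x) (cr w v) / dt (cr w v) (cr w v), ?_⟩
  have key : ∀ i, x i * dt (cr w v) (cr w v) = dt (cr x v) (cr w v) * w i + dt (cr w x) (cr w v) * v i := by
    have h' := h
    intro i
    simp only [det3, dt, cr_0, cr_1, cr_2] at h' ⊢
    fin_cases i
    · simp only [Fin.zero_eta]; linear_combination h' * (w 1 * v 2 - w 2 * v 1)
    · simp only [Fin.mk_one]; linear_combination h' * (w 2 * v 0 - w 0 * v 2)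
    · simp only [Fin.reduceFinMk]; linear_combination h' * (w 0 * v 1 - w 1 * v 0)
  funext i
  simp only [Pi.add_apply, Pi.smul_apply, smul_eq_mul]
  have := key i
  field_simp
  linarith

lemma cr_eq_zero {w v : Fin 3 → ℝ} (h : cr w v = 0) (hv : v ≠ 0) : ∃ c : ℝ, w = c • v := by
  have hpos := dt_self_ne hv
  refine ⟨dt w v / dt v v, ?_⟩
  have h0 : w 1 * v 2 - w 2 * v 1 = 0 := congrFun h 0
  have h1 : w 2 * v 0 - w 0 * v 2 = 0 := congrFun h 1
  have h2 : w 0 * v 1 - w 1 * v 0 = 0 := congrFun h 2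
  have key : ∀ i, w i * dt v v = dt w v * v i := by
    intro i
    simp only [dt]
    fin_cases i
    · simp only [Fin.zero_eta]; linear_combination h2 * v 1 - h1 * v 2
    · simp only [Fin.mk_one]; linear_combination - h2 * v 0 + h0 * v 2
    · simp only [Fin.reduceFinMk]; linear_combination h1 * v 0 - h0 * v 1
  funext i
  simp only [Pi.smul_apply, smul_eq_mul]
  have := key i
  field_simp
  linarith

lemma line_eq_of {p v p' v' : Fin 3 → ℝ} (hv : v ≠ 0) (hv' : v' ≠ 0) (h : cr v v' = 0)
    (h2 : cr v (p - p') = 0) : lineThrough p v = lineThrough p' v' := by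
  obtain ⟨c, hc⟩ := cr_eq_zero h hv'
  have hc0 : c ≠ 0 := by rintro rfl; simp at hc; exact hv hc
  have h3 : cr (p - p') v = 0 := by
    have h0 := congrFun h2 0
    have h1 := congrFun h2 1
    have h2 := congrFun h2 2
    simp only [cr_0, cr_1, cr_2, Pi.zero_apply] at h0 h1 h2
    apply vec3_ext <;> simp only [cr_0, cr_1, cr_2, Pi.zero_apply] <;> linarith
  obtain ⟨e, he⟩ := cr_eq_zero h3 hv
  have hp : p = p' + (e * c) • v' := by
    rw [mul_smul, ← hc, ← he]; simp
  ext q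
  constructor
  · rintro ⟨t, rfl⟩
    refine ⟨e * c + t * c, ?_⟩
    rw [hp, hc, add_smul, mul_smul t, add_assoc]
  · rintro ⟨t, rfl⟩
    refine ⟨t / c - e, ?_⟩
    rw [hp, hc, smul_smul, add_assoc, ← add_smul]
    congr 2
    field_simp
    ring

lemma mem_line_cr {p v q : Fin 3 → ℝ} (h : q ∈ lineThrough p v) : cr v (q - p) = 0 := by
  obtain ⟨t, rfl⟩ := h
  apply vec3_ext <;> simp only [cr_0, cr_1, cr_2, Pi.zero_apply, Pi.sub_apply, Pi.add_apply, Pi.smul_apply,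
    smul_eq_mul] <;> ring

lemma bezout_lines (f g : MvPolynomial (Fin 3) ℝ) (hf : Irreducible f) (hfg : ¬ f ∣ g)
    (S : Finset (Set (Fin 3 → ℝ))) (hS : ∀ ℓ ∈ S, IsLineIn (Zs f) ℓ) (hS' : ∀ ℓ ∈ S, ℓ ⊆ Zs g) :
    S.card ≤ 2 * f.totalDegree * g.totalDegree := by
  rcases S.eq_empty_or_nonempty with rfl | ⟨ℓ0, hℓ0⟩
  · simp
  have h1 : ∀ ℓ : Set (Fin 3 → ℝ), ∃ pv : (Fin 3 → ℝ) × (Fin 3 → ℝ), ℓ ∈ S → pv.2 ≠ 0 ∧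
      ℓ = lineThrough pv.1 pv.2 := by
    intro ℓ
    by_cases h : ℓ ∈ S
    · obtain ⟨⟨p, v, hv, hl⟩, _⟩ := hS ℓ h
      exact ⟨(p, v), fun _ => ⟨hv, hl⟩⟩
    · exact ⟨0, fun h' => absurd h' h⟩
  choose pv hpv using h1
  let p := fun ℓ => (pv ℓ).1
  let v := fun ℓ => (pv ℓ).2
  have hv : ∀ ℓ ∈ S, v ℓ ≠ 0 := fun ℓ h => (hpv ℓ h).1
  have hl : ∀ ℓ ∈ S, ℓ = lineThrough (p ℓ) (v ℓ) := fun ℓ h => (hpv ℓ h).2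
  have hK : ∀ a : Set (Fin 3 → ℝ) × Set (Fin 3 → ℝ), ∃ K : Fin 3 → ℝ, a ∈ S ×ˢ S → K ≠ 0 ∧
      (a.1 ≠ a.2 → K = cr (v a.1) (v a.2) ∨ (cr (v a.1) (v a.2) = 0 ∧ K = cr (v a.1) (p a.1 - p a.2))) ∧
      (a.1 = a.2 → ∃ z, K = cr (v a.1) z) := by
    rintro ⟨a, b⟩
    by_cases hab : a = b
    · by_cases ha : a ∈ S
      · obtain ⟨z, hz⟩ := exists_cr_ne (hv a ha)
        exact ⟨cr (v a) z, fun _ => ⟨hz, fun h => absurd hab h, fun _ => ⟨z, rfl⟩⟩⟩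
      · exact ⟨0, fun h => absurd (Finset.mem_product.mp h).1 ha⟩
    · by_cases hc : cr (v a) (v b) = 0
      · refine ⟨cr (v a) (p a - p b), fun h => ⟨fun h0 => hab ?_, fun _ => Or.inr ⟨hc, rfl⟩, fun h => absurd h hab⟩⟩
        have h := Finset.mem_product.mp h
        rw [hl a h.1, hl b h.2]
        exact line_eq_of (hv a h.1) (hv b h.2) hc h0
      · exact ⟨cr (v a) (v b), fun _ => ⟨hc, fun _ => Or.inl rfl, fun h => absurd h hab⟩⟩
  choose K hK using hK
  obtain ⟨w, -, hw⟩ := exists_dt_ne_open ((S ×ˢ S).image K) (by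
    intro u hu
    obtain ⟨a, ha, rfl⟩ := Finset.mem_image.mp hu
    exact (hK a ha).1) Set.univ isOpen_univ Set.univ_nonempty
  have hw' : ∀ a ∈ S, ∀ b ∈ S, dt w (K (a, b)) ≠ 0 := fun a ha b hb =>
    hw _ (Finset.mem_image_of_mem K (Finset.mk_mem_product ha hb))
  have hwv : ∀ a ∈ S, cr w (v a) ≠ 0 := by
    intro a ha h0
    obtain ⟨z, hz⟩ := (hK (a, a) (Finset.mk_mem_product ha ha)).2.2 rfl
    apply hw' a ha a ha
    rw [hz]
    have h1 := congrFun h0 0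
    have h2 := congrFun h0 1
    have h3 := congrFun h0 2
    simp only [dt, cr_0, cr_1, cr_2, Pi.zero_apply] at h1 h2 h3 ⊢
    linear_combination h1 * z 0 + h2 * z 1 + h3 * z 2
  have hw0 : w ≠ 0 := by
    rintro rfl
    apply hwv ℓ0 hℓ0
    apply vec3_ext <;> simp [cr_0, cr_1, cr_2]
  obtain ⟨H, hH0, hHd, hHw, hHz⟩ := elim_dir f g _ hf le_rfl hfg w hw0
  obtain ⟨o, ho⟩ := exists_eval_ne_zero H hH0
  have hplane : ∀ a ∈ S, ∀ x, det3 (x - p a) w (v a) = 0 → eval x H = 0 := by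
    intro a ha x hx
    obtain ⟨s, t, hst⟩ := span_of_det3 hx (hwv a ha)
    have : x = (p a + t • v a) + s • w := by
      rw [sub_eq_iff_eq_add] at hst
      rw [hst]; abel
    rw [this, hHw]
    have hm : p a + t • v a ∈ a := by
      have hm' : p a + t • v a ∈ lineThrough (p a) (v a) := ⟨t, rfl⟩
      rwa [← hl a ha] at hm'
    exact hHz _ ((hS a ha).2 hm) (hS' a ha hm)
  let D := fun a => det3 (p a - o) w (v a)
  have hD : ∀ a ∈ S, D a ≠ 0 := by
    intro a ha h0
    apply ho
    apply hplane a ha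
    simp only [D, det3, dt, Pi.sub_apply] at h0 ⊢
    linear_combination -h0
  obtain ⟨e, -, he⟩ := exists_dt_ne_open
    ((S.image fun a => cr w (v a)) ∪ ((S ×ˢ S).filter fun a => a.1 ≠ a.2).image
      fun a => D a.1 • cr w (v a.2) - D a.2 • cr w (v a.1)) (by
    intro u hu
    rcases Finset.mem_union.mp hu with hu | hu
    · obtain ⟨a, ha, rfl⟩ := Finset.mem_image.mp hu
      exact hwv a ha
    · obtain ⟨⟨a, b⟩, hab, rfl⟩ := Finset.mem_image.mp hu
      obtain ⟨hab, hne⟩ := Finset.mem_filter.mp hab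
      have ha := (Finset.mem_product.mp hab).1
      have hb := (Finset.mem_product.mp hab).2
      simp only at hne ha hb ⊢
      intro h0
      have hKab := hw' a ha b hb
      have c0 := congrFun h0 0
      have c1 := congrFun h0 1
      have c2 := congrFun h0 2
      simp only [Pi.sub_apply, Pi.smul_apply, smul_eq_mul, Pi.zero_apply, cr_0, cr_1, cr_2] at c0 c1 c2
      rcases (hK (a, b) hab).2.1 hne with h | ⟨hpar, h⟩
      · rw [h] at hKab
        apply hKab
        apply mul_left_cancel₀ (hD a ha)
        simp only [dt, cr_0, cr_1, cr_2]
        linear_combination -c0 * v a 0 - c1 * v a 1 - c2 * v a 2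
      · rw [h] at hKab
        obtain ⟨c, hc⟩ := cr_eq_zero hpar (hv b hb)
        have hc0 : c ≠ 0 := by rintro rfl; simp at hc; exact hv a ha hc
        apply hKab
        have hDD : D a = c * D b := by
          have hz : (D a - c * D b) • cr w (v b) = 0 := by
            simp only [hc, Pi.smul_apply, smul_eq_mul] at c0 c1 c2
            apply vec3_ext <;> simp only [Pi.smul_apply, smul_eq_mul, cr_0, cr_1, cr_2, Pi.zero_apply]
            · linear_combination c0
            · linear_combination c1
            · linear_combination c2
          rcases smul_eq_zero.mp hz with h | h
          · linarith
          · exact absurd h (hwv b hb)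
        simp only [D, hc, det3, dt, cr_0, cr_1, cr_2, Pi.smul_apply, smul_eq_mul, Pi.sub_apply] at hDD ⊢
        linear_combination hDD)
    Set.univ isOpen_univ Set.univ_nonempty
  have he1 : ∀ a ∈ S, dt e (cr w (v a)) ≠ 0 := fun a ha =>
    he _ (Finset.mem_union_left _ (Finset.mem_image_of_mem _ ha))
  have he2 : ∀ a ∈ S, ∀ b ∈ S, a ≠ b → D a * dt e (cr w (v b)) ≠ D b * dt e (cr w (v a)) := by
    intro a ha b hb hab h
    apply he (D a • cr w (v b) - D b • cr w (v a)) (Finset.mem_union_right _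
      (Finset.mem_image.mpr ⟨(a, b), Finset.mem_filter.mpr ⟨Finset.mk_mem_product ha hb, hab⟩, rfl⟩))
    simp only [dt, Pi.sub_apply, Pi.smul_apply, smul_eq_mul] at h ⊢
    linear_combination h
  let t := fun a => D a / dt e (cr w (v a))
  have hinj : Set.InjOn t S := by
    intro a ha b hb hab
    by_contra hne
    apply he2 a ha b hb hne
    have h1 := he1 a ha
    have h2 := he1 b hb
    simp only [t] at hab
    rwa [div_eq_div_iff h1 h2] at hab
  have hne : lineP o e H ≠ 0 := by
    intro h0
    have := lineP_eval o e H 0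
    rw [h0] at this
    simp at this
    exact ho this.symm
  have hroots : S.image t ⊆ (lineP o e H).roots.toFinset := by
    intro x hx
    obtain ⟨a, ha, rfl⟩ := Finset.mem_image.mp hx
    rw [Multiset.mem_toFinset, Polynomial.mem_roots hne, Polynomial.IsRoot, lineP_eval]
    apply hplane a ha
    have h1 := he1 a ha
    have h2 : t a * dt e (cr w (v a)) = D a := by simp only [t]; field_simp
    simp only [D, det3, dt, Pi.sub_apply, Pi.add_apply, Pi.smul_apply, smul_eq_mul] at h2 ⊢
    linear_combination h2
  calc S.card = (S.image t).card := (Finset.card_image_of_injOn hinj).symm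
    _ ≤ (lineP o e H).roots.toFinset.card := Finset.card_le_card hroots
    _ ≤ Multiset.card (lineP o e H).roots := Multiset.toFinset_card_le _
    _ ≤ (lineP o e H).natDegree := Polynomial.card_roots' _
    _ ≤ H.totalDegree := lineP_natDegree _ _ _
    _ ≤ _ := hHd

open MvPolynomial
open scoped Classical

/-- derivative of polynomial evaluation -/
noncomputable def dP {σ : Type*} [Fintype σ] (p : MvPolynomial σ ℝ) (x : σ → ℝ) : (σ → ℝ) →L[ℝ] ℝ :=
  ∑ i, eval x (pderiv i p) • ContinuousLinearMap.proj (R := ℝ) (φ := fun _ : σ => ℝ) i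

lemma dP_apply {σ : Type*} [Fintype σ] (p : MvPolynomial σ ℝ) (x u : σ → ℝ) :
    dP p x u = ∑ i, eval x (pderiv i p) * u i := by
  simp [dP]

lemma hasStrictFDerivAt_eval {σ : Type*} [Fintype σ] (p : MvPolynomial σ ℝ) (x : σ → ℝ) :
    HasStrictFDerivAt (fun y => eval y p) (dP p x) x := by
  induction p using MvPolynomial.induction_on with
  | C a =>
    have : dP (C a : MvPolynomial σ ℝ) x = 0 := by ext; simp [dP_apply]
    rw [this]
    simpa using hasStrictFDerivAt_const a x
  | add p q hp hq =>
    have : dP (p + q) x = dP p x + dP q x := by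
      ext u; simp [dP_apply, add_mul, Finset.sum_add_distrib]
    rw [this]
    simp only [map_add]
    exact hp.fun_add hq
  | mul_X p i hp =>
    have h1 : HasStrictFDerivAt (fun y : σ → ℝ => y i)
      (ContinuousLinearMap.proj (R := ℝ) (φ := fun _ : σ => ℝ) i) x :=
      (ContinuousLinearMap.proj (R := ℝ) (φ := fun _ : σ => ℝ) i).hasStrictFDerivAt
    have : dP (p * X i) x = eval x p • ContinuousLinearMap.proj (R := ℝ) (φ := fun _ : σ => ℝ) i + x i • dP p x := by
      ext u
      simp only [dP_apply, add_apply, smul_apply, smul_eq_mul,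
        ContinuousLinearMap.proj_apply, Derivation.leibniz, map_add, map_mul, eval_X, pderiv_X, add_mul,
        Finset.sum_add_distrib, Pi.single_apply, Finset.mul_sum]
      congr 1
      · rw [Finset.sum_eq_single i]
        · simp
        · intro j _ hj; simp [hj.symm]
        · simp
      · exact Finset.sum_congr rfl fun j _ => by ring
    rw [this]
    simp only [map_mul, eval_X]
    exact hp.fun_mul h1

lemma pderiv_comm' {σ : Type*} (i j : σ) (p : MvPolynomial σ ℝ) :
    pderiv i (pderiv j p) = pderiv j (pderiv i p) := by
  ext m
  simp only [coeff_pderiv]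
  by_cases h : i = j
  · subst h; rfl
  · rw [add_right_comm m]
    simp [h, Ne.symm h]
    ring

/-- bilinear form -/
def bil {R : Type*} [CommRing R] (H : Fin 3 → Fin 3 → R) (u v : Fin 3 → R) : R :=
  ∑ i, ∑ j, H i j * u i * v j
/-- trilinear form -/
def tri {R : Type*} [CommRing R] (T : Fin 3 → Fin 3 → Fin 3 → R) (u v w : Fin 3 → R) : R :=
  ∑ i, ∑ j, ∑ k, T i j k * u i * v j * w k

/-- gradient -/
noncomputable def nv (f : MvPolynomial (Fin 3) ℝ) (q : Fin 3 → ℝ) : Fin 3 → ℝ := fun i => eval q (pderiv i f)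
/-- Hessian -/
noncomputable def Hv (f : MvPolynomial (Fin 3) ℝ) (q : Fin 3 → ℝ) : Fin 3 → Fin 3 → ℝ :=
  fun i j => eval q (pderiv i (pderiv j f))
/-- third derivative -/
noncomputable def Tv (f : MvPolynomial (Fin 3) ℝ) (q : Fin 3 → ℝ) : Fin 3 → Fin 3 → Fin 3 → ℝ :=
  fun i j k => eval q (pderiv i (pderiv j (pderiv k f)))

abbrev S6 := Fin 3 ⊕ Fin 3
/-- base point part -/
def qq (x : S6 → ℝ) : Fin 3 → ℝ := fun i => x (Sum.inl i)
/-- direction part -/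
def vv (x : S6 → ℝ) : Fin 3 → ℝ := fun i => x (Sum.inr i)

/-- derivative along the direction -/
noncomputable def Eo (p : MvPolynomial S6 ℝ) : MvPolynomial S6 ℝ :=
  ∑ i : Fin 3, X (Sum.inr i) * pderiv (Sum.inl i) p

/-- f in the base variables -/
noncomputable def fq (f : MvPolynomial (Fin 3) ℝ) : MvPolynomial S6 ℝ := rename Sum.inl f

lemma fq_pderiv_inl (f : MvPolynomial (Fin 3) ℝ) (i : Fin 3) :
    pderiv (Sum.inl i) (fq f) = fq (pderiv i f) := pderiv_rename Sum.inl_injective i f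

lemma fq_pderiv_inr (f : MvPolynomial (Fin 3) ℝ) (i : Fin 3) :
    pderiv (Sum.inr i) (fq f) = 0 := by
  apply pderiv_eq_zero_of_notMem_vars
  intro h
  have := vars_rename (Sum.inl : Fin 3 → S6) f h
  simp at this

lemma fq_eval (f : MvPolynomial (Fin 3) ℝ) (x : S6 → ℝ) : eval x (fq f) = eval (qq x) f := by
  simp [fq, eval_rename]; rfl

lemma Eo_eval (p : MvPolynomial S6 ℝ) (x : S6 → ℝ) :
    eval x (Eo p) = dP p x (Sum.elim (vv x) 0) := by
  simp [Eo, dP_apply, vv]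
  exact Finset.sum_congr rfl fun _ _ => by ring

lemma F1_eval (f : MvPolynomial (Fin 3) ℝ) (x : S6 → ℝ) : eval x (Eo (fq f)) = dt (nv f (qq x)) (vv x) := by
  simp [Eo, fq_pderiv_inl, fq_eval, dt, nv, vv, Fin.sum_univ_three]
  ring

lemma F2_eval (f : MvPolynomial (Fin 3) ℝ) (x : S6 → ℝ) :
    eval x (Eo (Eo (fq f))) = bil (Hv f (qq x)) (vv x) (vv x) := by
  simp [Eo, fq_pderiv_inl, fq_eval, bil, Hv, vv, Fin.sum_univ_three, pderiv_X]
  ring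

lemma F3_eval (f : MvPolynomial (Fin 3) ℝ) (x : S6 → ℝ) :
    eval x (Eo (Eo (Eo (fq f)))) = tri (Tv f (qq x)) (vv x) (vv x) (vv x) := by
  simp [Eo, fq_pderiv_inl, fq_eval, tri, Tv, vv, Fin.sum_univ_three, pderiv_X]
  ring

lemma dP_fq (f : MvPolynomial (Fin 3) ℝ) (x : S6 → ℝ) (u w : Fin 3 → ℝ) :
    dP (fq f) x (Sum.elim u w) = dt (nv f (qq x)) u := by
  simp [dP_apply, fq_pderiv_inl, fq_pderiv_inr, fq_eval, dt, nv, Fin.sum_univ_three]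

lemma dP_F1 (f : MvPolynomial (Fin 3) ℝ) (x : S6 → ℝ) (u w : Fin 3 → ℝ) :
    dP (Eo (fq f)) x (Sum.elim u w) = bil (Hv f (qq x)) u (vv x) + dt (nv f (qq x)) w := by
  simp [dP_apply, Eo, fq_pderiv_inl, fq_pderiv_inr, fq_eval, dt, nv, Fin.sum_univ_three, bil, Hv, vv,
    pderiv_X, Pi.single_apply]
  ring

lemma dP_F2 (f : MvPolynomial (Fin 3) ℝ) (x : S6 → ℝ) (u w : Fin 3 → ℝ) :
    dP (Eo (Eo (fq f))) x (Sum.elim u w) =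
      tri (Tv f (qq x)) u (vv x) (vv x) + 2 * bil (Hv f (qq x)) (vv x) w := by
  have h01 : pderiv 1 (pderiv 0 f) = pderiv 0 (pderiv 1 f) := pderiv_comm' _ _ _
  have h02 : pderiv 2 (pderiv 0 f) = pderiv 0 (pderiv 2 f) := pderiv_comm' _ _ _
  have h12 : pderiv 2 (pderiv 1 f) = pderiv 1 (pderiv 2 f) := pderiv_comm' _ _ _
  simp [dP_apply, Eo, fq_pderiv_inl, fq_pderiv_inr, fq_eval, Fin.sum_univ_three, tri, Tv, bil, Hv, vv,
    pderiv_X, Pi.single_apply]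
  rw [h01, h02, h12]
  ring

open MvPolynomial
open scoped Classical

lemma lineP_deriv (x : S6 → ℝ) (p : MvPolynomial S6 ℝ) :
    Polynomial.derivative (lineP x (Sum.elim (vv x) 0) p) = lineP x (Sum.elim (vv x) 0) (Eo p) := by
  induction p using MvPolynomial.induction_on with
  | C a => simp [lineP, Eo]
  | add p q hp hq =>
    have : Eo (p + q) = Eo p + Eo q := by simp [Eo, mul_add, Finset.sum_add_distrib]
    rw [this]
    simp only [lineP, map_add] at *
    rw [hp, hq]
  | mul_X p i hp =>
    have h1 : Eo (p * X i) = Eo p * X i + p * Eo (X i) := by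
      simp only [Eo, Fin.sum_univ_three, Derivation.leibniz, smul_eq_mul]; ring
    have h2 : lineP x (Sum.elim (vv x) 0) (Eo (X i)) =
        Polynomial.derivative (lineP x (Sum.elim (vv x) 0) (X i)) := by
      rcases i with i | i
      · simp [Eo, lineP, pderiv_X, Pi.single_apply, Finset.sum_ite_eq, vv]
      · simp [Eo, lineP, pderiv_X]
    rw [h1]
    simp only [lineP, map_add, map_mul, Polynomial.derivative_mul] at *
    rw [hp, h2]

lemma lineP_iter (x : S6 → ℝ) (p : MvPolynomial S6 ℝ) (k : ℕ) :
    Polynomial.derivative^[k] (lineP x (Sum.elim (vv x) 0) p) = lineP x (Sum.elim (vv x) 0) (Eo^[k] p) := by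
  induction k with
  | zero => rfl
  | succ k ih => rw [Function.iterate_succ_apply', ih, lineP_deriv, Function.iterate_succ_apply']

lemma lineP_eval0 (x y : S6 → ℝ) (p : MvPolynomial S6 ℝ) : (lineP x y p).eval 0 = eval x p := by
  rw [lineP_eval]; simp

lemma lineP_fq_eval (x : S6 → ℝ) (f : MvPolynomial (Fin 3) ℝ) (s : ℝ) :
    (lineP x (Sum.elim (vv x) 0) (fq f)).eval s = eval (qq x + s • vv x) f := by
  rw [lineP_eval, fq_eval]
  congr 2

lemma line_of_iter (x : S6 → ℝ) (f : MvPolynomial (Fin 3) ℝ) (h : ∀ k, eval x (Eo^[k] (fq f)) = 0) (s : ℝ) :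
    eval (qq x + s • vv x) f = 0 := by
  rw [← lineP_fq_eval]
  have : lineP x (Sum.elim (vv x) 0) (fq f) = 0 := by
    ext k
    have h1 := h k
    rw [← lineP_eval0 x (Sum.elim (vv x) 0), ← lineP_iter, ← Polynomial.coeff_zero_eq_eval_zero,
      Polynomial.coeff_iterate_derivative] at h1
    simp only [zero_add, Nat.descFactorial_self, nsmul_eq_mul, mul_eq_zero, Nat.cast_eq_zero] at h1
    rcases h1 with h1 | h1
    · exact absurd h1 (Nat.factorial_ne_zero k)
    · simpa using h1
  rw [this]; simp

lemma iter_of_line (x : S6 → ℝ) (f : MvPolynomial (Fin 3) ℝ) (h : ∀ s : ℝ, eval (qq x + s • vv x) f = 0) (k : ℕ) :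
    eval x (Eo^[k] (fq f)) = 0 := by
  have : lineP x (Sum.elim (vv x) 0) (fq f) = 0 := by
    apply Polynomial.funext
    intro s
    rw [lineP_fq_eval, h]; simp
  rw [← lineP_eval0 x (Sum.elim (vv x) 0), ← lineP_iter, this]
  simp

/-- constraint polynomial for the normalization of directions -/
noncomputable def cP (c : Fin 3 → ℝ) : MvPolynomial S6 ℝ := ∑ i : Fin 3, C (c i) * X (Sum.inr i)

lemma cP_eval (c : Fin 3 → ℝ) (x : S6 → ℝ) : eval x (cP c) = dt c (vv x) := by
  simp [cP, dt, vv, Fin.sum_univ_three]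

lemma dP_cP (c : Fin 3 → ℝ) (x : S6 → ℝ) (u w : Fin 3 → ℝ) : dP (cP c) x (Sum.elim u w) = dt c w := by
  simp [dP_apply, cP, dt, Fin.sum_univ_three, pderiv_X, Pi.single_apply]

/-- The constraint set. -/
def Mset (f : MvPolynomial (Fin 3) ℝ) (g : MvPolynomial S6 ℝ) (c : Fin 3 → ℝ) : Set (S6 → ℝ) :=
  {x | eval x (fq f) = 0 ∧ eval x (Eo (fq f)) = 0 ∧ eval x g = 0 ∧ dt c (vv x) = 1}

/-- The regularity condition at a point. -/
def Reg (f : MvPolynomial (Fin 3) ℝ) (g : MvPolynomial S6 ℝ) (x : S6 → ℝ) : Prop :=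
  (∀ a b : ℝ, (∀ w, a * dt (nv f (qq x)) w + b * dP g x (Sum.elim 0 w) = 0) → a = 0 ∧ b = 0) ∧
    dP g x (Sum.elim 0 (vv x)) = 0

lemma Reg.n_ne {f : MvPolynomial (Fin 3) ℝ} {g : MvPolynomial S6 ℝ} {x : S6 → ℝ} (h : Reg f g x) :
    nv f (qq x) ≠ 0 := by
  intro h0
  have := (h.1 1 0 (by intro w; simp [h0, dt])).1
  simp at this

lemma mult_lemma (f : MvPolynomial (Fin 3) ℝ) (g : MvPolynomial S6 ℝ) (c : Fin 3 → ℝ) (U : Set (S6 → ℝ))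
    (hU : IsOpen U) (x : S6 → ℝ) (hxU : x ∈ U) (hx : x ∈ Mset f g c) (hr : Reg f g x)
    (P : MvPolynomial S6 ℝ) (hP : ∀ y ∈ U, y ∈ Mset f g c → eval y P = 0) :
    ∃ l1 l2 l3 l4 : ℝ, ∀ u w, dP P x (Sum.elim u w) = l1 * dt (nv f (qq x)) u
      + l2 * (bil (Hv f (qq x)) u (vv x) + dt (nv f (qq x)) w) + l3 * dP g x (Sum.elim u w)
      + l4 * dt c w := by
  let Φ : Fin 4 → MvPolynomial S6 ℝ := ![fq f, Eo (fq f), g, cP c]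
  have hext : IsLocalExtrOn (fun y => eval y P) {y | ∀ i, eval y (Φ i) = eval x (Φ i)} x := by
    left
    have : ∀ᶠ y in nhdsWithin x {y | ∀ i, eval y (Φ i) = eval x (Φ i)}, y ∈ U :=
      nhdsWithin_le_nhds (hU.mem_nhds hxU)
    filter_upwards [this, self_mem_nhdsWithin] with y hy hy'
    have h0 := hy' 0
    have h1 := hy' 1
    have h2 := hy' 2
    have h3 := hy' 3
    simp only [Φ, Matrix.cons_val] at h0 h1 h2 h3
    rw [hP x hxU hx, hP y hy]
    refine ⟨h0.trans hx.1, h1.trans hx.2.1, h2.trans hx.2.2.1, ?_⟩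
    rw [← cP_eval, h3, cP_eval]; exact hx.2.2.2
  obtain ⟨Λ, Λ0, hne, hsum⟩ := hext.exists_multipliers_of_hasStrictFDerivAt
    (fun i => hasStrictFDerivAt_eval (Φ i) x) (hasStrictFDerivAt_eval P x)
  have hsum' : ∀ u w, Λ 0 * dt (nv f (qq x)) u
      + Λ 1 * (bil (Hv f (qq x)) u (vv x) + dt (nv f (qq x)) w) + Λ 2 * dP g x (Sum.elim u w)
      + Λ 3 * dt c w + Λ0 * dP P x (Sum.elim u w) = 0 := by
    intro u w
    have := congrArg (fun L : (S6 → ℝ) →L[ℝ] ℝ => L (Sum.elim u w)) hsum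
    simp only [Fin.sum_univ_four, Φ, Matrix.cons_val, add_apply, smul_apply, smul_eq_mul, zero_apply,
      dP_fq, dP_F1, dP_cP] at this
    exact this
  have hb0 : ∀ v, bil (Hv f (qq x)) 0 v = 0 := by intro v; simp [bil]
  have hd0 : ∀ v : Fin 3 → ℝ, dt v 0 = 0 := by intro v; simp [dt]
  have hL0 : Λ0 ≠ 0 := by
    rintro rfl
    have hv := hsum' 0 (vv x)
    have h1 : dt (nv f (qq x)) (vv x) = 0 := by rw [← F1_eval]; exact hx.2.1
    rw [hb0, hd0, h1, hr.2, hx.2.2.2] at hv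
    have h3 : Λ 3 = 0 := by linarith
    have h12 := hr.1 (Λ 1) (Λ 2) (by
      intro w
      have := hsum' 0 w
      rw [hb0, hd0, h3] at this
      linarith)
    have h0 : Λ 0 = 0 := by
      have := hsum' (nv f (qq x)) 0
      rw [h12.1, h12.2, h3] at this
      have hpos := dt_self_ne hr.n_ne
      have h4 : Λ 0 * dt (nv f (qq x)) (nv f (qq x)) = 0 := by linarith
      exact (mul_eq_zero.mp h4).resolve_right hpos.ne'
    apply hne
    ext i
    · fin_cases i <;> simp [h0, h12.1, h12.2, h3]
    · rfl
  refine ⟨-Λ 0 / Λ0, -Λ 1 / Λ0, -Λ 2 / Λ0, -Λ 3 / Λ0, ?_⟩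
  intro u w
  have := hsum' u w
  field_simp
  linarith

lemma propagate (f : MvPolynomial (Fin 3) ℝ) (g : MvPolynomial S6 ℝ) (c : Fin 3 → ℝ) (U : Set (S6 → ℝ))
    (hU : IsOpen U) (hr : ∀ x ∈ U, x ∈ Mset f g c → Reg f g x)
    (hF2 : ∀ x ∈ U, x ∈ Mset f g c → eval x (Eo (Eo (fq f))) = 0)
    (hEg : ∀ x ∈ U, x ∈ Mset f g c → eval x (Eo g) = 0) :
    ∀ x ∈ U, x ∈ Mset f g c → ∀ s : ℝ, eval (qq x + s • vv x) f = 0 := by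
  have key : ∀ k, ∀ x ∈ U, x ∈ Mset f g c → eval x (Eo^[k] (fq f)) = 0 := by
    intro k
    induction k with
    | zero => intro x _ hx; exact hx.1
    | succ k ih =>
      intro x hxU hx
      rw [Function.iterate_succ_apply', Eo_eval]
      obtain ⟨l1, l2, l3, l4, h⟩ := mult_lemma f g c U hU x hxU hx (hr x hxU hx) _ ih
      rw [h, ← Eo_eval, hEg x hxU hx, ← F1_eval, hx.2.1, ← F2_eval, hF2 x hxU hx]
      simp [dt]
  intro x hxU hx
  exact line_of_iter x f fun k => key k x hxU hx

open MvPolynomial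
open scoped Classical

/-- a continuous injective one-parameter family of lines on the surface -/
structure Fam (f : MvPolynomial (Fin 3) ℝ) (q v : ℝ → Fin 3 → ℝ) (ε : ℝ) : Prop where
  pos : 0 < ε
  contq : ContinuousOn q (Set.Icc 0 ε)
  contv : ContinuousOn v (Set.Icc 0 ε)
  vne : ∀ τ ∈ Set.Icc 0 ε, v τ ≠ 0
  onf : ∀ τ ∈ Set.Icc 0 ε, ∀ s : ℝ, eval (q τ + s • v τ) f = 0
  inj : Set.InjOn (fun τ => lineThrough (q τ) (v τ)) (Set.Icc 0 ε)

lemma three_perp {u a b : Fin 3 → ℝ} (h1 : dt a u = 0) (h2 : dt b u = 0) (h3 : dt (cr a b) u = 0)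
    (h : cr a b ≠ 0) : u = 0 := by
  have hpos := dt_self_ne h
  have key : ∀ i, dt (cr a b) (cr a b) * u i = 0 := by
    intro i
    simp only [dt, cr_0, cr_1, cr_2] at h1 h2 h3 ⊢
    fin_cases i
    · show _ * u 0 = 0
      linear_combination h3 * (a 1 * b 2 - a 2 * b 1) + h1 * (b 1 * (a 0 * b 1 - a 1 * b 0) - b 2 * (a 2 * b 0 - a 0 * b 2))
        + h2 * ((a 2 * b 0 - a 0 * b 2) * a 2 - (a 0 * b 1 - a 1 * b 0) * a 1)
    · show _ * u 1 = 0
      linear_combination h3 * (a 2 * b 0 - a 0 * b 2) + h1 * (b 2 * (a 1 * b 2 - a 2 * b 1) - b 0 * (a 0 * b 1 - a 1 * b 0))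
        + h2 * ((a 0 * b 1 - a 1 * b 0) * a 0 - (a 1 * b 2 - a 2 * b 1) * a 2)
    · show _ * u 2 = 0
      linear_combination h3 * (a 0 * b 1 - a 1 * b 0) + h1 * (b 0 * (a 2 * b 0 - a 0 * b 2) - b 1 * (a 1 * b 2 - a 2 * b 1))
        + h2 * ((a 1 * b 2 - a 2 * b 1) * a 1 - (a 2 * b 0 - a 0 * b 2) * a 0)
  funext i
  exact (mul_eq_zero.mp (key i)).resolve_left hpos.ne'

lemma perp_two {w a b : Fin 3 → ℝ} (h1 : dt a w = 0) (h2 : dt b w = 0) (h : cr a b ≠ 0) :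
    ∃ k : ℝ, w = k • cr a b := by
  apply cr_eq_zero _ h
  simp only [dt] at h1 h2
  apply vec3_ext <;> simp only [cr_0, cr_1, cr_2, Pi.zero_apply]
  · linear_combination h2 * a 0 - h1 * b 0
  · linear_combination h2 * a 1 - h1 * b 1
  · linear_combination h2 * a 2 - h1 * b 2

/-- linear polynomial -/
noncomputable def linP (c : Fin 3 → ℝ) : MvPolynomial (Fin 3) ℝ := C (c 0) * X 0 + C (c 1) * X 1 + C (c 2) * X 2

lemma linP_eval (c q : Fin 3 → ℝ) : eval q (linP c) = dt c q := by simp [linP, dt]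
lemma linP_nv (c q : Fin 3 → ℝ) : nv (linP c) q = c := by
  apply vec3_ext <;> simp [nv, linP, pderiv_X, Pi.single_apply]

lemma family (f : MvPolynomial (Fin 3) ℝ) (g : MvPolynomial S6 ℝ) (c : Fin 3 → ℝ) (U : Set (S6 → ℝ))
    (hU : IsOpen U) (hr : ∀ x ∈ U, x ∈ Mset f g c → Reg f g x)
    (hF2 : ∀ x ∈ U, x ∈ Mset f g c → eval x (Eo (Eo (fq f))) = 0)
    (hEg : ∀ x ∈ U, x ∈ Mset f g c → eval x (Eo g) = 0)
    (x0 : S6 → ℝ) (hx0U : x0 ∈ U) (hx0 : x0 ∈ Mset f g c) :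
    ∃ q v ε, Fam f q v ε ∧ q 0 = qq x0 ∧ v 0 = vv x0 := by
  have hprop := propagate f g c U hU hr hF2 hEg
  have hreg := hr x0 hx0U hx0
  set n := nv f (qq x0) with hn
  set h := cr n c with hh
  have hnv : dt n (vv x0) = 0 := by rw [hn, ← F1_eval]; exact hx0.2.1
  have hcv : dt c (vv x0) = 1 := hx0.2.2.2
  have hc0 : c ≠ 0 := by rintro rfl; simp [dt] at hcv
  have hhne : h ≠ 0 := by
    intro h0
    obtain ⟨k, hk⟩ := cr_eq_zero h0 hc0
    have : k = 0 := by
      rw [hk] at hnv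
      simp only [dt, Pi.smul_apply, smul_eq_mul] at hnv hcv
      linear_combination hnv - k * hcv
    exact hreg.n_ne (by rw [← hn, hk, this, zero_smul])
  let Φ : Fin 6 → MvPolynomial S6 ℝ := ![fq f, Eo (fq f), g, cP c, fq (linP c), fq (linP h)]
  let Ψ : (S6 → ℝ) → (Fin 6 → ℝ) := fun x i => eval x (Φ i)
  let L : (S6 → ℝ) →L[ℝ] (Fin 6 → ℝ) := ContinuousLinearMap.pi fun i => dP (Φ i) x0
  have hΨ : HasStrictFDerivAt Ψ L x0 := hasStrictFDerivAt_pi.2 fun i => hasStrictFDerivAt_eval (Φ i) x0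
  let G : Fin 3 → ℝ := fun i => eval x0 (pderiv (Sum.inr i) g)
  have hG : ∀ w, dP g x0 (Sum.elim 0 w) = dt G w := by
    intro w; simp [dP_apply, G, dt, Fin.sum_univ_three]
  have hnG : cr n G ≠ 0 := by
    intro h0
    by_cases hG0 : G = 0
    · have := (hreg.1 0 1 (by intro w; rw [hG, hG0]; simp [dt])).2
      simp at this
    · obtain ⟨k, hk⟩ := cr_eq_zero h0 hG0
      have := (hreg.1 1 (-k) (by
        intro w; rw [hG, ← hn, hk]; simp only [dt, Pi.smul_apply, smul_eq_mul]; ring)).1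
      simp at this
  have hinj : Function.Injective L := by
    rw [injective_iff_map_eq_zero]
    intro y hy
    have hy' : y = Sum.elim (qq y) (vv y) := by ext i; rcases i with i | i <;> rfl
    have e : ∀ i, dP (Φ i) x0 y = 0 := fun i => congrFun hy i
    have e0 := e 0
    have e1 := e 1
    have e2 := e 2
    have e3 := e 3
    have e4 := e 4
    have e5 := e 5
    simp only [Φ, Matrix.cons_val] at e0 e1 e2 e3 e4 e5
    rw [hy'] at e0 e1 e2 e3 e4 e5
    rw [dP_fq] at e0 e4 e5
    rw [linP_nv] at e4 e5
    have hu : qq y = 0 := three_perp e0 e4 e5 hhne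
    rw [dP_F1, hu, ← hn] at e1
    rw [hu, hG] at e2
    rw [dP_cP] at e3
    have e1' : dt n (vv y) = 0 := by simpa [bil] using e1
    obtain ⟨k, hk⟩ := perp_two e1' e2 hnG
    have hgv : dt G (vv x0) = 0 := by rw [← hG]; exact hreg.2
    obtain ⟨k', hk'⟩ := perp_two hnv hgv hnG
    have hk0 : k = 0 := by
      rw [hk] at e3
      rw [hk'] at hcv
      simp only [dt, Pi.smul_apply, smul_eq_mul] at e3 hcv
      linear_combination k' * e3 - k * hcv
    have hw : vv y = 0 := by rw [hk, hk0, zero_smul]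
    rw [hy', hu, hw]
    ext i; rcases i with i | i <;> rfl
  let eL : (S6 → ℝ) ≃L[ℝ] (Fin 6 → ℝ) :=
    (LinearEquiv.ofInjectiveOfFinrankEq L.toLinearMap hinj (by simp)).toContinuousLinearEquiv
  have hΨ' : HasStrictFDerivAt Ψ (eL : (S6 → ℝ) →L[ℝ] (Fin 6 → ℝ)) x0 := by
    convert hΨ using 1
    exact ContinuousLinearMap.ext fun _ => rfl
  let e := hΨ'.toOpenPartialHomeomorph Ψ
  let y : ℝ → (Fin 6 → ℝ) := fun τ => Ψ x0 + τ • Pi.single 5 1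
  have hycont : Continuous y := by fun_prop
  have hO : IsOpen (e.target ∩ e.symm ⁻¹' U) := e.continuousOn_symm.isOpen_inter_preimage e.open_target hU
  have hmem : y 0 ∈ e.target ∩ e.symm ⁻¹' U := by
    have h1 : y 0 = Ψ x0 := by simp [y]
    rw [h1]
    refine ⟨hΨ'.image_mem_toOpenPartialHomeomorph_target, ?_⟩
    have h2 : e.symm (Ψ x0) = x0 := e.left_inv hΨ'.mem_toOpenPartialHomeomorph_source
    show e.symm (Ψ x0) ∈ U
    rw [h2]; exact hx0U
  obtain ⟨ε, hε, hball⟩ := Metric.isOpen_iff.mp (hO.preimage hycont) 0 hmem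
  have hI : ∀ τ ∈ Set.Icc (0:ℝ) (ε/2), y τ ∈ e.target ∩ e.symm ⁻¹' U := by
    intro τ hτ
    apply hball
    simp only [Metric.mem_ball, dist_zero_right, Real.norm_eq_abs]
    rw [abs_of_nonneg hτ.1]; linarith [hτ.2]
  let x : ℝ → (S6 → ℝ) := fun τ => e.symm (y τ)
  have hx : ∀ τ ∈ Set.Icc (0:ℝ) (ε/2), Ψ (x τ) = y τ := fun τ hτ => e.right_inv (hI τ hτ).1
  have hxc : ContinuousOn x (Set.Icc 0 (ε/2)) :=
    e.continuousOn_symm.comp hycont.continuousOn fun τ hτ => (hI τ hτ).1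
  have hx00 : x 0 = x0 := by
    have h1 : y 0 = Ψ x0 := by simp [y]
    simp only [x, h1]
    exact e.left_inv hΨ'.mem_toOpenPartialHomeomorph_source
  have hΦ : ∀ τ ∈ Set.Icc (0:ℝ) (ε/2), ∀ i, eval (x τ) (Φ i) = eval x0 (Φ i) + τ * (Pi.single 5 1 : Fin 6 → ℝ) i :=
    fun τ hτ i => congrFun (hx τ hτ) i
  have hM : ∀ τ ∈ Set.Icc (0:ℝ) (ε/2), x τ ∈ Mset f g c := by
    intro τ hτ
    have h0 := hΦ τ hτ 0
    have h1 := hΦ τ hτ 1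
    have h2 := hΦ τ hτ 2
    have h3 := hΦ τ hτ 3
    simp [Φ, Pi.single_apply] at h0 h1 h2 h3
    refine ⟨h0.trans hx0.1, h1.trans hx0.2.1, h2.trans hx0.2.2.1, ?_⟩
    rw [cP_eval, cP_eval] at h3
    exact h3.trans hx0.2.2.2
  refine ⟨fun τ => qq (x τ), fun τ => vv (x τ), ε/2, ⟨by linarith, ?_, ?_, ?_, ?_, ?_⟩, by simp [hx00], by simp [hx00]⟩
  · exact (by unfold qq; fun_prop : Continuous qq).comp_continuousOn hxc
  · exact (by unfold vv; fun_prop : Continuous vv).comp_continuousOn hxc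
  · intro τ hτ h0
    have := (hM τ hτ).2.2.2
    rw [h0] at this
    simp [dt] at this
  · intro τ hτ s
    exact hprop (x τ) (hI τ hτ).2 (hM τ hτ) s
  · intro τ hτ τ' hτ' hl
    have hm : qq (x τ) ∈ lineThrough (qq (x τ)) (vv (x τ)) := ⟨0, by simp⟩
    simp only at hl
    rw [hl] at hm
    obtain ⟨t, ht⟩ := hm
    have a4 := hΦ τ hτ 4
    have b4 := hΦ τ' hτ' 4
    have a5 := hΦ τ hτ 5
    have b5 := hΦ τ' hτ' 5
    simp [Φ, Pi.single_apply, fq_eval, linP_eval] at a4 b4 a5 b5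
    have ht0 : t = 0 := by
      have h1 := (hM τ' hτ').2.2.2
      rw [← b4, ht] at a4
      simp only [dt, Pi.add_apply, Pi.smul_apply, smul_eq_mul] at a4 h1
      linear_combination a4 - t * h1
    rw [ht0] at ht
    simp at ht
    rw [ht] at a5
    linarith

open MvPolynomial
open scoped Classical

lemma st_decomp {n a b v : Fin 3 → ℝ} (h : dt n v = 0) :
    dt (cr n a) b • v = dt v b • cr n a + (-dt v a) • cr n b := by
  simp only [dt] at h ⊢
  apply vec3_ext <;>
    simp only [cr_0, cr_1, cr_2, Pi.smul_apply, Pi.add_apply, smul_eq_mul]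
  · linear_combination (a 1 * b 2 - a 2 * b 1) * h
  · linear_combination (a 2 * b 0 - a 0 * b 2) * h
  · linear_combination (a 0 * b 1 - a 1 * b 0) * h

lemma bil_smul (H : Fin 3 → Fin 3 → ℝ) (c : ℝ) (v w : Fin 3 → ℝ) : bil H (c • v) w = c * bil H v w := by
  simp [bil, Fin.sum_univ_three]; ring
lemma bil_smul' (H : Fin 3 → Fin 3 → ℝ) (c : ℝ) (v w : Fin 3 → ℝ) : bil H v (c • w) = c * bil H v w := by
  simp [bil, Fin.sum_univ_three]; ring
lemma bil_add (H : Fin 3 → Fin 3 → ℝ) (u v w : Fin 3 → ℝ) : bil H (u + v) w = bil H u w + bil H v w := by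
  simp [bil, Fin.sum_univ_three]; ring
lemma bil_add' (H : Fin 3 → Fin 3 → ℝ) (u v w : Fin 3 → ℝ) : bil H w (u + v) = bil H w u + bil H w v := by
  simp [bil, Fin.sum_univ_three]; ring
lemma bil_comm (f : MvPolynomial (Fin 3) ℝ) (q u v : Fin 3 → ℝ) : bil (Hv f q) u v = bil (Hv f q) v u := by
  have h01 : pderiv 1 (pderiv 0 f) = pderiv 0 (pderiv 1 f) := pderiv_comm' _ _ _
  have h02 : pderiv 2 (pderiv 0 f) = pderiv 0 (pderiv 2 f) := pderiv_comm' _ _ _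
  have h12 : pderiv 2 (pderiv 1 f) = pderiv 1 (pderiv 2 f) := pderiv_comm' _ _ _
  simp [bil, Fin.sum_univ_three, Hv, h01, h02, h12]; ring

lemma tri_eq (T : Fin 3 → Fin 3 → Fin 3 → ℝ) (u v w : Fin 3 → ℝ) :
    tri T u v w = ∑ i, u i * bil (T i) v w := by
  simp only [tri, bil, Finset.mul_sum]
  refine Finset.sum_congr rfl fun i _ => Finset.sum_congr rfl fun j _ => Finset.sum_congr rfl fun k _ => by ring

lemma tri_smul (T : Fin 3 → Fin 3 → Fin 3 → ℝ) (c : ℝ) (u v w : Fin 3 → ℝ) :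
    tri T (c • u) v w = c * tri T u v w := by
  simp [tri_eq, Finset.mul_sum, mul_assoc]
lemma tri_add (T : Fin 3 → Fin 3 → Fin 3 → ℝ) (u u' v w : Fin 3 → ℝ) :
    tri T (u + u') v w = tri T u v w + tri T u' v w := by
  simp [tri_eq, Finset.sum_add_distrib, add_mul]

lemma tri_swap12 (f : MvPolynomial (Fin 3) ℝ) (q u v w : Fin 3 → ℝ) :
    tri (Tv f q) u v w = tri (Tv f q) v u w := by
  simp only [tri]
  rw [Finset.sum_comm]
  refine Finset.sum_congr rfl fun i _ => Finset.sum_congr rfl fun j _ => Finset.sum_congr rfl fun k _ => ?_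
  simp only [Tv]
  rw [pderiv_comm' j i]; ring
lemma tri_swap23 (f : MvPolynomial (Fin 3) ℝ) (q u v w : Fin 3 → ℝ) :
    tri (Tv f q) u v w = tri (Tv f q) u w v := by
  simp only [tri]
  refine Finset.sum_congr rfl fun i _ => ?_
  rw [Finset.sum_comm]
  refine Finset.sum_congr rfl fun j _ => Finset.sum_congr rfl fun k _ => ?_
  simp only [Tv]
  rw [pderiv_comm' k j]; ring

lemma bil_comb (f : MvPolynomial (Fin 3) ℝ) (q : Fin 3 → ℝ) (o s t : ℝ) (v e1 e2 : Fin 3 → ℝ)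
    (h : o • v = s • e1 + t • e2) :
    o ^ 2 * bil (Hv f q) v v = bil (Hv f q) e1 e1 * s ^ 2 + 2 * bil (Hv f q) e1 e2 * s * t
      + bil (Hv f q) e2 e2 * t ^ 2 := by
  have h1 : bil (Hv f q) (o • v) (o • v) = o ^ 2 * bil (Hv f q) v v := by
    rw [bil_smul, bil_smul']; ring
  rw [← h1, h]
  simp only [bil_add, bil_add', bil_smul, bil_smul', bil_comm f q e2 e1]
  ring

lemma tri_comb (f : MvPolynomial (Fin 3) ℝ) (q : Fin 3 → ℝ) (o s t : ℝ) (v e1 e2 : Fin 3 → ℝ)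
    (h : o • v = s • e1 + t • e2) :
    o ^ 3 * tri (Tv f q) v v v = tri (Tv f q) e1 e1 e1 * s ^ 3 + 3 * tri (Tv f q) e1 e1 e2 * s ^ 2 * t
      + 3 * tri (Tv f q) e1 e2 e2 * s * t ^ 2 + tri (Tv f q) e2 e2 e2 * t ^ 3 := by
  have e : ∀ x y, o * tri (Tv f q) v x y = s * tri (Tv f q) e1 x y + t * tri (Tv f q) e2 x y := by
    intro x y
    rw [← tri_smul, h, tri_add, tri_smul, tri_smul]
  have a1 := e v v
  have a2 := e e1 v
  have a3 := e e2 v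
  have b1 := e e1 e1
  have b2 := e e1 e2
  have b3 := e e2 e2
  have s1 := tri_swap12 f q e1 v v
  have s2 := tri_swap12 f q e2 v v
  have s3 : tri (Tv f q) e1 e1 v = tri (Tv f q) v e1 e1 := by
    rw [tri_swap23, tri_swap12]
  have s4 : tri (Tv f q) e1 e2 v = tri (Tv f q) v e1 e2 := by
    rw [tri_swap23, tri_swap12]
  have s5 : tri (Tv f q) e2 e2 v = tri (Tv f q) v e2 e2 := by
    rw [tri_swap23, tri_swap12]
  have s6 : tri (Tv f q) e2 e1 v = tri (Tv f q) v e1 e2 := by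
    rw [tri_swap12, s4]
  have s7 : tri (Tv f q) e2 e1 e1 = tri (Tv f q) e1 e1 e2 := by
    rw [tri_swap12, tri_swap23]
  have s8 : tri (Tv f q) e2 e1 e2 = tri (Tv f q) e1 e2 e2 := tri_swap12 ..
  rw [s1, s2] at a1
  rw [s3, s6] at a2
  rw [s4, s5] at a3
  rw [s7] at b1
  rw [s8] at b2
  linear_combination o ^ 2 * a1 + o * s * a2 + o * t * a3 + s ^ 2 * b1 + 2 * s * t * b2 + t ^ 2 * b3

/-- coefficients of the resultant -/
def kapR {R : Type*} [CommRing R] (al be ga c0 c1 c2 : R) : R :=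
  al * (al * c2 - ga * c0) - (be + be) * (al * c1 - (be + be) * c0)
def lamR {R : Type*} [CommRing R] (al be ga c0 c1 c3 : R) : R :=
  al * al * c3 - ga * (al * c1 - (be + be) * c0)

lemma red_cubic (al be ga c0 c1 c2 c3 s t : ℝ) (h : al * s ^ 2 + 2 * be * s * t + ga * t ^ 2 = 0) :
    al ^ 2 * (c0 * s ^ 3 + c1 * s ^ 2 * t + c2 * s * t ^ 2 + c3 * t ^ 3)
      = t ^ 2 * (kapR al be ga c0 c1 c2 * s + lamR al be ga c0 c1 c3 * t) := by
  unfold kapR lamR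
  linear_combination (al * c0 * s + (al * c1 - 2 * be * c0) * t) * h

open MvPolynomial
open scoped Classical

noncomputable def nP (f : MvPolynomial (Fin 3) ℝ) : Fin 3 → MvPolynomial (Fin 3) ℝ := fun i => pderiv i f
noncomputable def HP (f : MvPolynomial (Fin 3) ℝ) : Fin 3 → Fin 3 → MvPolynomial (Fin 3) ℝ :=
  fun i j => pderiv i (pderiv j f)
noncomputable def TP (f : MvPolynomial (Fin 3) ℝ) : Fin 3 → Fin 3 → Fin 3 → MvPolynomial (Fin 3) ℝ :=
  fun i j k => pderiv i (pderiv j (pderiv k f))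
noncomputable def cv (a : Fin 3 → ℝ) : Fin 3 → MvPolynomial (Fin 3) ℝ := fun i => C (a i)
/-- tangent vector field -/
noncomputable def eP (f : MvPolynomial (Fin 3) ℝ) (a : Fin 3 → ℝ) : Fin 3 → MvPolynomial (Fin 3) ℝ :=
  cr (nP f) (cv a)
noncomputable def ev (f : MvPolynomial (Fin 3) ℝ) (q a : Fin 3 → ℝ) : Fin 3 → ℝ := cr (nv f q) a

lemma eP_eval (f : MvPolynomial (Fin 3) ℝ) (q a : Fin 3 → ℝ) (i : Fin 3) :
    eval q (eP f a i) = ev f q a i := by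
  fin_cases i <;> simp [eP, ev, cr, nP, nv, cv]

noncomputable def wP (f : MvPolynomial (Fin 3) ℝ) (a b : Fin 3 → ℝ) := dt (eP f a) (cv b)
noncomputable def bP (f : MvPolynomial (Fin 3) ℝ) (a b : Fin 3 → ℝ) := bil (HP f) (eP f a) (eP f b)
noncomputable def tP (f : MvPolynomial (Fin 3) ℝ) (a b c : Fin 3 → ℝ) :=
  tri (TP f) (eP f a) (eP f b) (eP f c)

lemma wP_eval (f : MvPolynomial (Fin 3) ℝ) (q a b : Fin 3 → ℝ) :
    eval q (wP f a b) = dt (cr (nv f q) a) b := by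
  simp only [wP, dt, map_add, map_mul, eP_eval, cv, eval_C]; rfl
lemma bP_eval (f : MvPolynomial (Fin 3) ℝ) (q a b : Fin 3 → ℝ) :
    eval q (bP f a b) = bil (Hv f q) (cr (nv f q) a) (cr (nv f q) b) := by
  simp only [bP, bil, map_sum, map_mul, eP_eval]; rfl
lemma tP_eval (f : MvPolynomial (Fin 3) ℝ) (q a b c : Fin 3 → ℝ) :
    eval q (tP f a b c) = tri (Tv f q) (cr (nv f q) a) (cr (nv f q) b) (cr (nv f q) c) := by
  simp only [tP, tri, map_sum, map_mul, eP_eval]; rfl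

noncomputable def c1P (f : MvPolynomial (Fin 3) ℝ) (a b : Fin 3 → ℝ) := tP f a a b + tP f a a b + tP f a a b
noncomputable def c2P (f : MvPolynomial (Fin 3) ℝ) (a b : Fin 3 → ℝ) := tP f a b b + tP f a b b + tP f a b b
noncomputable def DeP (f : MvPolynomial (Fin 3) ℝ) (a b : Fin 3 → ℝ) := bP f a b * bP f a b - bP f a a * bP f b b
noncomputable def kaP (f : MvPolynomial (Fin 3) ℝ) (a b : Fin 3 → ℝ) :=
  kapR (bP f a a) (bP f a b) (bP f b b) (tP f a a a) (c1P f a b) (c2P f a b)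
noncomputable def laP (f : MvPolynomial (Fin 3) ℝ) (a b : Fin 3 → ℝ) :=
  lamR (bP f a a) (bP f a b) (bP f b b) (tP f a a a) (c1P f a b) (tP f b b b)
noncomputable def GP (f : MvPolynomial (Fin 3) ℝ) (a b : Fin 3 → ℝ) :=
  bP f a a * (laP f a b * laP f a b) - (bP f a b + bP f a b) * (kaP f a b * laP f a b)
    + bP f b b * (kaP f a b * kaP f a b)

lemma tdeg_add {p q : MvPolynomial (Fin 3) ℝ} {k : ℕ} (hp : p.totalDegree ≤ k) (hq : q.totalDegree ≤ k) :
    (p + q).totalDegree ≤ k := (totalDegree_add p q).trans (max_le hp hq)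
lemma tdeg_sub {p q : MvPolynomial (Fin 3) ℝ} {k : ℕ} (hp : p.totalDegree ≤ k) (hq : q.totalDegree ≤ k) :
    (p - q).totalDegree ≤ k := (totalDegree_sub p q).trans (max_le hp hq)
lemma tdeg_mul {p q : MvPolynomial (Fin 3) ℝ} {k l m : ℕ} (hp : p.totalDegree ≤ k) (hq : q.totalDegree ≤ l)
    (h : k + l ≤ m) : (p * q).totalDegree ≤ m := (totalDegree_mul p q).trans (by omega)
lemma tdeg_sum {ι : Type*} (s : Finset ι) (F : ι → MvPolynomial (Fin 3) ℝ) {k : ℕ}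
    (h : ∀ i, (F i).totalDegree ≤ k) : (∑ i ∈ s, F i).totalDegree ≤ k :=
  (totalDegree_finsetSum s F).trans (Finset.sup_le fun i _ => h i)

lemma tdeg_pderiv (f : MvPolynomial (Fin 3) ℝ) (i : Fin 3) :
    (pderiv i f).totalDegree ≤ f.totalDegree - 1 := by
  refine Finset.sup_le fun m hm => ?_
  have h1 : coeff m (pderiv i f) ≠ 0 := mem_support_iff.mp hm
  rw [coeff_pderiv] at h1
  have h2 : coeff (m + Finsupp.single i 1) f ≠ 0 := left_ne_zero_of_mul h1
  have h3 := le_totalDegree (mem_support_iff.mpr h2)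
  rw [Finsupp.sum_add_index' (by simp) (by simp)] at h3
  simp at h3
  omega

lemma pderiv_ne (f : MvPolynomial (Fin 3) ℝ) (hf : 1 ≤ f.totalDegree) : ∃ i, pderiv i f ≠ 0 := by
  by_contra hc
  push Not at hc
  have : f.totalDegree ≤ 0 := by
    refine Finset.sup_le fun m hm => ?_
    have : m = 0 := by
      ext i
      by_contra hi
      have h1 : coeff (m - Finsupp.single i 1) (pderiv i f) = 0 := by rw [hc i]; simp
      rw [coeff_pderiv] at h1
      have h2 : m - Finsupp.single i 1 + Finsupp.single i 1 = m := by
        apply tsub_add_cancel_of_le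
        simp only [Finsupp.single_le_iff]
        simp at hi; omega
      rw [h2] at h1
      rcases mul_eq_zero.mp h1 with h | h
      · exact mem_support_iff.mp hm h
      · exact absurd h (by positivity)
    simp [this]
  omega

lemma tdeg_nP (f : MvPolynomial (Fin 3) ℝ) (i) : (nP f i).totalDegree ≤ f.totalDegree := (tdeg_pderiv f i).trans (Nat.sub_le _ _)
lemma tdeg_HP (f : MvPolynomial (Fin 3) ℝ) (i j) : (HP f i j).totalDegree ≤ f.totalDegree :=
  (tdeg_nP _ i).trans (tdeg_nP _ j)
lemma tdeg_TP (f : MvPolynomial (Fin 3) ℝ) (i j k) : (TP f i j k).totalDegree ≤ f.totalDegree :=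
  (tdeg_nP _ i).trans (tdeg_HP _ j k)
lemma tdeg_eP (f : MvPolynomial (Fin 3) ℝ) (a : Fin 3 → ℝ) (i) : (eP f a i).totalDegree ≤ f.totalDegree := by
  have h : ∀ i j, (nP f i * cv a j).totalDegree ≤ f.totalDegree := fun i j =>
    tdeg_mul (tdeg_nP f i) (l := 0) (by simp [cv]) le_rfl
  fin_cases i <;> exact tdeg_sub (h _ _) (h _ _)
lemma tdeg_wP (f : MvPolynomial (Fin 3) ℝ) (a b : Fin 3 → ℝ) : (wP f a b).totalDegree ≤ f.totalDegree := by
  have h : ∀ i, (eP f a i * cv b i).totalDegree ≤ f.totalDegree := fun i =>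
    tdeg_mul (tdeg_eP f a i) (l := 0) (by simp [cv]) le_rfl
  exact tdeg_add (tdeg_add (h _) (h _)) (h _)
lemma tdeg_bP (f : MvPolynomial (Fin 3) ℝ) (a b : Fin 3 → ℝ) : (bP f a b).totalDegree ≤ 3 * f.totalDegree := by
  refine tdeg_sum _ _ fun i => tdeg_sum _ _ fun j => ?_
  exact tdeg_mul (tdeg_mul (tdeg_HP f i j) (tdeg_eP f a i) le_rfl) (tdeg_eP f b j) (by omega)
lemma tdeg_tP (f : MvPolynomial (Fin 3) ℝ) (a b c : Fin 3 → ℝ) : (tP f a b c).totalDegree ≤ 4 * f.totalDegree := by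
  refine tdeg_sum _ _ fun i => tdeg_sum _ _ fun j => tdeg_sum _ _ fun k => ?_
  exact tdeg_mul (tdeg_mul (tdeg_mul (tdeg_TP f i j k) (tdeg_eP f a i) le_rfl) (tdeg_eP f b j) le_rfl)
    (tdeg_eP f c k) (by omega)
lemma tdeg_DeP (f : MvPolynomial (Fin 3) ℝ) (a b : Fin 3 → ℝ) : (DeP f a b).totalDegree ≤ 6 * f.totalDegree :=
  tdeg_sub (tdeg_mul (tdeg_bP f _ _) (tdeg_bP f _ _) (by omega)) (tdeg_mul (tdeg_bP f _ _) (tdeg_bP f _ _) (by omega))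
lemma tdeg_c1P (f : MvPolynomial (Fin 3) ℝ) (a b : Fin 3 → ℝ) : (c1P f a b).totalDegree ≤ 4 * f.totalDegree :=
  tdeg_add (tdeg_add (tdeg_tP ..) (tdeg_tP ..)) (tdeg_tP ..)
lemma tdeg_c2P (f : MvPolynomial (Fin 3) ℝ) (a b : Fin 3 → ℝ) : (c2P f a b).totalDegree ≤ 4 * f.totalDegree :=
  tdeg_add (tdeg_add (tdeg_tP ..) (tdeg_tP ..)) (tdeg_tP ..)
lemma tdeg_aux (f : MvPolynomial (Fin 3) ℝ) (a b : Fin 3 → ℝ) :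
    (bP f a a * c1P f a b - (bP f a b + bP f a b) * tP f a a a).totalDegree ≤ 7 * f.totalDegree :=
  tdeg_sub (tdeg_mul (tdeg_bP ..) (tdeg_c1P ..) (by omega))
    (tdeg_mul (tdeg_add (tdeg_bP ..) (tdeg_bP ..)) (tdeg_tP ..) (by omega))
lemma tdeg_kaP (f : MvPolynomial (Fin 3) ℝ) (a b : Fin 3 → ℝ) : (kaP f a b).totalDegree ≤ 10 * f.totalDegree := by
  refine tdeg_sub (tdeg_mul (tdeg_bP ..) (l := 7 * f.totalDegree) ?_ (by omega))
    (tdeg_mul (tdeg_add (tdeg_bP ..) (tdeg_bP ..)) (tdeg_aux ..) (by omega))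
  exact tdeg_sub (tdeg_mul (tdeg_bP ..) (tdeg_c2P ..) (by omega)) (tdeg_mul (tdeg_bP ..) (tdeg_tP ..) (by omega))
lemma tdeg_laP (f : MvPolynomial (Fin 3) ℝ) (a b : Fin 3 → ℝ) : (laP f a b).totalDegree ≤ 10 * f.totalDegree :=
  tdeg_sub (tdeg_mul (tdeg_mul (tdeg_bP ..) (tdeg_bP ..) le_rfl) (tdeg_tP ..) (by omega))
    (tdeg_mul (tdeg_bP ..) (tdeg_aux ..) (by omega))
lemma tdeg_GP (f : MvPolynomial (Fin 3) ℝ) (a b : Fin 3 → ℝ) : (GP f a b).totalDegree ≤ 23 * f.totalDegree := by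
  refine tdeg_add (tdeg_sub (tdeg_mul (tdeg_bP ..) (tdeg_mul (tdeg_laP ..) (tdeg_laP ..) le_rfl) (by omega))
    (tdeg_mul (tdeg_add (tdeg_bP ..) (tdeg_bP ..)) (tdeg_mul (tdeg_kaP ..) (tdeg_laP ..) le_rfl) (by omega)))
    (tdeg_mul (tdeg_bP ..) (tdeg_mul (tdeg_kaP ..) (tdeg_kaP ..) le_rfl) (by omega))

open MvPolynomial
open scoped Classical

lemma qq_elim (q v : Fin 3 → ℝ) : qq (Sum.elim q v) = q := rfl
lemma vv_elim (q v : Fin 3 → ℝ) : vv (Sum.elim q v) = v := rfl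

lemma line_facts (f : MvPolynomial (Fin 3) ℝ) (q v : Fin 3 → ℝ) (h : ∀ s : ℝ, eval (q + s • v) f = 0) :
    eval q f = 0 ∧ dt (nv f q) v = 0 ∧ bil (Hv f q) v v = 0 ∧ tri (Tv f q) v v v = 0 := by
  have hk := iter_of_line (Sum.elim q v) f h
  refine ⟨by simpa using h 0, ?_, ?_, ?_⟩
  · have := hk 1
    simp only [Function.iterate_succ, Function.iterate_zero, Function.comp_apply, id] at this
    rw [F1_eval] at this; exact this
  · have := hk 2
    simp only [Function.iterate_succ, Function.iterate_zero, Function.comp_apply, id] at this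
    rw [F2_eval] at this; exact this
  · have := hk 3
    simp only [Function.iterate_succ, Function.iterate_zero, Function.comp_apply, id] at this
    rw [F3_eval] at this; exact this

lemma Q2_eq (f : MvPolynomial (Fin 3) ℝ) (a b q v : Fin 3 → ℝ) (h : dt (nv f q) v = 0) :
    eval q (wP f a b) ^ 2 * bil (Hv f q) v v = eval q (bP f a a) * dt v b ^ 2
      + 2 * eval q (bP f a b) * dt v b * (-dt v a) + eval q (bP f b b) * (-dt v a) ^ 2 := by
  simp only [wP_eval, bP_eval]
  exact bil_comb f q _ _ _ v _ _ (st_decomp h)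

lemma Q3_eq (f : MvPolynomial (Fin 3) ℝ) (a b q v : Fin 3 → ℝ) (h : dt (nv f q) v = 0) :
    eval q (wP f a b) ^ 3 * tri (Tv f q) v v v = eval q (tP f a a a) * dt v b ^ 3
      + eval q (c1P f a b) * dt v b ^ 2 * (-dt v a) + eval q (c2P f a b) * dt v b * (-dt v a) ^ 2
      + eval q (tP f b b b) * (-dt v a) ^ 3 := by
  simp only [wP_eval, c1P, c2P, map_add, tP_eval]
  rw [tri_comb f q _ _ _ v _ _ (st_decomp h)]
  ring

lemma red_eq (f : MvPolynomial (Fin 3) ℝ) (a b q v : Fin 3 → ℝ) (h : dt (nv f q) v = 0)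
    (h2 : bil (Hv f q) v v = 0) :
    eval q (bP f a a) ^ 2 * (eval q (wP f a b) ^ 3 * tri (Tv f q) v v v) =
      (-dt v a) ^ 2 * (eval q (kaP f a b) * dt v b + eval q (laP f a b) * (-dt v a)) := by
  have e2 := Q2_eq f a b q v h
  rw [h2, mul_zero] at e2
  rw [Q3_eq f a b q v h, red_cubic _ _ _ _ _ _ _ _ _ e2.symm]
  simp only [kaP, laP, kapR, lamR, map_sub, map_add, map_mul]

lemma st_zero (f : MvPolynomial (Fin 3) ℝ) (a b q v : Fin 3 → ℝ) (h : dt (nv f q) v = 0)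
    (ho : eval q (wP f a b) ≠ 0) (hs : dt v b = 0) (ht : -dt v a = 0) : v = 0 := by
  have := st_decomp (a := a) (b := b) h
  rw [hs, ht, zero_smul, zero_smul, add_zero, ← wP_eval] at this
  exact (smul_eq_zero.mp this).resolve_left ho

lemma t_ne (f : MvPolynomial (Fin 3) ℝ) (a b q v : Fin 3 → ℝ) (h : dt (nv f q) v = 0)
    (h2 : bil (Hv f q) v v = 0) (hv : v ≠ 0)
    (ho : eval q (wP f a b) ≠ 0) (ha : eval q (bP f a a) ≠ 0) : -dt v a ≠ 0 := by
  intro ht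
  have e2 := Q2_eq f a b q v h
  rw [h2, ht] at e2
  have : eval q (bP f a a) * dt v b ^ 2 = 0 := by linarith
  have := (mul_eq_zero.mp this).resolve_left ha
  exact hv (st_zero f a b q v h ho (pow_eq_zero_iff (two_ne_zero) |>.mp this) ht)

lemma n_ne_of (f : MvPolynomial (Fin 3) ℝ) (a b q : Fin 3 → ℝ) (ho : eval q (wP f a b) ≠ 0) : nv f q ≠ 0 := by
  intro h
  rw [wP_eval, h] at ho
  simp [dt, cr] at ho

lemma dt_cr_self (n a : Fin 3 → ℝ) : dt n (cr n a) = 0 := by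
  simp only [dt, cr_0, cr_1, cr_2]; ring

lemma dP_F2_0 (f : MvPolynomial (Fin 3) ℝ) (x : S6 → ℝ) (w : Fin 3 → ℝ) :
    dP (Eo (Eo (fq f))) x (Sum.elim 0 w) = 2 * bil (Hv f (qq x)) (vv x) w := by
  rw [dP_F2]; simp [tri]

lemma smul_n_eq {n : Fin 3 → ℝ} (hn : n ≠ 0) {a : ℝ} (h : ∀ w, a * dt n w = 0) : a = 0 :=
  (mul_eq_zero.mp (h n)).resolve_right (dt_self_ne hn).ne'

lemma norm_c {v : Fin 3 → ℝ} (hv : v ≠ 0) : dt ((dt v v)⁻¹ • v) v = 1 := by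
  have := (dt_self_ne hv).ne'
  have e : dt ((dt v v)⁻¹ • v) v = (dt v v)⁻¹ * dt v v := by simp [dt]; ring
  rw [e, inv_mul_cancel₀ this]

lemma fam_nondeg (f : MvPolynomial (Fin 3) ℝ) (a b : Fin 3 → ℝ) (W : Set (S6 → ℝ)) (hWo : IsOpen W)
    (hW : ∀ x ∈ W, eval (qq x) (wP f a b) ≠ 0 ∧ eval (qq x) (DeP f a b) ≠ 0)
    (hF3 : ∀ x ∈ W, eval (qq x) f = 0 → dt (nv f (qq x)) (vv x) = 0 →
      bil (Hv f (qq x)) (vv x) (vv x) = 0 → tri (Tv f (qq x)) (vv x) (vv x) (vv x) = 0)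
    (q0 v0 : Fin 3 → ℝ) (hv0 : v0 ≠ 0) (hl : ∀ s : ℝ, eval (q0 + s • v0) f = 0)
    (hx : Sum.elim q0 v0 ∈ W) : ∃ q v ε, Fam f q v ε ∧ q 0 = q0 ∧ v 0 = v0 := by
  obtain ⟨l0, l1, l2, l3⟩ := line_facts f q0 v0 hl
  refine family f (Eo (Eo (fq f))) ((dt v0 v0)⁻¹ • v0) W hWo ?_ ?_ ?_ (Sum.elim q0 v0) hx ?_
  · rintro x hxW ⟨m0, m1, m2, m3⟩
    rw [F1_eval] at m1
    rw [F2_eval] at m2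
    obtain ⟨ho, hD⟩ := hW x hxW
    have hvx : vv x ≠ 0 := by intro h; rw [h] at m3; simp [dt] at m3
    have hn := n_ne_of f a b _ ho
    constructor
    · intro k l hkl
      have hl0 : l = 0 := by
        by_contra hl0
        have h1 := hkl (cr (nv f (qq x)) a)
        have h2 := hkl (cr (nv f (qq x)) b)
        rw [dt_cr_self, dP_F2_0] at h1 h2
        have h1' : bil (Hv f (qq x)) (vv x) (cr (nv f (qq x)) a) = 0 := by
          simpa [hl0] using h1
        have h2' : bil (Hv f (qq x)) (vv x) (cr (nv f (qq x)) b) = 0 := by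
          simpa [hl0] using h2
        have hd := st_decomp (a := a) (b := b) m1
        have g1 : bil (Hv f (qq x)) (dt (cr (nv f (qq x)) a) b • vv x) (cr (nv f (qq x)) a) = 0 := by
          rw [bil_smul, h1', mul_zero]
        have g2 : bil (Hv f (qq x)) (dt (cr (nv f (qq x)) a) b • vv x) (cr (nv f (qq x)) b) = 0 := by
          rw [bil_smul, h2', mul_zero]
        rw [hd, bil_add, bil_smul, bil_smul] at g1 g2
        rw [bil_comm f _ (cr (nv f (qq x)) b) (cr (nv f (qq x)) a)] at g1
        simp only [← bP_eval] at g1 g2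
        have hD' : eval (qq x) (DeP f a b) = eval (qq x) (bP f a b) * eval (qq x) (bP f a b)
          - eval (qq x) (bP f a a) * eval (qq x) (bP f b b) := by simp [DeP]
        apply hvx
        apply st_zero f a b _ _ m1 ho
        · have : eval (qq x) (DeP f a b) * dt (vv x) b = 0 := by
            rw [hD']; linear_combination eval (qq x) (bP f a b) * g2 - eval (qq x) (bP f b b) * g1
          exact (mul_eq_zero.mp this).resolve_left hD
        · have : eval (qq x) (DeP f a b) * -dt (vv x) a = 0 := by
            rw [hD']; linear_combination eval (qq x) (bP f a b) * g1 - eval (qq x) (bP f a a) * g2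
          exact (mul_eq_zero.mp this).resolve_left hD
      refine ⟨?_, hl0⟩
      apply smul_n_eq hn
      intro w
      have := hkl w
      rw [hl0] at this; linarith
    · rw [dP_F2_0, m2, mul_zero]
  · rintro x hxW ⟨m0, m1, m2, m3⟩
    exact m2
  · rintro x hxW ⟨m0, m1, m2, m3⟩
    rw [F3_eval]
    rw [fq_eval] at m0
    rw [F1_eval] at m1
    rw [F2_eval] at m2
    exact hF3 x hxW m0 m1 m2
  · refine ⟨?_, ?_, ?_, ?_⟩
    · rw [fq_eval]; exact l0
    · rw [F1_eval]; exact l1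
    · rw [F2_eval]; exact l2
    · exact norm_c hv0

/-- constraint for the parabolic case -/
noncomputable def gP (f : MvPolynomial (Fin 3) ℝ) (a : Fin 3 → ℝ) : MvPolynomial S6 ℝ :=
  ∑ i : Fin 3, ∑ j : Fin 3, fq (HP f i j) * X (Sum.inr i) * fq (eP f a j)

lemma gP_eval (f : MvPolynomial (Fin 3) ℝ) (a : Fin 3 → ℝ) (x : S6 → ℝ) :
    eval x (gP f a) = bil (Hv f (qq x)) (vv x) (cr (nv f (qq x)) a) := by
  simp only [gP, map_sum, map_mul, fq_eval, eP_eval, eval_X, bil]; rfl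

lemma dP_sum {σ ι : Type*} [Fintype σ] (s : Finset ι) (F : ι → MvPolynomial σ ℝ) (x u : σ → ℝ) :
    dP (∑ i ∈ s, F i) x u = ∑ i ∈ s, dP (F i) x u := by
  simp only [dP_apply, map_sum, Finset.sum_mul]
  rw [Finset.sum_comm]
lemma dP_mul {σ : Type*} [Fintype σ] (p q : MvPolynomial σ ℝ) (x u : σ → ℝ) :
    dP (p * q) x u = eval x p * dP q x u + eval x q * dP p x u := by
  simp only [dP_apply, Derivation.leibniz, map_add, smul_eq_mul, map_mul, add_mul, Finset.sum_add_distrib,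
    Finset.mul_sum, mul_assoc]
lemma dP_Xr (x : S6 → ℝ) (u w : Fin 3 → ℝ) (i : Fin 3) : dP (X (Sum.inr i)) x (Sum.elim u w) = w i := by
  simp [dP_apply, pderiv_X, Pi.single_apply]

lemma dP_gP_0 (f : MvPolynomial (Fin 3) ℝ) (a : Fin 3 → ℝ) (x : S6 → ℝ) (w : Fin 3 → ℝ) :
    dP (gP f a) x (Sum.elim 0 w) = bil (Hv f (qq x)) w (cr (nv f (qq x)) a) := by
  simp only [gP, dP_sum, dP_mul, dP_fq, dP_Xr, fq_eval, eP_eval, bil]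
  refine Finset.sum_congr rfl fun i _ => Finset.sum_congr rfl fun j _ => ?_
  simp [dt, ev, Hv, HP]; ring

lemma nv_HP (f : MvPolynomial (Fin 3) ℝ) (q u : Fin 3 → ℝ) (i j : Fin 3) :
    dt (nv (HP f i j) q) u = ∑ k, Tv f q k i j * u k := by
  simp [dt, nv, HP, Tv, Fin.sum_univ_three]

lemma nv_eP (f : MvPolynomial (Fin 3) ℝ) (a q u : Fin 3 → ℝ) (j : Fin 3) :
    dt (nv (eP f a j) q) u = cr (fun i => ∑ k, Hv f q k i * u k) a j := by
  fin_cases j <;>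
  simp [dt, nv, eP, cr, nP, cv, Hv, Fin.sum_univ_three] <;> ring

lemma Eo_gP (f : MvPolynomial (Fin 3) ℝ) (a : Fin 3 → ℝ) (x : S6 → ℝ) :
    eval x (Eo (gP f a)) = tri (Tv f (qq x)) (vv x) (vv x) (cr (nv f (qq x)) a) := by
  rw [Eo_eval]
  simp only [gP, dP_sum, dP_mul, dP_fq, dP_Xr, map_mul, eval_X, fq_eval, eP_eval, nv_HP, nv_eP]
  have h01 : pderiv 1 (pderiv 0 f) = pderiv 0 (pderiv 1 f) := pderiv_comm' _ _ _
  have h02 : pderiv 2 (pderiv 0 f) = pderiv 0 (pderiv 2 f) := pderiv_comm' _ _ _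
  have h12 : pderiv 2 (pderiv 1 f) = pderiv 1 (pderiv 2 f) := pderiv_comm' _ _ _
  simp only [Fin.sum_univ_three, tri, HP, cr_0, cr_1, cr_2, ev]
  simp only [Hv, h01, h02, h12]
  simp only [vv, Pi.zero_apply]
  ring

lemma fam_parab (f : MvPolynomial (Fin 3) ℝ) (a b : Fin 3 → ℝ) (hD : f ∣ DeP f a b)
    (q0 v0 : Fin 3 → ℝ) (hv0 : v0 ≠ 0) (hl : ∀ s : ℝ, eval (q0 + s • v0) f = 0)
    (ho : eval q0 (wP f a b) ≠ 0) (ha : eval q0 (bP f a a) ≠ 0) :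
    ∃ q v ε, Fam f q v ε ∧ q 0 = q0 ∧ v 0 = v0 := by
  obtain ⟨l0, l1, l2, l3⟩ := line_facts f q0 v0 hl
  let W : Set (S6 → ℝ) := {x | eval x (fq (wP f a b * bP f a a)) ≠ 0}
  have hWo : IsOpen W := isOpen_ne_fun (continuous_eval _) continuous_const
  have hW : ∀ x ∈ W, eval (qq x) (wP f a b) ≠ 0 ∧ eval (qq x) (bP f a a) ≠ 0 := by
    intro x hx
    have : eval x (fq (wP f a b * bP f a a)) ≠ 0 := hx
    rw [fq_eval, map_mul] at this
    exact ⟨left_ne_zero_of_mul this, right_ne_zero_of_mul this⟩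
  have hDe : ∀ q, eval q f = 0 → eval q (bP f a b) * eval q (bP f a b)
          - eval q (bP f a a) * eval q (bP f b b) = 0 := by
    intro q hq
    obtain ⟨k, hk⟩ := hD
    have := congrArg (eval q) hk
    rw [map_mul, hq, zero_mul] at this
    simpa [DeP] using this
  -- relation between g and s,t
  have hg : ∀ q v, dt (nv f q) v = 0 → eval q (wP f a b) * bil (Hv f q) v (cr (nv f q) a) =
      eval q (bP f a a) * dt v b + eval q (bP f a b) * (-dt v a) := by
    intro q v h
    rw [← bil_smul, wP_eval, st_decomp h, bil_add, bil_smul, bil_smul, bP_eval, bP_eval,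
      bil_comm f _ (cr (nv f q) b)]
    ring
  set c := (dt v0 v0)⁻¹ • v0 with hc
  have hF2 : ∀ x ∈ W, x ∈ Mset f (gP f a) c → eval x (Eo (Eo (fq f))) = 0 := by
    rintro x hxW ⟨m0, m1, m2, m3⟩
    rw [fq_eval] at m0
    rw [F1_eval] at m1
    rw [gP_eval] at m2
    rw [F2_eval]
    obtain ⟨ho, ha⟩ := hW x hxW
    have h1 := hg _ _ m1
    rw [m2, mul_zero] at h1
    have h2 := Q2_eq f a b _ _ m1
    have h3 := hDe _ m0
    have : eval (qq x) (bP f a a) * (eval (qq x) (wP f a b) ^ 2 * bil (Hv f (qq x)) (vv x) (vv x)) = 0 := by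
      rw [h2]
      linear_combination -(eval (qq x) (bP f a a) * dt (vv x) b + eval (qq x) (bP f a b) * (-dt (vv x) a)) * h1
        - (-dt (vv x) a) ^ 2 * h3
    have := (mul_eq_zero.mp this).resolve_left ha
    exact (mul_eq_zero.mp this).resolve_left (pow_ne_zero _ ho)
  have hReg : ∀ x ∈ W, x ∈ Mset f (gP f a) c → Reg f (gP f a) x := by
    rintro x hxW ⟨m0, m1, m2, m3⟩
    rw [gP_eval] at m2
    obtain ⟨ho, ha⟩ := hW x hxW
    constructor
    · intro k l hkl
      have h1 := hkl (cr (nv f (qq x)) a)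
      rw [dt_cr_self, dP_gP_0, ← bP_eval] at h1
      have hl0 : l = 0 := by simpa [ha] using h1
      refine ⟨smul_n_eq (n_ne_of f a b _ ho) fun w => ?_, hl0⟩
      have := hkl w
      rw [hl0] at this; linarith
    · rw [dP_gP_0, m2]
  refine family f (gP f a) c W hWo hReg hF2 ?_ (Sum.elim q0 v0) ?_ ?_
  · intro x hxW hx
    have hr := hReg x hxW hx
    obtain ⟨k1, k2, k3, k4, hk⟩ := mult_lemma f (gP f a) c W hWo x hxW hx hr _ hF2
    have hf2 := hF2 x hxW hx
    obtain ⟨m0, m1, m2, m3⟩ := hx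
    rw [F1_eval] at m1
    rw [gP_eval] at m2
    rw [F2_eval] at hf2
    obtain ⟨ho, ha⟩ := hW x hxW
    have b0 : ∀ w, bil (Hv f (qq x)) 0 w = 0 := by intro w; simp [bil]
    have d0 : ∀ w : Fin 3 → ℝ, dt w 0 = 0 := by intro w; simp [dt]
    have e1 := hk 0 (vv x)
    rw [dP_F2_0, hf2, dP_gP_0, m2, b0, d0, m1, m3] at e1
    have hk4 : k4 = 0 := by linarith
    have e2 := hk 0 (cr (nv f (qq x)) a)
    rw [dP_F2_0, m2, dP_gP_0, b0, d0, dt_cr_self, hk4, ← bP_eval] at e2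
    have hk3 : k3 = 0 := by
      have : k3 * eval (qq x) (bP f a a) = 0 := by linarith
      exact (mul_eq_zero.mp this).resolve_right ha
    have e3 := hk (cr (nv f (qq x)) a) 0
    rw [dP_F2, hk3, hk4, d0, dt_cr_self, bil_comm f _ (cr (nv f (qq x)) a), m2, bil_comm f _ (vv x) 0, b0] at e3
    rw [Eo_gP, tri_swap23, tri_swap12]
    linarith
  · show eval _ (fq (wP f a b * bP f a a)) ≠ 0
    rw [fq_eval, map_mul]
    exact mul_ne_zero ho ha
  · refine ⟨by rw [fq_eval]; exact l0, by rw [F1_eval]; exact l1, ?_, norm_c hv0⟩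
    rw [gP_eval, qq_elim, vv_elim]
    have h1 := hg _ _ l1
    have h2 := Q2_eq f a b _ _ l1
    rw [l2] at h2
    have h3 := hDe _ l0
    have : (eval q0 (bP f a a) * dt v0 b + eval q0 (bP f a b) * (-dt v0 a)) ^ 2 = 0 := by
      linear_combination (-eval q0 (bP f a a)) * h2 + (-dt v0 a) ^ 2 * h3
    rw [pow_eq_zero_iff two_ne_zero.elim] at this
    · rw [this] at h1
      exact (mul_eq_zero.mp h1).resolve_left ho

open MvPolynomial
open scoped Classical

lemma tdeg_dvd {f g : MvPolynomial (Fin 3) ℝ} (h : f ∣ g) (hg : g ≠ 0) : f.totalDegree ≤ g.totalDegree := by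
  obtain ⟨k, rfl⟩ := h
  rw [totalDegree_mul_of_isDomain (left_ne_zero_of_mul hg) (right_ne_zero_of_mul hg)]
  omega

lemma plane_fin (f : MvPolynomial (Fin 3) ℝ) (hf : Irreducible f) (hd : 2 ≤ f.totalDegree)
    (c : Fin 3 → ℝ) (hc : c ≠ 0) (k : ℝ) :
    {ℓ | IsLineIn (Zs f) ℓ ∧ ∀ x ∈ ℓ, dt c x = k}.Finite := by
  by_contra hinf
  obtain ⟨S, hS, hcard⟩ := Set.Infinite.exists_subset_card_eq hinf (2 * f.totalDegree * 1 + 1)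
  let g := linP c - C k
  have hgd : g.totalDegree ≤ 1 := by
    have h1 : ∀ i : Fin 3, (C (c i) * X i : MvPolynomial (Fin 3) ℝ).totalDegree ≤ 1 := fun i =>
      tdeg_mul (k := 0) (l := 1) (by simp) (by simp) (by omega)
    exact tdeg_sub (tdeg_add (tdeg_add (h1 0) (h1 1)) (h1 2)) (by simp)
  have hge : ∀ x, eval x g = dt c x - k := by intro x; simp [g, linP_eval]
  have hg0 : g ≠ 0 := by
    intro h0
    have h1 := hge 0
    have h2 := hge c
    rw [h0] at h1 h2
    simp [dt] at h1 h2
    have := dt_self_ne hc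
    simp only [dt] at this
    linarith
  have hfg : ¬ f ∣ g := fun h => by have := tdeg_dvd h hg0; omega
  have := bezout_lines f g hf hfg S (fun ℓ hℓ => (hS hℓ).1) (fun ℓ hℓ x hx => by
    show eval x g = 0
    rw [hge, (hS hℓ).2 x hx, sub_self])
  have h2 : 2 * f.totalDegree * g.totalDegree ≤ 2 * f.totalDegree * 1 := Nat.mul_le_mul_left _ hgd
  omega

lemma line_in_of {f : MvPolynomial (Fin 3) ℝ} {q v : Fin 3 → ℝ} (hv : v ≠ 0)
    (h : ∀ s : ℝ, eval (q + s • v) f = 0) : IsLineIn (Zs f) (lineThrough q v) := by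
  refine ⟨⟨q, v, hv, rfl⟩, ?_⟩
  rintro x ⟨s, rfl⟩
  exact h s

lemma pencil_inj (q a b : Fin 3 → ℝ) (hab : cr a b ≠ 0) :
    Function.Injective fun t : ℝ => lineThrough q (a + t • b) := by
  intro t t' h
  have h1 : q + (a + t' • b) ∈ lineThrough q (a + t' • b) := ⟨1, by simp⟩
  simp only at h
  rw [← h] at h1
  have h2 := mem_line_cr h1
  by_contra hne
  apply hab
  have h3 : cr (a + t • b) (q + (a + t' • b) - q) = (t' - t) • cr a b := by
    apply vec3_ext <;> simp only [cr_0, cr_1, cr_2, Pi.smul_apply, Pi.add_apply, Pi.sub_apply, smul_eq_mul] <;> ring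
  rw [h3] at h2
  exact (smul_eq_zero.mp h2).resolve_left (sub_ne_zero.mpr (Ne.symm hne))

lemma cr_cr_ne {n z : Fin 3 → ℝ} (h : cr n z ≠ 0) : cr (cr n z) (cr n (cr n z)) ≠ 0 := by
  intro h0
  have hn : n ≠ 0 := by rintro rfl; apply h; apply vec3_ext <;> simp [cr]
  have e : cr (cr n z) (cr n (cr n z)) = dt (cr n z) (cr n z) • n := by
    apply vec3_ext <;> simp only [cr_0, cr_1, cr_2, dt, Pi.smul_apply, smul_eq_mul] <;> ring
  rw [e] at h0
  rcases smul_eq_zero.mp h0 with h1 | h1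
  · exact (dt_self_ne h).ne' h1
  · exact hn h1

lemma flat_case (f : MvPolynomial (Fin 3) ℝ) (hf : Irreducible f) (hd : 2 ≤ f.totalDegree)
    (hfl : ∀ a, f ∣ bP f a a) (q0 : Fin 3 → ℝ) (hq0 : eval q0 f = 0) (hn : nv f q0 ≠ 0) : False := by
  set n := nv f q0 with hnd
  have key : ∀ v0 : Fin 3 → ℝ, v0 ≠ 0 → dt n v0 = 0 → ∀ s : ℝ, eval (q0 + s • v0) f = 0 := by
    intro v0 hv0 hnv
    let d := cr v0 n
    let W : Set (S6 → ℝ) := {x | cr (nv f (qq x)) d ≠ 0}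
    have hcont : Continuous fun x : S6 → ℝ => cr (nv f (qq x)) d := by
      have h1 : ∀ i, Continuous fun x : S6 → ℝ => nv f (qq x) i := fun i => by
        unfold nv
        exact (continuous_eval _).comp (by unfold qq; fun_prop)
      refine continuous_pi fun i => ?_
      fin_cases i <;> simp only [cr] <;> simp <;> fun_prop
    have hWo : IsOpen W := isOpen_ne_fun hcont continuous_const
    have hb0 : ∀ x, ∀ w, dP (cP d) x (Sum.elim 0 w) = dt d w := fun x w => dP_cP d x 0 w
    refine propagate f (cP d) ((dt v0 v0)⁻¹ • v0) W hWo ?_ ?_ ?_ (Sum.elim q0 v0) ?_ ?_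
    · rintro x hxW ⟨m0, m1, m2, m3⟩
      rw [cP_eval] at m2
      constructor
      · intro k l hkl
        simp only [hb0] at hkl
        have hxW' : cr (nv f (qq x)) d ≠ 0 := hxW
        have hkl' : k • nv f (qq x) + l • d = 0 := by
          have : dt (k • nv f (qq x) + l • d) (k • nv f (qq x) + l • d) = 0 := by
            have := hkl (k • nv f (qq x) + l • d)
            simp only [dt, Pi.add_apply, Pi.smul_apply, smul_eq_mul] at this ⊢
            linarith
          by_contra h
          exact (dt_self_ne h).ne' this
        have h0 := fun i => congrFun hkl' i
        simp only [Pi.add_apply, Pi.smul_apply, smul_eq_mul, Pi.zero_apply] at h0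
        constructor
        · by_contra hk
          apply hxW'
          have : k • cr (nv f (qq x)) d = 0 := by
            apply vec3_ext <;> simp only [cr_0, cr_1, cr_2, Pi.smul_apply, smul_eq_mul, Pi.zero_apply]
            · linear_combination d 2 * h0 1 - d 1 * h0 2
            · linear_combination d 0 * h0 2 - d 2 * h0 0
            · linear_combination d 1 * h0 0 - d 0 * h0 1
          exact (smul_eq_zero.mp this).resolve_left hk
        · by_contra hk
          apply hxW'
          have : l • cr (nv f (qq x)) d = 0 := by
            apply vec3_ext <;> simp only [cr_0, cr_1, cr_2, Pi.smul_apply, smul_eq_mul, Pi.zero_apply]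
            · linear_combination nv f (qq x) 1 * h0 2 - nv f (qq x) 2 * h0 1
            · linear_combination nv f (qq x) 2 * h0 0 - nv f (qq x) 0 * h0 2
            · linear_combination nv f (qq x) 0 * h0 1 - nv f (qq x) 1 * h0 0
          exact (smul_eq_zero.mp this).resolve_left hk
      · rw [hb0, m2]
    · rintro x hxW ⟨m0, m1, m2, m3⟩
      rw [fq_eval] at m0
      rw [cP_eval] at m2
      rw [F1_eval] at m1
      rw [F2_eval]
      obtain ⟨k, hk⟩ := perp_two m1 m2 hxW
      rw [hk, bil_smul, bil_smul', ← bP_eval]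
      obtain ⟨r, hr⟩ := hfl d
      rw [hr, map_mul, m0]; simp
    · intro x _ _
      simp [Eo, cP, pderiv_X, Pi.single_apply]
    · show cr n (cr v0 n) ≠ 0
      have e : cr n (cr v0 n) = dt n n • v0 - dt n v0 • n := by
        apply vec3_ext <;> simp only [cr_0, cr_1, cr_2, dt, Pi.smul_apply, Pi.sub_apply, smul_eq_mul] <;> ring
      rw [e, hnv, zero_smul, sub_zero]
      exact smul_ne_zero (dt_self_ne hn).ne' hv0
    · refine ⟨by rw [fq_eval]; exact hq0, by rw [F1_eval]; exact hnv, ?_, norm_c hv0⟩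
      rw [cP_eval, vv_elim]
      simp only [d, dt, cr_0, cr_1, cr_2]; ring
  obtain ⟨z, hz⟩ := exists_cr_ne hn
  have hfin := plane_fin f hf hd n hn (dt n q0)
  have hcc := cr_cr_ne hz
  have hinj := pencil_inj q0 _ _ hcc
  refine (Set.infinite_range_of_injective hinj) (hfin.subset ?_)
  rintro _ ⟨t, rfl⟩
  have hv : cr n z + t • cr n (cr n z) ≠ 0 := by
    intro h0
    apply hcc
    have h1 : cr n z = (-t) • cr n (cr n z) := by
      rw [neg_smul]; exact eq_neg_of_add_eq_zero_left h0
    generalize cr n (cr n z) = y at *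
    rw [h1]
    apply vec3_ext <;> simp only [cr_0, cr_1, cr_2, Pi.smul_apply, smul_eq_mul, Pi.zero_apply] <;> ring
  have hp : dt n (cr n z + t • cr n (cr n z)) = 0 := by
    simp only [cr_0, cr_1, cr_2, dt, Pi.smul_apply, Pi.add_apply, smul_eq_mul]; ring
  refine ⟨line_in_of hv (key _ hv hp), ?_⟩
  rintro x ⟨s, rfl⟩
  have : dt n (q0 + s • (cr n z + t • cr n (cr n z))) = dt n q0 + s * dt n (cr n z + t • cr n (cr n z)) := by
    simp only [dt, Pi.smul_apply, Pi.add_apply, smul_eq_mul]; ring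
  rw [this, hp]; ring

/-- two-direction lemma -/
lemma two_dirs (f : MvPolynomial (Fin 3) ℝ) (a b q : Fin 3 → ℝ) (ho : eval q (wP f a b) ≠ 0)
    (ha : eval q (bP f a a) ≠ 0) (v1 v2 v3 : Fin 3 → ℝ) (h1 : v1 ≠ 0) (h2 : v2 ≠ 0) (h3 : v3 ≠ 0)
    (n1 : dt (nv f q) v1 = 0) (n2 : dt (nv f q) v2 = 0) (n3 : dt (nv f q) v3 = 0)
    (H1 : bil (Hv f q) v1 v1 = 0) (H2 : bil (Hv f q) v2 v2 = 0) (H3 : bil (Hv f q) v3 v3 = 0) :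
    cr v1 v2 = 0 ∨ cr v1 v3 = 0 ∨ cr v2 v3 = 0 := by
  have par : ∀ v v' : Fin 3 → ℝ, dt (nv f q) v = 0 → dt (nv f q) v' = 0 →
      dt v b * (-dt v' a) - dt v' b * (-dt v a) = 0 → cr v v' = 0 := by
    intro v v' m m' h
    have d := st_decomp (a := a) (b := b) m
    have d' := st_decomp (a := a) (b := b) m'
    rw [← wP_eval] at d d'
    have e : cr (eval q (wP f a b) • v) (eval q (wP f a b) • v') =
      (dt v b * (-dt v' a) - dt v' b * (-dt v a)) • cr (cr (nv f q) a) (cr (nv f q) b) := by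
      rw [d, d']
      generalize cr (nv f q) a = e1
      generalize cr (nv f q) b = e2
      apply vec3_ext <;> simp only [cr_0, cr_1, cr_2, Pi.smul_apply, Pi.add_apply, smul_eq_mul] <;> ring
    rw [h, zero_smul] at e
    have e' : cr (eval q (wP f a b) • v) (eval q (wP f a b) • v') = (eval q (wP f a b) ^ 2) • cr v v' := by
      apply vec3_ext <;> simp only [cr_0, cr_1, cr_2, Pi.smul_apply, smul_eq_mul] <;> ring
    rw [e'] at e
    exact (smul_eq_zero.mp e).resolve_left (pow_ne_zero _ ho)
  have t1 := t_ne f a b q v1 n1 H1 h1 ho ha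
  have e1 := Q2_eq f a b q v1 n1
  have e2 := Q2_eq f a b q v2 n2
  have e3 := Q2_eq f a b q v3 n3
  rw [H1, mul_zero] at e1
  rw [H2, mul_zero] at e2
  rw [H3, mul_zero] at e3
  by_contra hc
  push Not at hc
  obtain ⟨c12, c13, c23⟩ := hc
  set al := eval q (bP f a a)
  set be := eval q (bP f a b)
  set ga := eval q (bP f b b)
  have p12 := mt (par v1 v2 n1 n2) c12
  have p13 := mt (par v1 v3 n1 n3) c13
  apply c23
  apply par v2 v3 n2 n3
  set s1 := dt v1 b
  set s2 := dt v2 b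
  set s3 := dt v3 b
  set u1 := -dt v1 a
  set u2 := -dt v2 a
  set u3 := -dt v3 a
  have f12 : al * (s1 * u2 + s2 * u1) + 2 * be * u1 * u2 = 0 := by
    have : (s1 * u2 - s2 * u1) * (al * (s1 * u2 + s2 * u1) + 2 * be * u1 * u2) = 0 := by
      linear_combination -u2 ^ 2 * e1 + u1 ^ 2 * e2
    exact (mul_eq_zero.mp this).resolve_left p12
  have f13 : al * (s1 * u3 + s3 * u1) + 2 * be * u1 * u3 = 0 := by
    have : (s1 * u3 - s3 * u1) * (al * (s1 * u3 + s3 * u1) + 2 * be * u1 * u3) = 0 := by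
      linear_combination -u3 ^ 2 * e1 + u1 ^ 2 * e3
    exact (mul_eq_zero.mp this).resolve_left p13
  have : (al * u1) * (s2 * u3 - s3 * u2) = 0 := by linear_combination u3 * f12 - u2 * f13
  exact (mul_eq_zero.mp this).resolve_left (mul_ne_zero ha t1)

/-- properties of the auxiliary polynomial -/
structure Aux (f B : MvPolynomial (Fin 3) ℝ) : Prop where
  ndvd : ¬ f ∣ B
  deg : B.totalDegree ≤ 27 * f.totalDegree
  fam : ∀ q0 v0 : Fin 3 → ℝ, v0 ≠ 0 → (∀ s : ℝ, eval (q0 + s • v0) f = 0) → eval q0 B ≠ 0 →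
    ∃ q v ε, Fam f q v ε ∧ q 0 = q0 ∧ v 0 = v0
  two : ∀ q v1 v2 v3 : Fin 3 → ℝ, v1 ≠ 0 → v2 ≠ 0 → v3 ≠ 0 → (∀ s : ℝ, eval (q + s • v1) f = 0) →
    (∀ s : ℝ, eval (q + s • v2) f = 0) → (∀ s : ℝ, eval (q + s • v3) f = 0) → eval q B ≠ 0 →
    cr v1 v2 = 0 ∨ cr v1 v3 = 0 ∨ cr v2 v3 = 0

lemma two_of (f : MvPolynomial (Fin 3) ℝ) (a b q v1 v2 v3 : Fin 3 → ℝ) (h1 : v1 ≠ 0) (h2 : v2 ≠ 0)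
    (h3 : v3 ≠ 0) (l1 : ∀ s : ℝ, eval (q + s • v1) f = 0) (l2 : ∀ s : ℝ, eval (q + s • v2) f = 0)
    (l3 : ∀ s : ℝ, eval (q + s • v3) f = 0) (ho : eval q (wP f a b) ≠ 0)
    (ha : eval q (bP f a a) ≠ 0) : cr v1 v2 = 0 ∨ cr v1 v3 = 0 ∨ cr v2 v3 = 0 := by
  obtain ⟨-, n1, H1, -⟩ := line_facts f q v1 l1
  obtain ⟨-, n2, H2, -⟩ := line_facts f q v2 l2
  obtain ⟨-, n3, H3, -⟩ := line_facts f q v3 l3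
  exact two_dirs f a b q ho ha v1 v2 v3 h1 h2 h3 n1 n2 n3 H1 H2 H3

open MvPolynomial
open scoped Classical

lemma wP_basis (f : MvPolynomial (Fin 3) ℝ) (a : Fin 3 → ℝ) (i : Fin 3) :
    wP f a (Pi.single i 1) = eP f a i := by
  fin_cases i <;> simp [wP, dt, cv]

lemma GP_eval (f : MvPolynomial (Fin 3) ℝ) (a b q : Fin 3 → ℝ) : eval q (GP f a b) =
    eval q (bP f a a) * eval q (laP f a b) ^ 2 - 2 * eval q (bP f a b) * eval q (kaP f a b) * eval q (laP f a b)
    + eval q (bP f b b) * eval q (kaP f a b) ^ 2 := by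
  simp only [GP, map_add, map_sub, map_mul]; ring

lemma exists_aux (f : MvPolynomial (Fin 3) ℝ) (hf : Irreducible f) (hd : 2 ≤ f.totalDegree) :
    ∃ B, Aux f B := by
  have hp : Prime f := hf.prime
  have hev : ∀ {g : MvPolynomial (Fin 3) ℝ} {q : Fin 3 → ℝ}, f ∣ g → eval q f = 0 → eval q g = 0 := by
    rintro _ q ⟨k, rfl⟩ h; simp [h]
  by_cases hfl : ∀ a, f ∣ bP f a a
  · obtain ⟨i, hi⟩ := pderiv_ne f (by omega)
    have hno : ∀ q, eval q f = 0 → eval q (pderiv i f) ≠ 0 → False := fun q h0 h1 =>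
      flat_case f hf hd hfl q h0 (fun h => h1 (congrFun h i))
    refine ⟨pderiv i f, ?_, ?_, ?_, ?_⟩
    · intro h
      have := tdeg_dvd h hi
      have := tdeg_pderiv f i
      omega
    · have := tdeg_pderiv f i
      omega
    · intro q0 v0 _ hl hB
      exact (hno q0 (by simpa using hl 0) hB).elim
    · intro q v1 v2 v3 _ _ _ hl _ _ hB
      exact (hno q (by simpa using hl 0) hB).elim
  push Not at hfl
  obtain ⟨a, ha⟩ := hfl
  obtain ⟨b, hb⟩ : ∃ b, ¬ f ∣ wP f a b := by
    by_contra hc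
    push Not at hc
    apply ha
    unfold bP bil
    refine Finset.dvd_sum fun i _ => Finset.dvd_sum fun j _ => ?_
    have := hc (Pi.single j 1)
    rw [wP_basis] at this
    exact dvd_mul_of_dvd_right this _
  have hwa : ¬ f ∣ wP f a b * bP f a a := hp.not_dvd_mul hb ha
  have hwad : (wP f a b * bP f a a).totalDegree ≤ 4 * f.totalDegree :=
    tdeg_mul (tdeg_wP ..) (tdeg_bP ..) (by omega)
  by_cases hD : f ∣ DeP f a b
  · refine ⟨wP f a b * bP f a a, hwa, by omega, ?_, ?_⟩
    · intro q0 v0 hv0 hl hB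
      rw [map_mul] at hB
      exact fam_parab f a b hD q0 v0 hv0 hl (left_ne_zero_of_mul hB) (right_ne_zero_of_mul hB)
    · intro q v1 v2 v3 h1 h2 h3 l1 l2 l3 hB
      rw [map_mul] at hB
      exact two_of f a b q v1 v2 v3 h1 h2 h3 l1 l2 l3 (left_ne_zero_of_mul hB) (right_ne_zero_of_mul hB)
  -- relation along lines
  have hrel : ∀ q v, v ≠ 0 → (∀ s : ℝ, eval (q + s • v) f = 0) → eval q (wP f a b) ≠ 0 →
      eval q (bP f a a) ≠ 0 → -dt v a ≠ 0 ∧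
        eval q (kaP f a b) * dt v b + eval q (laP f a b) * (-dt v a) = 0 := by
    intro q v hv hl ho hal
    obtain ⟨-, n1, H1, T1⟩ := line_facts f q v hl
    have ht := t_ne f a b q v n1 H1 hv ho hal
    have := red_eq f a b q v n1 H1
    rw [T1] at this
    refine ⟨ht, ?_⟩
    have h0 : (-dt v a) ^ 2 * (eval q (kaP f a b) * dt v b + eval q (laP f a b) * (-dt v a)) = 0 := by
      rw [← this]; ring
    exact (mul_eq_zero.mp h0).resolve_left (pow_ne_zero _ ht)
  by_cases hG : f ∣ GP f a b
  swap
  · refine ⟨wP f a b * bP f a a * GP f a b, hp.not_dvd_mul hwa hG,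
      tdeg_mul hwad (tdeg_GP ..) (by omega), ?_, ?_⟩
    · intro q0 v0 hv0 hl hB
      rw [map_mul, map_mul] at hB
      exfalso
      have hB1 := left_ne_zero_of_mul hB
      have ho := left_ne_zero_of_mul hB1
      have hal := right_ne_zero_of_mul hB1
      obtain ⟨ht, hr⟩ := hrel q0 v0 hv0 hl ho hal
      obtain ⟨-, n1, H1, -⟩ := line_facts f q0 v0 hl
      have e2 := Q2_eq f a b q0 v0 n1
      rw [H1, mul_zero] at e2
      apply right_ne_zero_of_mul hB
      have : (-dt v0 a) ^ 2 * eval q0 (GP f a b) = 0 := by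
        rw [GP_eval]
        linear_combination (eval q0 (bP f a a) * (eval q0 (laP f a b) * (-dt v0 a) - eval q0 (kaP f a b) * dt v0 b)
          - 2 * eval q0 (bP f a b) * eval q0 (kaP f a b) * (-dt v0 a)) * hr
          - eval q0 (kaP f a b) ^ 2 * e2
      exact (mul_eq_zero.mp this).resolve_left (pow_ne_zero _ ht)
    · intro q v1 v2 v3 h1 h2 h3 l1 l2 l3 hB
      rw [map_mul, map_mul] at hB
      have hB1 := left_ne_zero_of_mul hB
      exact two_of f a b q v1 v2 v3 h1 h2 h3 l1 l2 l3 (left_ne_zero_of_mul hB1) (right_ne_zero_of_mul hB1)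
  by_cases hk : f ∣ kaP f a b
  · have hla : f ∣ laP f a b := by
      have h1 : f ∣ bP f a a * (laP f a b * laP f a b) := by
        have e : bP f a a * (laP f a b * laP f a b) = GP f a b
          + kaP f a b * ((bP f a b + bP f a b) * laP f a b - bP f b b * kaP f a b) := by
          simp only [GP]; ring
        rw [e]
        exact dvd_add hG (dvd_mul_of_dvd_left hk _)
      have := (hp.dvd_or_dvd h1).resolve_left ha
      exact (hp.dvd_or_dvd this).elim id id
    refine ⟨wP f a b * bP f a a * DeP f a b, hp.not_dvd_mul hwa hD,
      tdeg_mul hwad (tdeg_DeP ..) (by omega), ?_, ?_⟩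
    · intro q0 v0 hv0 hl hB
      refine fam_nondeg f a b {x | eval x (fq (wP f a b * bP f a a * DeP f a b)) ≠ 0}
        (isOpen_ne_fun (continuous_eval _) continuous_const) ?_ ?_ q0 v0 hv0 hl ?_
      · intro x hx
        rw [Set.mem_ofPred_eq, fq_eval, map_mul, map_mul] at hx
        exact ⟨left_ne_zero_of_mul (left_ne_zero_of_mul hx), right_ne_zero_of_mul hx⟩
      · intro x hx m0 m1 m2
        rw [Set.mem_ofPred_eq, fq_eval, map_mul, map_mul] at hx
        have := red_eq f a b _ _ m1 m2
        rw [hev hk m0, hev hla m0] at this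
        have h0 : eval (qq x) (bP f a a) ^ 2 * (eval (qq x) (wP f a b) ^ 3 *
          tri (Tv f (qq x)) (vv x) (vv x) (vv x)) = 0 := by rw [this]; ring
        have h1 := (mul_eq_zero.mp h0).resolve_left (pow_ne_zero _ (right_ne_zero_of_mul (left_ne_zero_of_mul hx)))
        exact (mul_eq_zero.mp h1).resolve_left (pow_ne_zero _ (left_ne_zero_of_mul (left_ne_zero_of_mul hx)))
      · rw [Set.mem_ofPred_eq, fq_eval]; exact hB
    · intro q v1 v2 v3 h1 h2 h3 l1 l2 l3 hB
      rw [map_mul, map_mul] at hB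
      have hB1 := left_ne_zero_of_mul hB
      exact two_of f a b q v1 v2 v3 h1 h2 h3 l1 l2 l3 (left_ne_zero_of_mul hB1) (right_ne_zero_of_mul hB1)
  · refine ⟨wP f a b * bP f a a * (DeP f a b * kaP f a b), hp.not_dvd_mul hwa (hp.not_dvd_mul hD hk),
      tdeg_mul hwad (tdeg_mul (tdeg_DeP ..) (tdeg_kaP ..) le_rfl) (by omega), ?_, ?_⟩
    · intro q0 v0 hv0 hl hB
      let R : (S6 → ℝ) → ℝ := fun x => eval x (fq (bP f a a)) * (dt (vv x) b * eval x (fq (kaP f a b))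
        - eval x (fq (laP f a b)) * (-dt (vv x) a)) + 2 * eval x (fq (bP f a b)) * (-dt (vv x) a) * eval x (fq (kaP f a b))
      have hRc : Continuous R := by
        have h1 : ∀ p : MvPolynomial S6 ℝ, Continuous fun x => eval x p := fun p => continuous_eval p
        have h2 : ∀ a : Fin 3 → ℝ, Continuous fun x => dt (vv x) a := fun a => by
          unfold dt vv; fun_prop
        exact ((h1 _).mul (((h2 _).mul (h1 _)).sub ((h1 _).mul (h2 _).neg))).add
          (((continuous_const.mul (h1 _)).mul (h2 _).neg).mul (h1 _))
      refine fam_nondeg f a b ({x | eval x (fq (wP f a b * bP f a a * (DeP f a b * kaP f a b))) ≠ 0} ∩ {x | R x ≠ 0})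
        ((isOpen_ne_fun (continuous_eval _) continuous_const).inter (isOpen_ne_fun hRc continuous_const)) ?_ ?_ q0 v0 hv0 hl ?_
      · rintro x ⟨hx, -⟩
        rw [Set.mem_ofPred_eq, fq_eval, map_mul, map_mul, map_mul] at hx
        exact ⟨left_ne_zero_of_mul (left_ne_zero_of_mul hx), left_ne_zero_of_mul (right_ne_zero_of_mul hx)⟩
      · rintro x ⟨hx, hR⟩ m0 m1 m2
        rw [Set.mem_ofPred_eq, fq_eval, map_mul, map_mul, map_mul] at hx
        have hg0 := hev hG m0
        rw [GP_eval] at hg0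
        have e2 := Q2_eq f a b _ _ m1
        rw [m2, mul_zero] at e2
        simp only [R, fq_eval, Set.mem_ofPred_eq] at hR
        have hlin : eval (qq x) (kaP f a b) * dt (vv x) b + eval (qq x) (laP f a b) * (-dt (vv x) a) = 0 := by
          have : (eval (qq x) (kaP f a b) * dt (vv x) b + eval (qq x) (laP f a b) * (-dt (vv x) a)) *
            (eval (qq x) (bP f a a) * (dt (vv x) b * eval (qq x) (kaP f a b)
              - eval (qq x) (laP f a b) * (-dt (vv x) a))
              + 2 * eval (qq x) (bP f a b) * (-dt (vv x) a) * eval (qq x) (kaP f a b)) = 0 := by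
            linear_combination -eval (qq x) (kaP f a b) ^ 2 * e2 - (-dt (vv x) a) ^ 2 * hg0
          exact (mul_eq_zero.mp this).resolve_right hR
        have := red_eq f a b _ _ m1 m2
        rw [hlin, mul_zero] at this
        have h1 := (mul_eq_zero.mp this).resolve_left (pow_ne_zero _ (right_ne_zero_of_mul (left_ne_zero_of_mul hx)))
        exact (mul_eq_zero.mp h1).resolve_left (pow_ne_zero _ (left_ne_zero_of_mul (left_ne_zero_of_mul hx)))
      · refine ⟨by rw [Set.mem_ofPred_eq, fq_eval]; exact hB, ?_⟩
        rw [map_mul, map_mul, map_mul] at hB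
        have ho := left_ne_zero_of_mul (left_ne_zero_of_mul hB)
        have hal := right_ne_zero_of_mul (left_ne_zero_of_mul hB)
        have hDe := left_ne_zero_of_mul (right_ne_zero_of_mul hB)
        have hka := right_ne_zero_of_mul (right_ne_zero_of_mul hB)
        obtain ⟨ht, hr⟩ := hrel q0 v0 hv0 hl ho hal
        obtain ⟨-, n1, H1, -⟩ := line_facts f q0 v0 hl
        have e2 := Q2_eq f a b q0 v0 n1
        rw [H1, mul_zero] at e2
        simp only [R, fq_eval, Set.mem_ofPred_eq, qq_elim, vv_elim]
        have hDe' : eval q0 (bP f a b) ^ 2 - eval q0 (bP f a a) * eval q0 (bP f b b) ≠ 0 := by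
          intro h; apply hDe; simp only [DeP, map_sub, map_mul]; linarith
        have e3 : (eval q0 (bP f a a) * dt v0 b + eval q0 (bP f a b) * (-dt v0 a)) ≠ 0 := by
          intro h
          have : (eval q0 (bP f a b) ^ 2 - eval q0 (bP f a a) * eval q0 (bP f b b)) * (-dt v0 a) ^ 2 = 0 := by
            linear_combination (eval q0 (bP f a a) * dt v0 b + eval q0 (bP f a b) * (-dt v0 a)) * h
              + eval q0 (bP f a a) * e2
          rcases mul_eq_zero.mp this with h | h
          · exact hDe' h
          · exact pow_ne_zero _ ht h
        have e4 : eval q0 (bP f a a) * (dt v0 b * eval q0 (kaP f a b) - eval q0 (laP f a b) * (-dt v0 a))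
            + 2 * eval q0 (bP f a b) * (-dt v0 a) * eval q0 (kaP f a b) =
            2 * eval q0 (kaP f a b) * (eval q0 (bP f a a) * dt v0 b + eval q0 (bP f a b) * (-dt v0 a)) := by
          linear_combination -eval q0 (bP f a a) * hr
        rw [e4]
        exact mul_ne_zero (mul_ne_zero two_ne_zero hka) e3
    · intro q v1 v2 v3 h1 h2 h3 l1 l2 l3 hB
      rw [map_mul, map_mul] at hB
      have hB1 := left_ne_zero_of_mul hB
      exact two_of f a b q v1 v2 v3 h1 h2 h3 l1 l2 l3 (left_ne_zero_of_mul hB1) (right_ne_zero_of_mul hB1)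

open MvPolynomial
open scoped Classical
open Topology

/-- globally parametrized family of lines -/
structure GFam (f : MvPolynomial (Fin 3) ℝ) (q v : ℝ → Fin 3 → ℝ) : Prop where
  contq : Continuous q
  contv : Continuous v
  vne : ∀ τ, v τ ≠ 0
  onf : ∀ τ, ∀ s : ℝ, eval (q τ + s • v τ) f = 0
  inj : ∃ ε > 0, Set.InjOn (fun τ => lineThrough (q τ) (v τ)) (Set.Icc 0 ε)

lemma Fam.toG {f : MvPolynomial (Fin 3) ℝ} {q v : ℝ → Fin 3 → ℝ} {ε : ℝ} (h : Fam f q v ε) :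
    ∃ q' v', GFam f q' v' ∧ q' 0 = q 0 ∧ v' 0 = v 0 := by
  let pr : ℝ → ℝ := fun τ => max 0 (min ε τ)
  have hpr : ∀ τ, pr τ ∈ Set.Icc 0 ε := fun τ =>
    ⟨le_max_left _ _, max_le h.pos.le (min_le_left _ _)⟩
  have hprc : Continuous pr := by fun_prop
  have hid : ∀ τ ∈ Set.Icc 0 ε, pr τ = τ := by
    intro τ hτ
    simp only [pr, min_eq_right hτ.2, max_eq_right hτ.1]
  have h0 : pr 0 = 0 := hid 0 ⟨le_rfl, h.pos.le⟩
  refine ⟨q ∘ pr, v ∘ pr, ⟨h.contq.comp_continuous hprc hpr, h.contv.comp_continuous hprc hpr,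
    fun τ => h.vne _ (hpr τ), fun τ => h.onf _ (hpr τ), ε, h.pos, ?_⟩, by simp [h0], by simp [h0]⟩
  intro τ hτ τ' hτ' he
  simp only [Function.comp, hid τ hτ, hid τ' hτ'] at he
  exact h.inj hτ hτ' he

lemma continuous_cr {α : Type*} [TopologicalSpace α] {a b : α → Fin 3 → ℝ} (ha : Continuous a)
    (hb : Continuous b) : Continuous fun x => cr (a x) (b x) := by
  refine continuous_pi fun i => ?_
  fin_cases i <;> simp [cr] <;> fun_prop

lemma continuous_dt {α : Type*} [TopologicalSpace α] {a b : α → Fin 3 → ℝ} (ha : Continuous a)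
    (hb : Continuous b) : Continuous fun x => dt (a x) (b x) := by
  unfold dt; fun_prop

lemma continuous_det3 {α : Type*} [TopologicalSpace α] {a b c : α → Fin 3 → ℝ} (ha : Continuous a)
    (hb : Continuous b) (hc : Continuous c) : Continuous fun x => det3 (a x) (b x) (c x) := by
  unfold det3; exact continuous_dt ha (continuous_cr hb hc)

lemma cr_self (a : Fin 3 → ℝ) : cr a a = 0 := by
  apply vec3_ext <;> simp only [cr_0, cr_1, cr_2, Pi.zero_apply] <;> ring

lemma count_signed (f B : MvPolynomial (Fin 3) ℝ) (hf : Irreducible f) (hB : Aux f B)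
    {ι : Type*} (s : Finset ι) (q v : ι → ℝ → Fin 3 → ℝ) (hfam : ∀ i ∈ s, GFam f (q i) (v i))
    (p w u : Fin 3 → ℝ)
    (h0 : ∀ i ∈ s, det3 w (v i 0) (q i 0 - p) = 0)
    (hsg : ∀ i ∈ s, ∃ᶠ τ in 𝓝[>] (0:ℝ), 0 < det3 w (v i τ) (q i τ - p) * det3 w (v i 0) u)
    (hpar : ∀ i ∈ s, cr w (v i 0) ≠ 0)
    (hdist : ∀ i ∈ s, ∀ j ∈ s, i ≠ j → lineThrough (q i 0) (v i 0) ≠ lineThrough (q j 0) (v j 0)) :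
    s.card ≤ 2 * f.totalDegree := by
  rcases s.eq_empty_or_nonempty with rfl | ⟨i0, hi0⟩
  · simp
  have hw : w ≠ 0 := by
    rintro rfl
    apply hpar i0 hi0
    apply vec3_ext <;> simp [cr]
  -- step 1
  have s1 : ∀ i ∈ s, ∀ᶠ τ in 𝓝 (0:ℝ), cr w (v i τ) ≠ 0 := by
    intro i hi
    exact (continuous_cr continuous_const (hfam i hi).contv).continuousAt.eventually_ne (hpar i hi)
  have s2 : ∀ i ∈ s, ∀ j ∈ s, i ≠ j → ∀ᶠ x : ℝ × ℝ in 𝓝 (0:ℝ) ×ˢ 𝓝 (0:ℝ),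
      (cr (v i x.1) (v j x.2) ≠ 0 ∨ cr (v i x.1) (q i x.1 - q j x.2) ≠ 0) := by
    intro i hi j hj hij
    have hqi := (hfam i hi).contq
    have hqj := (hfam j hj).contq
    have hvi := (hfam i hi).contv
    have hvj := (hfam j hj).contv
    rw [← nhds_prod_eq]
    by_cases hc : cr (v i 0) (v j 0) = 0
    · have : cr (v i 0) (q i 0 - q j 0) ≠ 0 := fun h =>
        hdist i hi j hj hij (line_eq_of ((hfam i hi).vne 0) ((hfam j hj).vne 0) hc h)
      have hcont : Continuous fun x : ℝ × ℝ => cr (v i x.1) (q i x.1 - q j x.2) :=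
        continuous_cr (hvi.comp continuous_fst) ((hqi.comp continuous_fst).sub (hqj.comp continuous_snd))
      filter_upwards [hcont.continuousAt.eventually_ne (x := ((0:ℝ),(0:ℝ))) this] with x hx
      exact Or.inr hx
    · have hcont : Continuous fun x : ℝ × ℝ => cr (v i x.1) (v j x.2) :=
        continuous_cr (hvi.comp continuous_fst) (hvj.comp continuous_snd)
      filter_upwards [hcont.continuousAt.eventually_ne (x := ((0:ℝ),(0:ℝ))) hc] with x hx
      exact Or.inl hx
  obtain ⟨δ, hδ, hd1, hd2⟩ : ∃ δ > 0, (∀ i ∈ s, ∀ τ ∈ Set.Icc 0 δ, cr w (v i τ) ≠ 0) ∧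
      (∀ i ∈ s, ∀ j ∈ s, i ≠ j → ∀ τ ∈ Set.Icc 0 δ, ∀ τ' ∈ Set.Icc 0 δ,
        (cr (v i τ) (v j τ') ≠ 0 ∨ cr (v i τ) (q i τ - q j τ') ≠ 0)) := by
    have e1 : ∀ᶠ τ in 𝓝 (0:ℝ), ∀ i ∈ s, cr w (v i τ) ≠ 0 := (Filter.eventually_all_finset s).2 s1
    have e2 : ∀ᶠ x in 𝓝 ((0:ℝ), (0:ℝ)), ∀ i ∈ s, ∀ j ∈ s, i ≠ j →
        (cr (v i x.1) (v j x.2) ≠ 0 ∨ cr (v i x.1) (q i x.1 - q j x.2) ≠ 0) := by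
      rw [nhds_prod_eq]
      refine (Filter.eventually_all_finset s).2 fun i hi => (Filter.eventually_all_finset s).2 fun j hj => ?_
      by_cases hij : i = j
      · exact Filter.Eventually.of_forall fun x h => (h hij).elim
      · filter_upwards [s2 i hi j hj hij] with x hx _ using hx
    obtain ⟨δ1, hδ1, h1⟩ := Metric.eventually_nhds_iff.mp e1
    obtain ⟨δ2, hδ2, h2⟩ := Metric.eventually_nhds_iff.mp e2
    refine ⟨min δ1 δ2 / 2, by positivity, ?_, ?_⟩
    · intro i hi τ hτ
      refine h1 ?_ i hi
      rw [dist_zero_right, Real.norm_eq_abs, abs_of_nonneg hτ.1]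
      have := min_le_left δ1 δ2
      linarith [hτ.2]
    · intro i hi j hj hij τ hτ τ' hτ'
      refine h2 (y := (τ, τ')) ?_ i hi j hj hij
      have := min_le_right δ1 δ2
      rw [Prod.dist_eq, max_lt_iff]
      simp only [dist_zero_right, Real.norm_eq_abs, abs_of_nonneg hτ.1, abs_of_nonneg hτ'.1]
      constructor
      · linarith [hτ.2]
      · linarith [hτ'.2]
  -- step 2
  have s3 : ∀ i ∈ s, ∃ τ, τ ∈ Set.Ioc 0 δ ∧ 0 < det3 w (v i τ) (q i τ - p) * det3 w (v i 0) u := by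
    intro i hi
    obtain ⟨τ, h1, h2⟩ := ((hsg i hi).and_eventually (Ioc_mem_nhdsGT hδ)).exists
    exact ⟨τ, h2, h1⟩
  choose! T hT1 hT2 using s3
  have hk : ∀ i ∈ s, det3 w (v i 0) u ≠ 0 := fun i hi => right_ne_zero_of_mul (hT2 i hi).ne'
  -- step 3
  have s4 : ∀ᶠ r in 𝓝 (0:ℝ), ∀ i ∈ s, 0 < det3 w (v i (T i)) (q i (T i) - (p + r • u)) * det3 w (v i 0) u := by
    refine (Filter.eventually_all_finset s).2 fun i hi => ?_
    have hc : Continuous fun r : ℝ => det3 w (v i (T i)) (q i (T i) - (p + r • u)) * det3 w (v i 0) u :=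
      (continuous_det3 continuous_const continuous_const (by fun_prop)).mul continuous_const
    refine hc.continuousAt.eventually (lt_mem_nhds ?_)
    simpa using hT2 i hi
  obtain ⟨r, hr1, hr2⟩ := ((s4.filter_mono (nhdsWithin_le_nhds (s := Set.Ioi 0))).and
    (self_mem_nhdsWithin (a := (0:ℝ)) (s := Set.Ioi 0))).exists
  have hr0 : (0:ℝ) < r := hr2
  -- step 4
  let O : Set (Fin 3 → ℝ) := {p' | ∀ i ∈ s, 0 < det3 w (v i (T i)) (q i (T i) - p') * det3 w (v i 0) u ∧
    det3 w (v i 0) (q i 0 - p') * det3 w (v i 0) u < 0}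
  have hO : ∀ᶠ p' in 𝓝 (p + r • u), p' ∈ O := by
    refine (Filter.eventually_all_finset s).2 fun i hi => ?_
    have hc : ∀ τ, Continuous fun p' : Fin 3 → ℝ => det3 w (v i τ) (q i τ - p') * det3 w (v i 0) u :=
      fun τ => (continuous_det3 continuous_const continuous_const (by fun_prop)).mul continuous_const
    refine Filter.Eventually.and ((hc (T i)).continuousAt.eventually (lt_mem_nhds (hr1 i hi))) ?_
    refine (hc 0).continuousAt.eventually (gt_mem_nhds ?_)
    have e : det3 w (v i 0) (q i 0 - (p + r • u)) = det3 w (v i 0) (q i 0 - p) - r * det3 w (v i 0) u := by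
      simp only [det3, dt, cr_0, cr_1, cr_2, Pi.add_apply, Pi.sub_apply, Pi.smul_apply, smul_eq_mul]; ring
    beta_reduce
    rw [e, h0 i hi]
    have := mul_pos hr0 (mul_self_pos.mpr (hk i hi))
    linarith
  obtain ⟨O', hO'sub, hO'open, hO'mem⟩ := mem_nhds_iff.mp hO
  obtain ⟨H, hH0, -, hHinv, hHz⟩ := elim_dir f B _ hf le_rfl hB.ndvd w hw
  obtain ⟨p', hp'O, hp'⟩ := exists_eval_ne_zero_open (H * f) (mul_ne_zero hH0 hf.ne_zero) O' hO'open ⟨_, hO'mem⟩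
  rw [map_mul] at hp'
  have hHp := left_ne_zero_of_mul hp'
  have hfp := right_ne_zero_of_mul hp'
  have hpO := hO'sub hp'O
  -- step 5
  have s5 : ∀ i ∈ s, ∃ τ t b : ℝ, τ ∈ Set.Icc 0 δ ∧ p' + t • w = q i τ + b • v i τ := by
    intro i hi
    have hc : Continuous fun τ => det3 w (v i τ) (q i τ - p') * det3 w (v i 0) u :=
      (continuous_det3 continuous_const (hfam i hi).contv ((hfam i hi).contq.sub continuous_const)).mul
        continuous_const
    obtain ⟨τ, hτ, he⟩ := intermediate_value_Icc (hT1 i hi).1.le hc.continuousOn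
      ⟨(hpO i hi).2.le, (hpO i hi).1.le⟩
    have hz : det3 w (v i τ) (q i τ - p') = 0 := (mul_eq_zero.mp he).resolve_right (hk i hi)
    have hτ' : τ ∈ Set.Icc 0 δ := ⟨hτ.1, hτ.2.trans (hT1 i hi).2⟩
    have hz' : det3 (q i τ - p') w (v i τ) = 0 := by
      rw [← hz]; simp only [det3, dt, cr_0, cr_1, cr_2]; ring
    obtain ⟨a, b, hab⟩ := span_of_det3 hz' (hd1 i hi τ hτ')
    refine ⟨τ, a, -b, hτ', ?_⟩
    rw [sub_eq_iff_eq_add] at hab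
    rw [hab, neg_smul]; abel
  choose! θ t b hθ hx using s5
  -- step 6
  have hl0 : lineP p' w f ≠ 0 := by
    intro h
    have := lineP_eval p' w f 0
    rw [h] at this
    simp at this
    exact hfp this.symm
  have hmaps : ∀ i ∈ s, t i ∈ (lineP p' w f).roots.toFinset := by
    intro i hi
    rw [Multiset.mem_toFinset, Polynomial.mem_roots hl0, Polynomial.IsRoot, lineP_eval, hx i hi]
    exact (hfam i hi).onf _ _
  have hfib : ∀ y ∈ (lineP p' w f).roots.toFinset, (s.filter fun i => t i = y).card ≤ 2 := by
    intro y _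
    by_contra hc
    push Not at hc
    obtain ⟨i, j, k, hi, hj, hk', hij, hik, hjk⟩ := Finset.two_lt_card_iff.mp hc
    rw [Finset.mem_filter] at hi hj hk'
    set x := p' + y • w with hxd
    have hBx : eval x B ≠ 0 := by
      intro h
      apply hHp
      rw [← hHinv p' y]
      refine hHz _ ?_ h
      rw [← hi.2, hx i hi.1]
      exact (hfam i hi.1).onf _ _
    have hon : ∀ m ∈ s, t m = y → x = q m (θ m) + b m • v m (θ m) ∧ ∀ a : ℝ, eval (x + a • v m (θ m)) f = 0 := by
      intro m hm hty
      have h1 : x = q m (θ m) + b m • v m (θ m) := by rw [hxd, ← hty, hx m hm]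
      refine ⟨h1, fun a => ?_⟩
      rw [h1, add_assoc, ← add_smul]
      exact (hfam m hm).onf _ _
    have hno : ∀ m ∈ s, ∀ m' ∈ s, m ≠ m' → t m = y → t m' = y → cr (v m (θ m)) (v m' (θ m')) ≠ 0 := by
      intro m hm m' hm' hne hty hty' hcr
      rcases hd2 m hm m' hm' hne (θ m) (hθ m hm) (θ m') (hθ m' hm') with h | h
      · exact h hcr
      · apply h
        have e : q m (θ m) - q m' (θ m') = b m' • v m' (θ m') - b m • v m (θ m) := by
          have h1 := (hon m hm hty).1
          have h2 := (hon m' hm' hty').1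
          rw [h1] at h2
          rw [sub_eq_sub_iff_add_eq_add, h2]; abel
        rw [e]
        have e2 : cr (v m (θ m)) (b m' • v m' (θ m') - b m • v m (θ m)) = b m' • cr (v m (θ m)) (v m' (θ m')) := by
          apply vec3_ext <;> simp only [cr_0, cr_1, cr_2, Pi.smul_apply, Pi.sub_apply, smul_eq_mul] <;> ring
        rw [e2, hcr, smul_zero]
    rcases hB.two x _ _ _ ((hfam i hi.1).vne (θ i)) ((hfam j hj.1).vne (θ j)) ((hfam k hk'.1).vne (θ k))
      (hon i hi.1 hi.2).2 (hon j hj.1 hj.2).2 (hon k hk'.1 hk'.2).2 hBx with h | h | h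
    · exact hno i hi.1 j hj.1 hij hi.2 hj.2 h
    · exact hno i hi.1 k hk'.1 hik hi.2 hk'.2 h
    · exact hno j hj.1 k hk'.1 hjk hj.2 hk'.2 h
  have := Finset.card_le_mul_card_image_of_maps_to hmaps 2 hfib
  have h3 : (lineP p' w f).roots.toFinset.card ≤ f.totalDegree :=
    (Multiset.toFinset_card_le _).trans ((Polynomial.card_roots' _).trans (lineP_natDegree _ _ _))
  calc s.card ≤ 2 * (lineP p' w f).roots.toFinset.card := this
    _ ≤ 2 * f.totalDegree := Nat.mul_le_mul_left _ h3

open MvPolynomial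
open scoped Classical
open Topology

lemma det3_neg_right (a b c : Fin 3 → ℝ) : det3 a b (-c) = - det3 a b c := by
  simp only [det3, dt, cr_0, cr_1, cr_2, Pi.neg_apply]; ring

lemma count_all (f B : MvPolynomial (Fin 3) ℝ) (hf : Irreducible f) (hB : Aux f B)
    {ι : Type*} (s : Finset ι) (q v : ι → ℝ → Fin 3 → ℝ) (hfam : ∀ i ∈ s, GFam f (q i) (v i))
    (p w : Fin 3 → ℝ)
    (h0 : ∀ i ∈ s, det3 w (v i 0) (q i 0 - p) = 0)
    (hnE : ∀ i ∈ s, ¬ ∀ᶠ τ in 𝓝[>] (0:ℝ), det3 w (v i τ) (q i τ - p) = 0)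
    (hpar : ∀ i ∈ s, cr w (v i 0) ≠ 0)
    (hdist : ∀ i ∈ s, ∀ j ∈ s, i ≠ j → lineThrough (q i 0) (v i 0) ≠ lineThrough (q j 0) (v j 0)) :
    s.card ≤ 4 * f.totalDegree := by
  obtain ⟨u, -, hu⟩ := exists_dt_ne_open (s.image fun i => cr w (v i 0))
    (by
      intro x hx
      obtain ⟨i, hi, rfl⟩ := Finset.mem_image.mp hx
      exact hpar i hi) Set.univ isOpen_univ Set.univ_nonempty
  have hk : ∀ i ∈ s, det3 w (v i 0) u ≠ 0 := by
    intro i hi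
    have := hu _ (Finset.mem_image_of_mem _ hi)
    intro h; apply this; refine Eq.trans ?_ h
    simp only [det3, dt, cr_0, cr_1, cr_2]; ring
  let s1 := s.filter fun i => ∃ᶠ τ in 𝓝[>] (0:ℝ), 0 < det3 w (v i τ) (q i τ - p) * det3 w (v i 0) u
  let s2 := s.filter fun i => ∃ᶠ τ in 𝓝[>] (0:ℝ), 0 < det3 w (v i τ) (q i τ - p) * det3 w (v i 0) (-u)
  have hs : s ⊆ s1 ∪ s2 := by
    intro i hi
    have h1 : ∃ᶠ τ in 𝓝[>] (0:ℝ), (0 < det3 w (v i τ) (q i τ - p) * det3 w (v i 0) u ∨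
        0 < det3 w (v i τ) (q i τ - p) * det3 w (v i 0) (-u)) := by
      have := hnE i hi
      rw [Filter.not_eventually] at this
      refine this.mono fun τ hτ => ?_
      rw [det3_neg_right]
      rcases lt_or_gt_of_ne (mul_ne_zero hτ (hk i hi)) with h | h
      · right; linarith
      · left; exact h
    rw [Filter.frequently_or_distrib] at h1
    rcases h1 with h | h
    · exact Finset.mem_union_left _ (Finset.mem_filter.mpr ⟨hi, h⟩)
    · exact Finset.mem_union_right _ (Finset.mem_filter.mpr ⟨hi, h⟩)
  have c1 : s1.card ≤ 2 * f.totalDegree := by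
    have hm : ∀ i ∈ s1, i ∈ s := fun i hi => (Finset.mem_filter.mp hi).1
    exact count_signed f B hf hB s1 q v (fun i hi => hfam i (hm i hi)) p w u (fun i hi => h0 i (hm i hi))
      (fun i hi => (Finset.mem_filter.mp hi).2) (fun i hi => hpar i (hm i hi))
      (fun i hi j hj => hdist i (hm i hi) j (hm j hj))
  have c2 : s2.card ≤ 2 * f.totalDegree := by
    have hm : ∀ i ∈ s2, i ∈ s := fun i hi => (Finset.mem_filter.mp hi).1
    exact count_signed f B hf hB s2 q v (fun i hi => hfam i (hm i hi)) p w (-u) (fun i hi => h0 i (hm i hi))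
      (fun i hi => (Finset.mem_filter.mp hi).2) (fun i hi => hpar i (hm i hi))
      (fun i hi j hj => hdist i (hm i hi) j (hm j hj))
  have := Finset.card_le_card hs
  have := Finset.card_union_le s1 s2
  omega

open MvPolynomial
open scoped Classical
open Topology

lemma line_rep {ℓ : Set (Fin 3 → ℝ)} (h : IsLine ℓ) {p : Fin 3 → ℝ} (hp : p ∈ ℓ) :
    ∃ v, v ≠ 0 ∧ ℓ = lineThrough p v := by
  obtain ⟨p0, v, hv, rfl⟩ := h
  refine ⟨v, hv, ?_⟩
  apply line_eq_of hv hv (cr_self v)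
  have := mem_line_cr hp
  have e : cr v (p0 - p) = - cr v (p - p0) := by
    apply vec3_ext <;> simp only [cr_0, cr_1, cr_2, Pi.neg_apply, Pi.sub_apply] <;> ring
  rw [e, this, neg_zero]

lemma self_mem_line (p v : Fin 3 → ℝ) : p ∈ lineThrough p v := ⟨0, by simp⟩

lemma line_two {ℓ : Set (Fin 3 → ℝ)} (h : IsLine ℓ) {p r : Fin 3 → ℝ} (hp : p ∈ ℓ) (hr : r ∈ ℓ) (hne : p ≠ r) :
    ℓ = lineThrough p (r - p) := by
  obtain ⟨v, hv, rfl⟩ := line_rep h hp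
  apply line_eq_of hv (sub_ne_zero.mpr hne.symm) (mem_line_cr hr)
  rw [sub_self]
  apply vec3_ext <;> simp [cr]

lemma cone_line (f : MvPolynomial (Fin 3) ℝ) (hf : Irreducible f) (p : Fin 3 → ℝ)
    (hp : IsExceptionalPoint (Zs f) p) (x : Fin 3 → ℝ) (hx : eval x f = 0) (t : ℝ) :
    eval (p + t • (x - p)) f = 0 := by
  let h : MvPolynomial (Fin 3) ℝ := aeval (fun i => C (p i) + C t * (X i - C (p i))) f
  have he : ∀ y, eval y h = eval (p + t • (y - p)) f := by
    intro y
    simp only [h]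
    rw [eval_aeval_mv]
    congr 2
    funext i
    simp
  have hdvd : f ∣ h := by
    by_contra hnd
    obtain ⟨S, hS, hcard⟩ := Set.Infinite.exists_subset_card_eq hp (2 * f.totalDegree * h.totalDegree + 1)
    have := bezout_lines f h hf hnd S (fun ℓ hℓ => (hS hℓ).1) (by
      intro ℓ hℓ y hy
      have h1 := (hS hℓ).1
      obtain ⟨v, hv, e⟩ := line_rep h1.1 (hS hℓ).2
      change eval y h = 0
      rw [he]
      apply h1.2
      rw [e] at hy ⊢
      obtain ⟨a, rfl⟩ := hy
      exact ⟨t * a, by rw [add_sub_cancel_left, smul_smul]⟩)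
    omega
  obtain ⟨k, hk⟩ := hdvd
  rw [← he, hk, map_mul, hx, zero_mul]

lemma two_cone (f : MvPolynomial (Fin 3) ℝ) (hf : Irreducible f) (hd : 2 ≤ f.totalDegree) (p r : Fin 3 → ℝ)
    (hp : IsExceptionalPoint (Zs f) p) (hr : IsExceptionalPoint (Zs f) r) : p = r := by
  by_contra hne
  obtain ⟨ℓ, ⟨⟨hℓ, hpℓ⟩, hno⟩⟩ : ({ℓ | IsLineIn (Zs f) ℓ ∧ p ∈ ℓ} \ {lineThrough p (r - p)}).Nonempty :=
    (Set.Infinite.sdiff hp (Set.finite_singleton _)).nonempty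
  have hrn : r ∉ ℓ := fun h => hno (line_two hℓ.1 hpℓ h hne)
  obtain ⟨w, hw, e⟩ := line_rep hℓ.1 hpℓ
  have hcr : cr (p - r) w ≠ 0 := by
    intro h
    obtain ⟨c, hc⟩ := cr_eq_zero h hw
    apply hrn
    rw [e]
    exact ⟨-c, by rw [neg_smul, ← hc]; abel⟩
  have hinf := Set.infinite_range_of_injective (pencil_inj r (p - r) w hcr)
  refine hinf ((plane_fin f hf hd (cr (p - r) w) hcr (dt (cr (p - r) w) r)).subset ?_)
  rintro _ ⟨t, rfl⟩
  have hv : p - r + t • w ≠ 0 := by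
    intro h
    apply hrn
    rw [e]
    refine ⟨t, ?_⟩
    have : p + t • w - r = 0 := by rw [← h]; abel
    exact (sub_eq_zero.mp this).symm
  refine ⟨line_in_of hv fun s => ?_, ?_⟩
  · have h1 : eval (p + t • w) f = 0 := hℓ.2 (by rw [e]; exact ⟨t, rfl⟩)
    have := cone_line f hf r hr _ h1 s
    rw [← this]
    congr 2
    module
  · rintro _ ⟨s, rfl⟩
    simp only [dt, cr_0, cr_1, cr_2, Pi.add_apply, Pi.sub_apply, Pi.smul_apply, smul_eq_mul]; ring

lemma E_cone (f : MvPolynomial (Fin 3) ℝ) (hf : Irreducible f) (hd : 2 ≤ f.totalDegree) (p w1 w2 : Fin 3 → ℝ)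
    (q v : ℝ → Fin 3 → ℝ) (hG : GFam f q v) (hw : cr w1 w2 ≠ 0)
    (h1 : ∀ᶠ τ in 𝓝[>] (0:ℝ), det3 w1 (v τ) (q τ - p) = 0)
    (h2 : ∀ᶠ τ in 𝓝[>] (0:ℝ), det3 w2 (v τ) (q τ - p) = 0) : IsExceptionalPoint (Zs f) p := by
  obtain ⟨ε, hε, hinj⟩ := hG.inj
  obtain ⟨δ, hδ, hsub⟩ := mem_nhdsGT_iff_exists_Ioc_subset.mp ((h1.and h2).and (Ioc_mem_nhdsGT hε))
  let c := cr w1 w2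
  have hinf : ((fun τ => lineThrough (q τ) (v τ)) '' Set.Ioc 0 δ).Infinite := by
    refine (Set.infinite_image_iff ?_).mpr (Set.Ioc_infinite hδ)
    refine hinj.mono fun τ hτ => ?_
    have := (hsub hτ).2
    exact ⟨this.1.le, this.2⟩
  have hsub2 : ((fun τ => lineThrough (q τ) (v τ)) '' Set.Ioc 0 δ) ⊆
      {ℓ | IsLineIn (Zs f) ℓ ∧ ∀ x ∈ ℓ, dt c x = dt c p} ∪ {ℓ | IsLineIn (Zs f) ℓ ∧ p ∈ ℓ} := by
    rintro _ ⟨τ, hτ, rfl⟩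
    obtain ⟨⟨e1, e2⟩, -⟩ := hsub hτ
    have hin := line_in_of (hG.vne τ) (hG.onf τ)
    have hN : cr (cr (v τ) (q τ - p)) c = 0 := by
      have : cr (cr (v τ) (q τ - p)) c = det3 w2 (v τ) (q τ - p) • w1 - det3 w1 (v τ) (q τ - p) • w2 := by
        apply vec3_ext <;> simp only [c, det3, dt, cr_0, cr_1, cr_2, Pi.smul_apply, Pi.sub_apply, smul_eq_mul] <;> ring
      rw [this, e1, e2]; simp
    obtain ⟨μ, hμ⟩ := cr_eq_zero hN hw
    by_cases h0 : μ = 0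
    · right
      refine ⟨hin, ?_⟩
      rw [h0, zero_smul] at hμ
      have : cr (q τ - p) (v τ) = 0 := by
        have e : cr (q τ - p) (v τ) = - cr (v τ) (q τ - p) := by
          apply vec3_ext <;> simp only [cr_0, cr_1, cr_2, Pi.neg_apply, Pi.sub_apply] <;> ring
        rw [e, hμ, neg_zero]
      obtain ⟨b, hb⟩ := cr_eq_zero this (hG.vne τ)
      exact ⟨-b, by rw [neg_smul, ← hb]; abel⟩
    · left
      refine ⟨hin, ?_⟩
      rintro _ ⟨s, rfl⟩
      have a1 : dt (cr (v τ) (q τ - p)) (q τ + s • v τ - p) = 0 := by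
        simp only [dt, cr_0, cr_1, cr_2, Pi.add_apply, Pi.sub_apply, Pi.smul_apply, smul_eq_mul]; ring
      rw [hμ] at a1
      have a2 : μ * (dt c (q τ + s • v τ) - dt c p) = 0 := by
        rw [← a1]
        simp only [dt, Pi.add_apply, Pi.sub_apply, Pi.smul_apply, smul_eq_mul]; ring
      exact sub_eq_zero.mp ((mul_eq_zero.mp a2).resolve_left h0)
  have := hinf.mono hsub2
  rw [Set.infinite_union] at this
  exact this.resolve_left (fun h => h (plane_fin f hf hd c hw _))

open MvPolynomial
open scoped Classical
open Topology

/-- the family `(q, v)` stays (to first order on one side) coplanar with the line `ℓ` -/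
def ERel (ℓ : Set (Fin 3 → ℝ)) (q v : ℝ → Fin 3 → ℝ) : Prop :=
  ∀ᶠ τ in 𝓝[>] (0:ℝ), ∀ x ∈ ℓ, ∀ y ∈ ℓ, det3 (y - x) (v τ) (q τ - x) = 0

lemma ERel_iff (p w : Fin 3 → ℝ) (q v : ℝ → Fin 3 → ℝ) :
    ERel (lineThrough p w) q v ↔ ∀ᶠ τ in 𝓝[>] (0:ℝ), det3 w (v τ) (q τ - p) = 0 := by
  constructor
  · intro h
    refine h.mono fun τ hτ => ?_
    have := hτ p (self_mem_line p w) (p + (1:ℝ) • w) ⟨1, rfl⟩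
    simpa using this
  · intro h
    refine h.mono fun τ hτ => ?_
    rintro _ ⟨a, rfl⟩ _ ⟨b, rfl⟩
    have : det3 (p + b • w - (p + a • w)) (v τ) (q τ - (p + a • w)) = (b - a) * det3 w (v τ) (q τ - p) := by
      simp only [det3, dt, cr_0, cr_1, cr_2, Pi.add_apply, Pi.sub_apply, Pi.smul_apply, smul_eq_mul]; ring
    rw [this, hτ, mul_zero]

lemma exists_gfam (f B : MvPolynomial (Fin 3) ℝ) (hB : Aux f B) (ℓ : Set (Fin 3 → ℝ)) (hℓ : IsLineIn (Zs f) ℓ)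
    (hn : ¬ ℓ ⊆ Zs B) : ∃ q v, GFam f q v ∧ ℓ = lineThrough (q 0) (v 0) := by
  obtain ⟨x, hx, hxB⟩ := Set.not_subset.mp hn
  obtain ⟨w, hw, e⟩ := line_rep hℓ.1 hx
  obtain ⟨q, v, ε, hF, h1, h2⟩ := hB.fam x w hw (fun s => hℓ.2 (by rw [e]; exact ⟨s, rfl⟩)) hxB
  obtain ⟨q', v', hG, h3, h4⟩ := hF.toG
  exact ⟨q', v', hG, by rw [h3, h4, h1, h2, e]⟩

/-- at a nonconical point a family is coplanar with at most one line -/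
lemma ERel_unique (f : MvPolynomial (Fin 3) ℝ) (hf : Irreducible f) (hd : 2 ≤ f.totalDegree) (p : Fin 3 → ℝ)
    (hp : ¬ IsExceptionalPoint (Zs f) p) (q v : ℝ → Fin 3 → ℝ) (hG : GFam f q v)
    (ℓ1 ℓ2 : Set (Fin 3 → ℝ)) (h1 : IsLine ℓ1) (h2 : IsLine ℓ2) (hp1 : p ∈ ℓ1) (hp2 : p ∈ ℓ2)
    (e1 : ERel ℓ1 q v) (e2 : ERel ℓ2 q v) : ℓ1 = ℓ2 := by
  obtain ⟨w1, hw1, rfl⟩ := line_rep h1 hp1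
  obtain ⟨w2, hw2, rfl⟩ := line_rep h2 hp2
  by_contra hne
  refine hp (E_cone f hf hd p w1 w2 q v hG ?_ ((ERel_iff _ _ _ _).mp e1) ((ERel_iff _ _ _ _).mp e2))
  intro h
  refine hne (line_eq_of hw1 hw2 h ?_)
  rw [sub_self]
  apply vec3_ext <;> simp [cr]

lemma count_line (f B : MvPolynomial (Fin 3) ℝ) (hf : Irreducible f) (hB : Aux f B)
    (s : Finset (Set (Fin 3 → ℝ))) (q v : Set (Fin 3 → ℝ) → ℝ → Fin 3 → ℝ)
    (hfam : ∀ i ∈ s, GFam f (q i) (v i) ∧ i = lineThrough (q i 0) (v i 0))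
    (ℓ : Set (Fin 3 → ℝ)) (hℓ : IsLine ℓ)
    (hm : ∀ i ∈ s, i ≠ ℓ ∧ (∃ p, p ∈ ℓ ∧ p ∈ i) ∧ ¬ ERel ℓ (q i) (v i)) :
    s.card ≤ 4 * f.totalDegree := by
  obtain ⟨p, w, hw, rfl⟩ := hℓ
  refine count_all f B hf hB s q v (fun i hi => (hfam i hi).1) p w ?_ ?_ ?_ ?_
  · intro i hi
    obtain ⟨-, ⟨x, ⟨a, hx1⟩, hx2⟩, -⟩ := hm i hi
    rw [(hfam i hi).2] at hx2
    obtain ⟨b, hb⟩ := hx2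
    have : q i 0 - p = a • w - b • v i 0 := by
      have h := hx1.symm.trans hb
      rw [sub_eq_sub_iff_add_eq_add, ← h]; abel
    rw [this]
    generalize v i 0 = z
    simp only [det3, dt, cr_0, cr_1, cr_2, Pi.sub_apply, Pi.smul_apply, smul_eq_mul]; ring
  · intro i hi h
    exact (hm i hi).2.2 ((ERel_iff _ _ _ _).mpr h)
  · intro i hi h
    obtain ⟨hne, ⟨x, hx1, hx2⟩, -⟩ := hm i hi
    apply hne
    obtain ⟨hG, e⟩ := hfam i hi
    rw [e] at hx2 ⊢
    obtain ⟨a, ha⟩ := hx1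
    obtain ⟨b, hb⟩ := hx2
    symm
    refine line_eq_of hw (hG.vne 0) h ?_
    have : p - q i 0 = b • v i 0 - a • w := by
      have h := ha.symm.trans hb
      rw [sub_eq_sub_iff_add_eq_add, h]; abel
    rw [this]
    have e2 : cr w (b • v i 0 - a • w) = b • cr w (v i 0) := by
      generalize v i 0 = z
      apply vec3_ext <;> simp only [cr_0, cr_1, cr_2, Pi.smul_apply, Pi.sub_apply, smul_eq_mul] <;> ring
    rw [e2, h, smul_zero]
  · intro i hi j hj hij h
    rw [← (hfam i hi).2, ← (hfam j hj).2] at h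
    exact hij h

lemma core (S : Finset (MvPolynomial (Fin 3) ℝ)) (Bf : MvPolynomial (Fin 3) ℝ → MvPolynomial (Fin 3) ℝ)
    (hirr : ∀ s ∈ S, Irreducible s) (hdeg : ∀ s ∈ S, 2 ≤ s.totalDegree) (hAux : ∀ s ∈ S, Aux s (Bf s))
    (D : ℕ) (hD : ∑ s ∈ S, s.totalDegree ≤ D)
    (L : Finset (Set (Fin 3 → ℝ))) (comp : Set (Fin 3 → ℝ) → MvPolynomial (Fin 3) ℝ)
    (hcomp : ∀ ℓ ∈ L, comp ℓ ∈ S) (hin : ∀ ℓ ∈ L, IsLineIn (Zs (comp ℓ)) ℓ)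
    (hnB : ∀ ℓ ∈ L, ¬ ℓ ⊆ Zs (Bf (comp ℓ))) (P : Finset (Fin 3 → ℝ)) :
    ∃ X : ℕ, ((P ×ˢ L).filter fun z => z.1 ∈ z.2).card ≤ L.card + X ∧ X ^ 2 ≤ P.card * (4 * D * L.card + 2 * X) := by
  have hex : ∀ ℓ : Set (Fin 3 → ℝ), ∃ qv : (ℝ → Fin 3 → ℝ) × (ℝ → Fin 3 → ℝ), ℓ ∈ L →
      GFam (comp ℓ) qv.1 qv.2 ∧ ℓ = lineThrough (qv.1 0) (qv.2 0) := by
    intro ℓ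
    by_cases h : ℓ ∈ L
    · obtain ⟨q, v, h1⟩ := exists_gfam (comp ℓ) (Bf (comp ℓ)) (hAux _ (hcomp ℓ h)) ℓ (hin ℓ h) (hnB ℓ h)
      exact ⟨(q, v), fun _ => h1⟩
    · exact ⟨(0, 0), fun h' => (h h').elim⟩
  choose qv hqv using hex
  let R : Set (Fin 3 → ℝ) → Set (Fin 3 → ℝ) → Prop := fun ℓ ℓ' => ℓ' ≠ ℓ ∧ ¬ ERel ℓ (qv ℓ').1 (qv ℓ').2
  let A : (Fin 3 → ℝ) → Finset (Set (Fin 3 → ℝ)) := fun p =>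
    L.filter fun ℓ => p ∈ ℓ ∧ ¬ IsExceptionalPoint (Zs (comp ℓ)) p
  have hA : ∀ {p ℓ}, ℓ ∈ A p → ℓ ∈ L ∧ p ∈ ℓ ∧ ¬ IsExceptionalPoint (Zs (comp ℓ)) p :=
    fun h => Finset.mem_filter.mp h
  -- (a)
  have ha : ∀ p, ∀ ℓ' ∈ A p, (A p).card ≤ 2 + ((A p).filter fun ℓ => R ℓ ℓ').card := by
    intro p ℓ' hℓ'
    obtain ⟨hL', hp', hnc⟩ := hA hℓ'
    have h1 : ((A p).filter fun ℓ => ERel ℓ (qv ℓ').1 (qv ℓ').2).card ≤ 1 := by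
      rw [Finset.card_le_one]
      intro a ha b hb
      rw [Finset.mem_filter] at ha hb
      obtain ⟨a1, a2, -⟩ := hA ha.1
      obtain ⟨b1, b2, -⟩ := hA hb.1
      exact ERel_unique _ (hirr _ (hcomp _ hL')) (hdeg _ (hcomp _ hL')) p hnc _ _ (hqv ℓ' hL').1 a b
        (hin a a1).1 (hin b b1).1 a2 b2 ha.2 hb.2
    have h2 : A p ⊆ ({ℓ'} ∪ (A p).filter fun ℓ => ERel ℓ (qv ℓ').1 (qv ℓ').2) ∪ (A p).filter fun ℓ => R ℓ ℓ' := by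
      intro ℓ hℓ
      by_cases e : ℓ' = ℓ
      · subst e; simp
      by_cases h : ERel ℓ (qv ℓ').1 (qv ℓ').2
      · simp [hℓ, h]
      · simp only [Finset.mem_union, Finset.mem_filter]
        right; exact ⟨hℓ, e, h⟩
    have h3 := Finset.card_le_card h2
    have h4 := Finset.card_union_le ({ℓ'} ∪ (A p).filter fun ℓ => ERel ℓ (qv ℓ').1 (qv ℓ').2) ((A p).filter fun ℓ => R ℓ ℓ')
    have h5 := Finset.card_union_le {ℓ'} ((A p).filter fun ℓ => ERel ℓ (qv ℓ').1 (qv ℓ').2)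
    rw [Finset.card_singleton] at h5
    omega
  -- (b)
  have hb : ∀ ℓ ∈ L, (L.filter fun ℓ' => (∃ p, p ∈ ℓ ∧ p ∈ ℓ') ∧ R ℓ ℓ').card ≤ 4 * D := by
    intro ℓ hℓ
    rw [Finset.card_eq_sum_card_fiberwise (f := comp) (t := S)
      (fun ℓ' h => hcomp ℓ' (Finset.mem_filter.mp h).1)]
    calc _ ≤ ∑ s ∈ S, 4 * s.totalDegree := by
            refine Finset.sum_le_sum fun s hs => ?_
            refine count_line s (Bf s) (hirr s hs) (hAux s hs) _ (fun ℓ => (qv ℓ).1) (fun ℓ => (qv ℓ).2) ?_ ℓ (hin ℓ hℓ).1 ?_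
            · intro i hi
              simp only [Finset.mem_filter] at hi
              have := hqv i hi.1.1
              rw [hi.2] at this
              exact this
            · intro i hi
              simp only [Finset.mem_filter] at hi
              exact ⟨hi.1.2.2.1, hi.1.2.1, hi.1.2.2.2⟩
      _ = 4 * ∑ s ∈ S, s.totalDegree := by rw [Finset.mul_sum]
      _ ≤ 4 * D := Nat.mul_le_mul_left _ hD
  -- (b')
  have hb' : ∀ ℓ ∈ L, ∑ p ∈ P.filter (fun p => p ∈ ℓ), (L.filter fun ℓ' => p ∈ ℓ' ∧ R ℓ ℓ').card ≤ 4 * D := by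
    intro ℓ hℓ
    refine le_trans ?_ (hb ℓ hℓ)
    rw [← Finset.card_biUnion]
    · refine Finset.card_le_card fun ℓ' h => ?_
      simp only [Finset.mem_biUnion, Finset.mem_filter] at h ⊢
      obtain ⟨p, ⟨-, hp⟩, h1, h2, h3⟩ := h
      exact ⟨h1, ⟨p, hp, h2⟩, h3⟩
    · intro p hp p' hp' hne
      rw [Function.onFun, Finset.disjoint_left]
      intro ℓ' h h'
      simp only [Finset.mem_coe, Finset.mem_filter] at h h' hp hp'
      apply h.2.2.1
      rw [line_two (hin ℓ hℓ).1 hp.2 hp'.2 hne, line_two (hin ℓ' h.1).1 h.2.1 h'.2.1 hne]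
  let X := ∑ p ∈ P, (A p).card
  have hc : ∑ p ∈ P, (A p).card ^ 2 ≤ 4 * D * L.card + 2 * X := by
    have h1 : ∀ p ∈ P, (A p).card ^ 2 ≤ 2 * (A p).card +
        ∑ ℓ ∈ L, if p ∈ ℓ then (L.filter fun ℓ' => p ∈ ℓ' ∧ R ℓ ℓ').card else 0 := by
      intro p hp
      calc (A p).card ^ 2 = ∑ ℓ' ∈ A p, (A p).card := by rw [Finset.sum_const, smul_eq_mul, sq]
        _ ≤ ∑ ℓ' ∈ A p, (2 + ((A p).filter fun ℓ => R ℓ ℓ').card) := Finset.sum_le_sum (ha p)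
        _ = 2 * (A p).card + ∑ ℓ' ∈ A p, ((A p).filter fun ℓ => R ℓ ℓ').card := by
            rw [Finset.sum_add_distrib, Finset.sum_const, smul_eq_mul, mul_comm]
        _ = 2 * (A p).card + ∑ ℓ ∈ A p, ((A p).filter fun ℓ' => R ℓ ℓ').card := by
            congr 1
            exact (Finset.sum_card_bipartiteAbove_eq_sum_card_bipartiteBelow (s := A p) (t := A p) R).symm
        _ ≤ 2 * (A p).card + ∑ ℓ ∈ L, if p ∈ ℓ then (L.filter fun ℓ' => p ∈ ℓ' ∧ R ℓ ℓ').card else 0 := by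
            refine Nat.add_le_add_left ?_ _
            rw [← Finset.sum_filter]
            calc _ ≤ ∑ ℓ ∈ A p, (L.filter fun ℓ' => p ∈ ℓ' ∧ R ℓ ℓ').card := by
                  refine Finset.sum_le_sum fun ℓ _ => Finset.card_le_card fun ℓ' h => ?_
                  rw [Finset.mem_filter] at h ⊢
                  obtain ⟨h1, h2, -⟩ := hA h.1
                  exact ⟨h1, h2, h.2⟩
              _ ≤ _ := by
                  refine Finset.sum_le_sum_of_subset fun ℓ h => ?_
                  obtain ⟨h1, h2, -⟩ := hA h
                  exact Finset.mem_filter.mpr ⟨h1, h2⟩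
    refine (Finset.sum_le_sum h1).trans ?_
    rw [Finset.sum_add_distrib, ← Finset.mul_sum, Finset.sum_comm, add_comm]
    refine Nat.add_le_add_right ?_ _
    calc _ ≤ ∑ ℓ ∈ L, 4 * D := by
          refine Finset.sum_le_sum fun ℓ hℓ => ?_
          rw [← Finset.sum_filter]
          exact hb' ℓ hℓ
      _ = 4 * D * L.card := by rw [Finset.sum_const, smul_eq_mul, mul_comm]
  refine ⟨X, ?_, ?_⟩
  · have h1 : ((P ×ˢ L).filter fun z => z.1 ∈ z.2) ⊆
        ((P ×ˢ L).filter fun z => z.1 ∈ z.2 ∧ IsExceptionalPoint (Zs (comp z.2)) z.1) ∪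
        ((P ×ˢ L).filter fun z => z.1 ∈ z.2 ∧ ¬ IsExceptionalPoint (Zs (comp z.2)) z.1) := by
      intro z hz
      simp only [Finset.mem_union, Finset.mem_filter] at hz ⊢
      tauto
    refine (Finset.card_le_card h1).trans ((Finset.card_union_le _ _).trans (add_le_add ?_ ?_))
    · refine Finset.card_le_card_of_injOn Prod.snd ?_ ?_
      · intro z hz
        have hz := Finset.mem_coe.mp hz
        simp only [Finset.mem_filter, Finset.mem_product] at hz
        exact hz.1.2
      · rintro ⟨p, ℓ⟩ hz ⟨p', ℓ'⟩ hz' h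
        have hz := Finset.mem_coe.mp hz
        have hz' := Finset.mem_coe.mp hz'
        simp only at h
        subst h
        simp only [Finset.mem_filter, Finset.mem_product] at hz hz'
        have hS := hcomp ℓ hz.1.2
        rw [two_cone _ (hirr _ hS) (hdeg _ hS) p p' hz.2.2 hz'.2.2]
    · rw [Finset.card_eq_sum_card_fiberwise (f := Prod.fst) (t := P)]
      · refine Finset.sum_le_sum fun p hp => ?_
        refine Finset.card_le_card_of_injOn Prod.snd ?_ ?_
        · intro z hz
          have hz := Finset.mem_coe.mp hz
          simp only [Finset.mem_filter, Finset.mem_product] at hz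
          obtain ⟨⟨⟨-, h1⟩, h2, h3⟩, rfl⟩ := hz
          exact Finset.mem_coe.mpr (Finset.mem_filter.mpr ⟨h1, h2, h3⟩)
        · rintro ⟨p1, ℓ⟩ hz ⟨p', ℓ'⟩ hz' h
          have hz := Finset.mem_coe.mp hz
          have hz' := Finset.mem_coe.mp hz'
          simp only [Finset.mem_filter, Finset.mem_product] at hz hz' h
          rw [Prod.mk.injEq]
          exact ⟨hz.2.trans hz'.2.symm, h⟩
      · intro z hz
        have hz := Finset.mem_coe.mp hz
        simp only [Finset.mem_filter, Finset.mem_product] at hz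
        exact hz.1.1
  · refine le_trans ?_ (Nat.mul_le_mul_left _ hc)
    exact sq_sum_le_card_mul_sum_sq

open MvPolynomial
open scoped Classical

lemma factor_set (f : MvPolynomial (Fin 3) ℝ) (hf : f ≠ 0) :
    ∃ S : Finset (MvPolynomial (Fin 3) ℝ), (∀ s ∈ S, Irreducible s ∧ s ∣ f) ∧
      ∑ s ∈ S, s.totalDegree ≤ f.totalDegree ∧ ∀ x, eval x f = 0 → ∃ s ∈ S, eval x s = 0 := by
  induction f using WfDvdMonoid.induction_on_irreducible with
  | zero => exact (hf rfl).elim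
  | unit u hu =>
    refine ⟨∅, by simp, by simp, fun x hx => ?_⟩
    have := hu.map (eval x)
    rw [hx] at this
    exact (not_isUnit_zero this).elim
  | mul a i ha hi ih =>
    obtain ⟨S, h1, h2, h3⟩ := ih ha
    refine ⟨insert i S, ?_, ?_, ?_⟩
    · intro s hs
      rcases Finset.mem_insert.mp hs with rfl | hs
      · exact ⟨hi, dvd_mul_right _ _⟩
      · exact ⟨(h1 s hs).1, (h1 s hs).2.mul_left _⟩
    · rw [totalDegree_mul_of_isDomain hi.ne_zero ha]
      by_cases h : i ∈ S
      · rw [Finset.insert_eq_of_mem h]; omega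
      · rw [Finset.sum_insert h]; omega
    · intro x hx
      rw [map_mul, mul_eq_zero] at hx
      rcases hx with hx | hx
      · exact ⟨i, Finset.mem_insert_self _ _, hx⟩
      · obtain ⟨s, hs, h⟩ := h3 x hx
        exact ⟨s, Finset.mem_insert_of_mem hs, h⟩

lemma line_in_comp (S : Finset (MvPolynomial (Fin 3) ℝ)) (ℓ : Set (Fin 3 → ℝ)) (hℓ : IsLine ℓ)
    (h : ∀ x ∈ ℓ, ∃ s ∈ S, eval x s = 0) : ∃ s ∈ S, IsLineIn (Zs s) ℓ := by
  obtain ⟨p, v, hv, rfl⟩ := hℓ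
  have h1 : (∏ s ∈ S, lineP p v s) = 0 := by
    apply Polynomial.funext
    intro t
    obtain ⟨s, hs, he⟩ := h (p + t • v) ⟨t, rfl⟩
    rw [Polynomial.eval_prod, Polynomial.eval_zero]
    refine Finset.prod_eq_zero hs ?_
    rw [lineP_eval, he]
  obtain ⟨s, hs, h2⟩ := Finset.prod_eq_zero_iff.mp h1
  refine ⟨s, hs, line_in_of hv fun t => ?_⟩
  rw [← lineP_eval, h2, Polynomial.eval_zero]

lemma quad_bound (X m n D : ℝ) (hX : 0 ≤ X) (hm : 0 ≤ m) (hn : 0 ≤ n) (hD : 0 ≤ D)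
    (h : X ^ 2 ≤ m * (4 * D * n + 2 * X)) : X ≤ 2 * Real.sqrt (m * n * D) + 2 * m := by
  set r := Real.sqrt (m * n * D) with hr
  have hr0 : 0 ≤ r := Real.sqrt_nonneg _
  have hr2 : r ^ 2 = m * n * D := Real.sq_sqrt (by positivity)
  by_contra hc
  push Not at hc
  have : X * (X - 2 * m) ≤ 4 * r ^ 2 := by rw [hr2]; linarith
  nlinarith [mul_nonneg hr0 hm]

open MvPolynomial
open scoped Classical

lemma main_fin (f : MvPolynomial (Fin 3) ℝ) (D : ℕ) (hfD : f.totalDegree = D) (hD : 1 < D)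
    (hlin : ¬ ∃ g h : MvPolynomial (Fin 3) ℝ, f = g * h ∧ g.totalDegree = 1)
    (P : Finset (Fin 3 → ℝ)) (L : Finset (Set (Fin 3 → ℝ))) (hL : ∀ ℓ ∈ L, IsLineIn (Zs f) ℓ) :
    ∃ L₀ ⊆ L, L₀.card ≤ 54 * D ^ 2 ∧ ∃ X : ℕ,
      ((P ×ˢ (L \ L₀)).filter fun z => z.1 ∈ z.2).card ≤ L.card + X ∧
      X ^ 2 ≤ P.card * (4 * D * L.card + 2 * X) := by
  have hf0 : f ≠ 0 := by rintro rfl; simp at hfD; omega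
  obtain ⟨S, hS, hsum, hcov⟩ := factor_set f hf0
  rw [hfD] at hsum
  have hdeg : ∀ s ∈ S, 2 ≤ s.totalDegree := by
    intro s hs
    have h1 := irr_deg_pos (hS s hs).1
    have h2 : s.totalDegree ≠ 1 := by
      intro h
      obtain ⟨k, hk⟩ := (hS s hs).2
      exact hlin ⟨s, k, hk, h⟩
    omega
  have hB : ∀ s, ∃ B, s ∈ S → Aux s B := by
    intro s
    by_cases h : s ∈ S
    · obtain ⟨B, hB⟩ := exists_aux s (hS s h).1 (hdeg s h)
      exact ⟨B, fun _ => hB⟩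
    · exact ⟨0, fun h' => (h h').elim⟩
  choose Bf hBf using hB
  have hc : ∀ ℓ : Set (Fin 3 → ℝ), ∃ s, ℓ ∈ L → s ∈ S ∧ IsLineIn (Zs s) ℓ := by
    intro ℓ
    by_cases h : ℓ ∈ L
    · obtain ⟨s, hs, h1⟩ := line_in_comp S ℓ (hL ℓ h).1 fun x hx => hcov x ((hL ℓ h).2 hx)
      exact ⟨s, fun _ => ⟨hs, h1⟩⟩
    · exact ⟨0, fun h' => (h h').elim⟩
  choose comp hcomp using hc
  let L₀ := L.filter fun ℓ => ℓ ⊆ Zs (Bf (comp ℓ))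
  refine ⟨L₀, Finset.filter_subset _ _, ?_, ?_⟩
  · rw [Finset.card_eq_sum_card_fiberwise (f := comp) (t := S)
      (fun ℓ h => (hcomp ℓ (Finset.mem_filter.mp h).1).1)]
    calc _ ≤ ∑ s ∈ S, 54 * s.totalDegree * D := by
          refine Finset.sum_le_sum fun s hs => ?_
          have h1 := bezout_lines s (Bf s) (hS s hs).1 (hBf s hs).ndvd (L₀.filter fun ℓ => comp ℓ = s)
            (by
              intro ℓ hℓ
              obtain ⟨h1, rfl⟩ := Finset.mem_filter.mp hℓ
              exact (hcomp ℓ (Finset.mem_filter.mp h1).1).2)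
            (by
              intro ℓ hℓ
              obtain ⟨h1, rfl⟩ := Finset.mem_filter.mp hℓ
              exact (Finset.mem_filter.mp h1).2)
          have h2 := (hBf s hs).deg
          have h3 : s.totalDegree ≤ D := (Finset.single_le_sum (f := fun s : MvPolynomial (Fin 3) ℝ => s.totalDegree)
            (fun _ _ => Nat.zero_le _) hs).trans hsum
          calc _ ≤ 2 * s.totalDegree * (Bf s).totalDegree := h1
            _ ≤ 2 * s.totalDegree * (27 * D) := by gcongr; omega
            _ = 54 * s.totalDegree * D := by ring
      _ = 54 * (∑ s ∈ S, s.totalDegree) * D := by rw [Finset.mul_sum, Finset.sum_mul]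
      _ ≤ 54 * D * D := by gcongr
      _ = 54 * D ^ 2 := by ring
  · have hm : ∀ ℓ ∈ L \ L₀, ℓ ∈ L := fun ℓ h => (Finset.mem_sdiff.mp h).1
    obtain ⟨X, h1, h2⟩ := core S Bf (fun s hs => (hS s hs).1) hdeg hBf D hsum (L \ L₀) comp
      (fun ℓ h => (hcomp ℓ (hm ℓ h)).1) (fun ℓ h => (hcomp ℓ (hm ℓ h)).2)
      (fun ℓ h h' => (Finset.mem_sdiff.mp h).2 (Finset.mem_filter.mpr ⟨hm ℓ h, h'⟩)) P
    have hle : (L \ L₀).card ≤ L.card := Finset.card_le_card Finset.sdiff_subset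
    refine ⟨X, h1.trans (by omega), h2.trans ?_⟩
    gcongr

/-- Theorem 3 ('salta'): for a surface `V = Z(f)` of degree `D > 1` in ℝ³ with
no linear components, a set `P` of `m` points on `V` and a set `L` of `n`
lines fully contained in `V`, there is a subset `L₀ ⊆ L` of `O(D²)` lines with
`I(P, L \ L₀) = O(m^{1/2} n^{1/2} D^{1/2} + m + n)`. -/
theorem stmt_15 :
    ∃ C : ℝ, 0 < C ∧
      ∀ (f : MvPolynomial (Fin 3) ℝ) (D : ℕ), f.totalDegree = D → 1 < D →
      (¬ ∃ g h : MvPolynomial (Fin 3) ℝ, f = g * h ∧ g.totalDegree = 1) →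
      ∀ V : Set (Fin 3 → ℝ), V = {p | eval p f = 0} →
      ∀ (P : Set (Fin 3 → ℝ)) (L : Set (Set (Fin 3 → ℝ))) (m n : ℕ),
        P.Finite → P.ncard = m → P ⊆ V →
        L.Finite → L.ncard = n → (∀ ℓ ∈ L, IsLineIn V ℓ) →
        ∃ L₀ ⊆ L, (L₀.ncard : ℝ) ≤ C * D ^ 2 ∧
          (({pq : (Fin 3 → ℝ) × Set (Fin 3 → ℝ) |
              pq.1 ∈ P ∧ pq.2 ∈ L \ L₀ ∧ pq.1 ∈ pq.2}).ncard : ℝ)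
            ≤ C * (Real.sqrt ((m : ℝ) * n * D) + m + n) := by
  refine ⟨54, by norm_num, ?_⟩
  intro f D hfD hD hlin V hV P L m n hP hm hPV hL hn hLV
  subst hV
  obtain ⟨L₀, hsub, hcard, X, h1, h2⟩ := main_fin f D hfD hD hlin hP.toFinset hL.toFinset
    (fun ℓ hℓ => hLV ℓ (hL.mem_toFinset.mp hℓ))
  rw [← Set.ncard_eq_toFinset_card P hP, hm, ← Set.ncard_eq_toFinset_card L hL, hn] at h2
  rw [← Set.ncard_eq_toFinset_card L hL, hn] at h1
  refine ⟨(L₀ : Set _), fun ℓ hℓ => hL.mem_toFinset.mp (hsub hℓ), ?_, ?_⟩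
  · rw [Set.ncard_coe_finset]
    exact_mod_cast hcard
  · have he : {pq : (Fin 3 → ℝ) × Set (Fin 3 → ℝ) | pq.1 ∈ P ∧ pq.2 ∈ L \ (L₀ : Set _) ∧ pq.1 ∈ pq.2} =
        ((hP.toFinset ×ˢ (hL.toFinset \ L₀)).filter fun z => z.1 ∈ z.2 : Finset _) := by
      ext z
      simp [and_assoc]
    rw [he, Set.ncard_coe_finset]
    have h3 := quad_bound X m n D (by positivity) (by positivity) (by positivity) (by positivity)
      (by exact_mod_cast h2)
    have h4 : ((((hP.toFinset ×ˢ (hL.toFinset \ L₀)).filter fun z => z.1 ∈ z.2).card : ℕ) : ℝ) ≤ n + X := by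
      exact_mod_cast h1
    have h5 : (0:ℝ) ≤ Real.sqrt ((m:ℝ) * n * D) := Real.sqrt_nonneg _
    have h6 : (0:ℝ) ≤ m := by positivity
    have h7 : (0:ℝ) ≤ n := by positivity
    linarith
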